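/- arXiv:0912.5492 — 2 statements merged into one kernel-verified Lean document; each statement's English description precedes it below -/
import Mathlib

section
/- Let g1 and g2 be metrics on an open set U ⊆ ℝ^N such that at every u ∈ U the matrix v(u) = g1(u) · g2(u)⁻¹ has N pairwise distinct real eigenvalues (a non-singular pair). Then g1 and g2 are compatible if and only if every point of U has an open neighborhood U0 ⊆ U and a smooth diffeomorphism φ : U0 → V onto an open set V ⊆ ℝ^N such that the transformed metrics ĝ_a, defined by ĝ_a^{ij}(φ(u)) = Σ_{k,l} (∂φ^i/∂u^k)(u) (∂φ^j/∂u^l)(u) g_a^{kl}(u) for a = 1, 2, have the special diagonal form ĝ2^{ij}(x) = ĝ^i(x) δ^{ij} and ĝ1^{ij}(x) = f^i(x^i) ĝ^i(x) δ^{ij} for some smooth nowhere-vanishing functions ĝ^1, ..., ĝ^N on V and some smooth nowhere-vanishing functions f^1, ..., f^N of one real variable. -/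
open Matrix

/-- Partial derivative `∂f/∂u^j` of a scalar function on `ℝ^N`. -/
noncomputable def pd {N : ℕ} (f : (Fin N → ℝ) → ℝ) (j : Fin N) (u : Fin N → ℝ) : ℝ :=
  fderiv ℝ f u (Pi.single j 1)

/-- Matrix-valued fields on `ℝ^N` (contravariant metrics, affinors, ...). -/
abbrev MetF (N : ℕ) := (Fin N → ℝ) → Matrix (Fin N) (Fin N) ℝ

/-- `g` is a contravariant metric on `U`: smooth, symmetric and invertible there. -/
def IsMetricOn {N : ℕ} (g : MetF N) (U : Set (Fin N → ℝ)) : Prop :=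
  (∀ i j, ContDiffOn ℝ (⊤ : ℕ∞) (fun u => g u i j) U) ∧
  (∀ u ∈ U, (g u).IsSymm) ∧ (∀ u ∈ U, IsUnit (g u).det)

/-- Christoffel symbols `Γ^i_{jk}` of the Levi-Civita connection of the contravariant metric `g`,
where the covariant metric `g_{ij}` is the matrix inverse of `g`. -/
noncomputable def christoffel {N : ℕ} (g : MetF N) (i j k : Fin N) (u : Fin N → ℝ) : ℝ :=
  (1 / 2) * ∑ s, g u i s *
    (pd (fun v => (g v)⁻¹ s k) j u + pd (fun v => (g v)⁻¹ j s) k u -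
      pd (fun v => (g v)⁻¹ j k) s u)

/-- Raised Christoffel symbols `Γ^{ij}_k = Σ_s g^{is} Γ^j_{sk}`. -/
noncomputable def christoffelR {N : ℕ} (g : MetF N) (i j k : Fin N) (u : Fin N → ℝ) : ℝ :=
  ∑ s, g u i s * christoffel g j s k u

/-- Riemannian curvature tensor `R^i_{jkl}` of the contravariant metric `g`. -/
noncomputable def curvature {N : ℕ} (g : MetF N) (i j k l : Fin N) (u : Fin N → ℝ) : ℝ :=
  pd (christoffel g i j l) k u - pd (christoffel g i j k) l u +
    ∑ p, (christoffel g i p k u * christoffel g p j l u -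
          christoffel g i p l u * christoffel g p j k u)

/-- Raised curvature tensor `R^{ij}_{kl} = Σ_s g^{is} R^j_{skl}`. -/
noncomputable def curvatureR {N : ℕ} (g : MetF N) (i j k l : Fin N) (u : Fin N → ℝ) : ℝ :=
  ∑ s, g u i s * curvature g j s k l u

/-- Two metrics are almost compatible on `U` if the raised Christoffel symbols of every
(invertible) linear combination are the corresponding linear combination. -/
def AlmostCompatibleOn {N : ℕ} (g1 g2 : MetF N) (U : Set (Fin N → ℝ)) : Prop :=
  ∀ l1 l2 : ℝ, ∀ u ∈ U, IsUnit (l1 • g1 u + l2 • g2 u).det →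
    ∀ i j k, christoffelR (fun v => l1 • g1 v + l2 • g2 v) i j k u =
      l1 * christoffelR g1 i j k u + l2 * christoffelR g2 i j k u

/-- Two metrics are compatible on `U` if additionally the raised curvature tensors of every
(invertible) linear combination are the corresponding linear combination. -/
def CompatibleOn {N : ℕ} (g1 g2 : MetF N) (U : Set (Fin N → ℝ)) : Prop :=
  AlmostCompatibleOn g1 g2 U ∧
  ∀ l1 l2 : ℝ, ∀ u ∈ U, IsUnit (l1 • g1 u + l2 • g2 u).det →
    ∀ i j k l, curvatureR (fun v => l1 • g1 v + l2 • g2 v) i j k l u =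
      l1 * curvatureR g1 i j k l u + l2 * curvatureR g2 i j k l u

/-- The Nijenhuis tensor `N^k_{ij}` of an affinor `v^i_j(u)`. -/
noncomputable def nijenhuisT {N : ℕ} (v : MetF N) (k i j : Fin N) (u : Fin N → ℝ) : ℝ :=
  ∑ s, (v u s i * pd (fun w => v w k j) s u - v u s j * pd (fun w => v w k i) s u +
        v u k s * pd (fun w => v w s i) j u - v u k s * pd (fun w => v w s j) i u)

/-- A pair of metrics is non-singular on `U` if at every point the affinor `v = g1 · g2⁻¹` has `N`
pairwise distinct real eigenvalues. -/
def NonSingularPairOn {N : ℕ} (g1 g2 : MetF N) (U : Set (Fin N → ℝ)) : Prop :=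
  ∀ u ∈ U, ∃ f : Fin N → ℝ, Function.Injective f ∧
    (g1 u * (g2 u)⁻¹).charpoly = ∏ i, (Polynomial.X - Polynomial.C (f i))

section
namespace RI
open Set Topology Filter
open scoped ContDiff

lemma inv_local {E F : Type} [NormedAddCommGroup E] [NormedSpace ℝ E] [CompleteSpace E]
    [NormedAddCommGroup F] [NormedSpace ℝ F] (f : E → F) (O : Set E) (hO : IsOpen O)
    (hf : ContDiffOn ℝ ∞ f O) (a : E) (ha : a ∈ O) (f' : E ≃L[ℝ] F)
    (hf' : HasFDerivAt f (f' : E →L[ℝ] F) a) :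
    ∃ T : OpenPartialHomeomorph E F, (T : E → F) = f ∧ a ∈ T.source ∧ T.source ⊆ O ∧
      ∀ y ∈ T.target, ContDiffAt ℝ ∞ T.symm y := by
  have hfa : ContDiffAt ℝ ∞ f a := hf.contDiffAt (hO.mem_nhds ha)
  let T0 := hfa.toOpenPartialHomeomorph f hf' (by simp)
  have hT0 : (T0 : E → F) = f := rfl
  have haT : a ∈ T0.source := hfa.mem_toOpenPartialHomeomorph_source hf' (by simp)
  have hc : ContinuousOn (fderiv ℝ f) O := hf.continuousOn_fderiv_of_isOpen hO (by simp)
  let S := O ∩ fderiv ℝ f ⁻¹' (Set.range ((↑) : (E ≃L[ℝ] F) → (E →L[ℝ] F)))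
  have hS : IsOpen S := hc.isOpen_inter_preimage hO ContinuousLinearEquiv.isOpen
  refine ⟨T0.restrOpen S hS, rfl, ?_, ?_, ?_⟩
  · refine ⟨haT, ha, f', ?_⟩
    exact hf'.fderiv.symm
  · intro x hx
    exact hx.2.1
  · intro y hy
    have hx := (T0.restrOpen S hS).map_target hy
    obtain ⟨-, hxO, e, he⟩ := hx
    refine OpenPartialHomeomorph.contDiffAt_symm _ hy (f₀' := e) ?_ ?_
    · rw [he]
      exact ((hf.contDiffAt (hO.mem_nhds hxO)).differentiableAt (by simp)).hasFDerivAt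
    · exact hf.contDiffAt (hO.mem_nhds hxO)

lemma implicit_local {E F : Type} [NormedAddCommGroup E] [NormedSpace ℝ E] [CompleteSpace E]
    [NormedAddCommGroup F] [NormedSpace ℝ F] [CompleteSpace F]
    (Φ : E × F → F) (O : Set (E × F)) (hO : IsOpen O)
    (hΦ : ContDiffOn ℝ ∞ Φ O) (a : E) (b : F) (hab : (a, b) ∈ O)
    (hd : HasFDerivAt (fun z => Φ (a, z)) (ContinuousLinearMap.id ℝ F) b) :
    ∃ ζ : E → F, ∃ W : Set E, IsOpen W ∧ a ∈ W ∧ ContDiffOn ℝ ∞ ζ W ∧ ζ a = b ∧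
      ∀ u ∈ W, (u, ζ u) ∈ O ∧ Φ (u, ζ u) = Φ (a, b) := by
  have hΦd := ((hΦ.contDiffAt (hO.mem_nhds hab)).differentiableAt (by simp)).hasFDerivAt
  set D := fderiv ℝ Φ (a, b) with hD
  have h2 : ∀ z, D (0, z) = z := by
    intro z
    have h1 : HasFDerivAt (fun z => Φ (a, z)) (D ∘L .inr ℝ E F) b :=
      hΦd.comp b (hasFDerivAt_prodMk_right a b)
    have := congrArg (fun A : F →L[ℝ] F => A z) (h1.unique hd)
    simpa using this
  have h3 : ∀ x z, D (x, z) = D (x, 0) + z := by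
    intro x z
    rw [← h2 z, ← map_add]; simp [h2]
  let f1 : E × F →L[ℝ] E × F := (ContinuousLinearMap.fst ℝ E F).prod D
  let f2 : E × F →L[ℝ] E × F := (ContinuousLinearMap.fst ℝ E F).prod
    (ContinuousLinearMap.snd ℝ E F - D ∘L (.inl ℝ E F) ∘L (.fst ℝ E F))
  let f' : (E × F) ≃L[ℝ] (E × F) := ContinuousLinearEquiv.equivOfInverse f1 f2
    (by rintro ⟨x, z⟩; simp [f1, f2, h3 x z])
    (by rintro ⟨x, z⟩; simp [f1, f2]; rw [h3]; simp)
  let f : E × F → E × F := fun q => (q.1, Φ q)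
  have hf : ContDiffOn ℝ ∞ f O := contDiffOn_fst.prodMk hΦ
  obtain ⟨T, hT, haT, hTO, hTs⟩ := inv_local f O hO hf (a, b) hab f'
    (hasFDerivAt_fst.prodMk hΦd)
  have hinl : Continuous (fun u : E => (u, Φ (a, b))) := by fun_prop
  refine ⟨fun u => (T.symm (u, Φ (a, b))).2, (fun u => (u, Φ (a, b))) ⁻¹' T.target,
    T.open_target.preimage hinl, ?_, ?_, ?_, ?_⟩
  · have := T.map_source haT
    rw [hT] at this
    exact this
  · intro u hu
    have h4 := hTs _ hu
    have h5 : ContDiffAt ℝ ∞ (fun u : E => (u, Φ (a, b))) u := by fun_prop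
    exact (contDiff_snd.contDiffAt.comp u (h4.comp u h5)).contDiffWithinAt
  · have := T.left_inv haT
    rw [hT] at this
    exact congrArg Prod.snd this
  · intro u hu
    have h4 := T.right_inv hu
    have h5 := hTO (T.map_target hu)
    rw [hT] at h4
    have h6 : (T.symm (u, Φ (a, b))).1 = u := congrArg Prod.fst h4
    have h7 : (u, (T.symm (u, Φ (a, b))).2) = T.symm (u, Φ (a, b)) := by
      rw [Prod.ext_iff]; exact ⟨h6.symm, rfl⟩
    simp only [h7]
    exact ⟨h5, congrArg Prod.snd h4⟩
end RI
end

section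
namespace RI
open Set Topology Filter
open scoped ContDiff unitInterval

section nem
variable {K : Type} [TopologicalSpace K] [CompactSpace K]
variable {E G : Type} [NormedAddCommGroup E] [NormedSpace ℝ E]
  [NormedAddCommGroup G] [NormedSpace ℝ G]

/-- pointwise application as a continuous bilinear map -/
noncomputable def appL : C(K, E →L[ℝ] G) →L[ℝ] (C(K, E) →L[ℝ] C(K, G)) :=
  LinearMap.mkContinuous₂
    (LinearMap.mk₂ ℝ (fun (A : C(K, E →L[ℝ] G)) (h : C(K, E)) =>
        (⟨fun s => A s (h s), by fun_prop⟩ : C(K, G)))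
      (by intro a b c; ext s; simp) (by intro a b c; ext s; simp)
      (by intro a b c; ext s; simp) (by intro a b c; ext s; simp)) 1
    (by
      intro A h
      rw [ContinuousMap.norm_le _ (by positivity)]
      intro s
      simp only [LinearMap.mk₂_apply, ContinuousMap.coe_mk, one_mul]
      exact (A s).le_of_opNorm_le_of_le (A.norm_coe_le_norm s) (h.norm_coe_le_norm s))

@[simp] lemma appL_apply (A : C(K, E →L[ℝ] G)) (h : C(K, E)) (s : K) :
    appL A h s = A s (h s) := rfl

/-- the superposition operator -/
def nem (F : C(E, G)) (γ : C(K, E)) : C(K, G) := F.comp γ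

@[simp] lemma nem_apply (F : C(E, G)) (γ : C(K, E)) (s : K) : nem F γ s = F (γ s) := rfl

lemma nem_hasFDerivAt (F : C(E, G)) (F' : C(E, E →L[ℝ] G)) (h : ∀ x, HasFDerivAt F (F' x) x)
    (γ : C(K, E)) : HasFDerivAt (nem (K := K) F) (appL (nem F' γ)) γ := by
  rw [hasFDerivAt_iff_isLittleO_nhds_zero, Asymptotics.isLittleO_iff]
  intro ε hε
  have hc : IsCompact (Set.range γ) := isCompact_range γ.continuous
  have h1 := hc.uniformContinuousAt_of_continuousAt F' (fun x _ => F'.continuous.continuousAt)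
    (Metric.dist_mem_uniformity hε)
  rw [Metric.mem_uniformity_dist] at h1
  obtain ⟨δ, hδ, h1⟩ := h1
  filter_upwards [Metric.ball_mem_nhds (0 : C(K, E)) hδ] with η hη
  rw [ContinuousMap.norm_le _ (by positivity)]
  intro s
  have hηs : ‖η s‖ ≤ ‖η‖ := η.norm_coe_le_norm s
  have hη' : ‖η‖ < δ := by simpa using hη
  have := Convex.norm_image_sub_le_of_norm_hasFDerivWithin_le' (f := F) (f' := F') (C := ε)
    (s := Metric.ball (γ s) δ) (x := γ s) (y := γ s + η s) (φ := F' (γ s)) (𝕜 := ℝ)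
    (fun x _ => (h x).hasFDerivWithinAt)
    (by
      intro x hx
      have := h1 (a := γ s) (b := x) (by rw [dist_comm]; exact hx) ⟨s, rfl⟩
      rw [← dist_eq_norm, dist_comm]
      exact le_of_lt this)
    (convex_ball _ _) (Metric.mem_ball_self hδ)
    (by simp; linarith)
  simp only [ContinuousMap.sub_apply, nem_apply, ContinuousMap.add_apply, appL_apply]
  simp only [add_sub_cancel_left] at this
  exact this.trans (by gcongr)

lemma nem_contDiff_nat (n : ℕ) : ∀ {G : Type} [NormedAddCommGroup G] [NormedSpace ℝ G]
    (F : C(E, G)), ContDiff ℝ n F → ContDiff ℝ n (nem (K := K) F) := by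
  induction n with
  | zero =>
    intro G _ _ F hF
    simp only [Nat.cast_zero, contDiff_zero]
    exact ContinuousMap.continuous_postcomp F
  | succ n ih =>
    intro G _ _ F hF
    have hF' := hF
    push_cast at hF ⊢
    rw [contDiff_succ_iff_fderiv] at hF
    obtain ⟨h1, -, h3⟩ := hF
    let F' : C(E, E →L[ℝ] G) := ⟨fderiv ℝ F, h3.continuous⟩
    have hd := nem_hasFDerivAt (K := K) F F' (fun x => (h1 x).hasFDerivAt)
    rw [contDiff_succ_iff_fderiv]
    refine ⟨fun γ => (hd γ).differentiableAt, by simp, ?_⟩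
    have : fderiv ℝ (nem (K := K) F) = fun γ => appL (nem F' γ) := by
      ext1 γ; exact (hd γ).fderiv
    rw [this]
    exact appL.contDiff.comp (ih F' h3)

lemma nem_contDiff (F : C(E, G)) (hF : ContDiff ℝ ∞ F) : ContDiff ℝ ∞ (nem (K := K) F) := by
  rw [contDiff_infty] at hF ⊢
  exact fun n => nem_contDiff_nat n F (hF n)

end nem

/-- Volterra integration operator -/
noncomputable def volt : C(I, ℝ) →L[ℝ] C(I, ℝ) :=
  LinearMap.mkContinuous
    { toFun := fun x => ⟨fun s => ∫ t in (0:ℝ)..s, x.IccExtend zero_le_one t, by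
        have : Continuous fun b : ℝ => ∫ t in (0:ℝ)..b, x.IccExtend zero_le_one t :=
          intervalIntegral.continuous_primitive
            (fun a b => (ContinuousMap.continuous _).intervalIntegrable _ _) 0
        exact this.comp continuous_subtype_val⟩
      map_add' := by
        intro x y
        ext s
        simp only [ContinuousMap.coe_mk, ContinuousMap.add_apply]
        rw [← intervalIntegral.integral_add
          ((ContinuousMap.continuous _).intervalIntegrable _ _)
          ((ContinuousMap.continuous _).intervalIntegrable _ _)]
        rfl
      map_smul' := by
        intro c x
        ext s
        simp only [ContinuousMap.coe_mk, ContinuousMap.smul_apply, RingHom.id_apply]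
        rw [← intervalIntegral.integral_smul]
        rfl } 1
    (by
      intro x
      rw [ContinuousMap.norm_le _ (by positivity)]
      intro s
      have := intervalIntegral.norm_integral_le_of_norm_le_const (a := 0) (b := (s:ℝ))
        (f := x.IccExtend zero_le_one) (C := ‖x‖) (fun t _ => x.norm_coe_le_norm _)
      simp only [LinearMap.coe_mk, AddHom.coe_mk, ContinuousMap.coe_mk, one_mul]
      refine this.trans ?_
      have h0 := s.2.1
      have h1 := s.2.2
      rw [sub_zero, abs_of_nonneg h0]
      exact mul_le_of_le_one_right (norm_nonneg _) h1)

lemma volt_apply (x : C(I, ℝ)) (s : I) :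
    volt x s = ∫ t in (0:ℝ)..s, x.IccExtend zero_le_one t := rfl

section ode
variable {E : Type} [NormedAddCommGroup E] [NormedSpace ℝ E]

noncomputable def constL : E →L[ℝ] C(I, E) :=
  LinearMap.mkContinuous
    { toFun := fun u => ContinuousMap.const I u
      map_add' := by intros; rfl
      map_smul' := by intros; rfl } 1
    (by
      intro u
      rw [ContinuousMap.norm_le _ (by positivity)]
      intro s; rw [one_mul]; exact le_refl ‖u‖)

@[simp] lemma constL_apply (u : E) (s : I) : constL u s = u := rfl

/-- linear part of `(u, ζ) ↦ (s ↦ (s, u, ζ s))` -/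
noncomputable def pathL : (E × C(I, ℝ)) →L[ℝ] C(I, ℝ × E × ℝ) :=
  LinearMap.mkContinuous
    { toFun := fun q => ⟨fun s => (0, q.1, q.2 s), by fun_prop⟩
      map_add' := by intros; ext s <;> simp
      map_smul' := by intros; ext s <;> simp } 1
    (by
      intro q
      rw [ContinuousMap.norm_le _ (by positivity)]
      intro s
      have h1 := q.2.norm_coe_le_norm s
      simp only [LinearMap.coe_mk, AddHom.coe_mk, ContinuousMap.coe_mk, one_mul]
      rw [Prod.norm_def, Prod.norm_def, Prod.norm_def]
      simp only [norm_zero]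
      refine max_le (by positivity) (max_le (le_max_left _ _) (h1.trans (le_max_right _ _))))

@[simp] lemma pathL_apply (q : E × C(I, ℝ)) (s : I) : pathL q s = (0, q.1, q.2 s) := rfl

lemma pathL_contDiff : ContDiff ℝ ∞ (fun q : E × C(I, ℝ) => pathL q) :=
  ContinuousLinearMap.contDiff (𝕜 := ℝ) (E := E × C(I, ℝ)) (F := C(I, ℝ × E × ℝ)) pathL

lemma pathL_hasFDerivAt (q : E × C(I, ℝ)) :
    HasFDerivAt (fun q : E × C(I, ℝ) => pathL q) pathL q :=
  ContinuousLinearMap.hasFDerivAt (𝕜 := ℝ) (E := E × C(I, ℝ)) (F := C(I, ℝ × E × ℝ)) pathL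

lemma constL_contDiff : ContDiff ℝ ∞ (fun q : E => constL q) :=
  ContinuousLinearMap.contDiff (𝕜 := ℝ) (E := E) (F := C(I, E)) constL

lemma constL_hasFDerivAt (q : E) :
    HasFDerivAt (fun q : E => constL q) constL q :=
  ContinuousLinearMap.hasFDerivAt (𝕜 := ℝ) (E := E) (F := C(I, E)) constL

lemma volt_contDiff : ContDiff ℝ ∞ (fun q : C(I, ℝ) => volt q) :=
  ContinuousLinearMap.contDiff (𝕜 := ℝ) (E := C(I, ℝ)) (F := C(I, ℝ)) volt

lemma volt_hasFDerivAt (q : C(I, ℝ)) :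
    HasFDerivAt (fun q : C(I, ℝ) => volt q) volt q :=
  ContinuousLinearMap.hasFDerivAt (𝕜 := ℝ) (E := C(I, ℝ)) (F := C(I, ℝ)) volt

noncomputable def path0 : C(I, ℝ × E × ℝ) := ⟨fun s => (s, 0, 0), by fun_prop⟩

@[simp] lemma path0_apply (s : I) : path0 (E := E) s = ((s:ℝ), 0, 0) := rfl

set_option maxHeartbeats 1000000 in
/-- Smooth dependence on parameters, with the variational equation. -/
theorem ode_param [CompleteSpace E] (F : ℝ × E × ℝ → ℝ) (hF : ContDiff ℝ ∞ F) (c : E → ℝ)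
    (hc : ContDiff ℝ ∞ c) (u0 : E) (h0 : ∀ s z, F (s, u0, z) = 0) :
    ∃ ζ : E → C(I, ℝ), ∃ W : Set E, IsOpen W ∧ u0 ∈ W ∧
      ContDiffOn ℝ ∞ ζ W ∧ ζ u0 = constL (c u0) ∧
      ∀ u ∈ W, ∃ η : E → C(I, ℝ), HasFDerivAt ζ (fderiv ℝ ζ u) u ∧
        (∀ k, η k = fderiv ℝ ζ u k) ∧
        (∀ s : I, ζ u s = c u + ∫ t in (0:ℝ)..s, F (projIcc 0 1 zero_le_one t, u,
            ζ u (projIcc 0 1 zero_le_one t))) ∧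
        (∀ k, ∀ s : I, η k s = fderiv ℝ c u k + ∫ t in (0:ℝ)..s,
          fderiv ℝ F (projIcc 0 1 zero_le_one t, u, ζ u (projIcc 0 1 zero_le_one t))
            (0, k, η k (projIcc 0 1 zero_le_one t))) := by
  let Fc : C(ℝ × E × ℝ, ℝ) := ⟨F, hF.continuous⟩
  let F' : C(ℝ × E × ℝ, (ℝ × E × ℝ) →L[ℝ] ℝ) :=
    ⟨fderiv ℝ F, hF.continuous_fderiv (by simp)⟩
  have hd := nem_hasFDerivAt (K := I) Fc F'
    (fun x => (hF.differentiable (by simp) x).hasFDerivAt)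
  let M : E × C(I, ℝ) → C(I, ℝ) := fun q => volt (nem Fc (path0 + pathL q))
  have hM : ContDiff ℝ ∞ M := by
    refine volt_contDiff.comp ((nem_contDiff Fc hF).comp ?_)
    exact contDiff_const.add pathL_contDiff
  have hMd : ∀ q, HasFDerivAt M (volt ∘L (appL (nem F' (path0 + pathL q))) ∘L pathL) q := by
    intro q
    refine (volt_hasFDerivAt _).comp q ((hd _).comp q ?_)
    exact (pathL_hasFDerivAt _).const_add _
  let Φ : E × C(I, ℝ) → C(I, ℝ) := fun q => q.2 - constL (c q.1) - M q
  have hΦ : ContDiff ℝ ∞ Φ := by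
    refine (contDiff_snd.sub (constL_contDiff.comp (hc.comp contDiff_fst))).sub hM
  let q0 : E × C(I, ℝ) := (u0, constL (c u0))
  have hM0 : ∀ z, M (u0, z) = 0 := by
    intro z
    have : nem Fc (path0 + pathL (u0, z)) = 0 := by
      ext s; simp [Fc, h0]
    simp [M, this]
  have hinv : HasFDerivAt (fun z => Φ (u0, z)) (ContinuousLinearMap.id ℝ _) (constL (c u0)) := by
    have h2 : (fun z => Φ (u0, z)) = fun z => z - constL (c u0) := by
      ext1 z; simp [Φ, hM0]
    rw [h2]
    exact (hasFDerivAt_id _).sub_const _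
  have hΦ0 : Φ q0 = 0 := by simp [Φ, q0, hM0]
  obtain ⟨ζ, W, hWo, hW0, hζ, hζ0, hev⟩ := implicit_local Φ univ isOpen_univ hΦ.contDiffOn u0
    (constL (c u0)) (mem_univ _) hinv
  refine ⟨ζ, W, hWo, hW0, hζ, hζ0, ?_⟩
  intro u huW
  have hdu : DifferentiableAt ℝ ζ u :=
    (hζ.contDiffAt (hWo.mem_nhds huW)).differentiableAt (by simp)
  have hu : ∀ᶠ v in 𝓝 u, Φ (v, ζ v) = 0 := by
    filter_upwards [hWo.mem_nhds huW] with v hv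
    exact (hev v hv).2.trans hΦ0
  refine ⟨fun k => fderiv ℝ ζ u k, hdu.hasFDerivAt, fun k => rfl, ?_, ?_⟩
  · intro s
    have h1 : ζ u - constL (c u) - M (u, ζ u) = 0 := hu.self_of_nhds
    have h2 := congrArg (fun x : C(I, ℝ) => x s) h1
    simp only [ContinuousMap.sub_apply, constL_apply, ContinuousMap.zero_apply, M, volt_apply] at h2
    have h3 : ζ u s = c u + ∫ t in (0:ℝ)..s,
      (nem Fc (path0 + pathL (u, ζ u))).IccExtend zero_le_one t := by linarith
    rw [h3]
    congr 1
    apply intervalIntegral.integral_congr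
    intro t _
    simp [Fc, ContinuousMap.IccExtend, Set.IccExtend]
  · intro k s
    have h1 : HasFDerivAt (fun u => ζ u) (constL ∘L (fderiv ℝ c u) +
        (volt ∘L (appL (nem F' (path0 + pathL (u, ζ u)))) ∘L pathL) ∘L
          ((ContinuousLinearMap.id ℝ E).prod (fderiv ℝ ζ u))) u := by
      have e : (fun u => ζ u) =ᶠ[𝓝 u] fun u => constL (c u) + M (u, ζ u) := by
        filter_upwards [hu] with v hv
        have hv' : ζ v - constL (c v) - M (v, ζ v) = 0 := hv
        rw [sub_sub, sub_eq_zero] at hv'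
        exact hv'
      refine HasFDerivAt.congr_of_eventuallyEq ?_ e
      refine ((constL_hasFDerivAt _).comp u (hc.differentiable (by simp) u).hasFDerivAt).add ?_
      exact (hMd (u, ζ u)).comp u ((hasFDerivAt_id u).prodMk hdu.hasFDerivAt)
    have h2 := congrArg (fun A : E →L[ℝ] C(I, ℝ) => A k s) h1.fderiv
    have h3 : (fun u => ζ u) = ζ := rfl
    rw [h3] at h2
    simp only [_root_.add_apply, ContinuousLinearMap.comp_apply,
      ContinuousMap.add_apply, constL_apply, volt_apply] at h2
    rw [h2]
    congr 1
    apply intervalIntegral.integral_congr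
    intro t _
    simp [F', ContinuousMap.IccExtend, Set.IccExtend]

end ode
end RI
end

section
namespace RI
open Set Topology Filter
open scoped ContDiff unitInterval

lemma hasDeriv_of_integral (X : C(I, ℝ)) (φ : ℝ → ℝ) (hφ : Continuous φ) (c : ℝ)
    (h : ∀ s : I, X s = c + ∫ t in (0:ℝ)..s, φ t) (x : ℝ) (hx : x ∈ Ico (0:ℝ) 1) :
    HasDerivWithinAt (fun t => X (projIcc 0 1 zero_le_one t)) (φ x) (Ici x) x := by
  have h1 : HasDerivAt (fun t : ℝ => c + ∫ τ in (0:ℝ)..t, φ τ) (φ x) x :=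
    (hφ.integral_hasStrictDerivAt 0 x).hasDerivAt.const_add c
  refine h1.hasDerivWithinAt.congr_of_eventuallyEq_of_mem ?_ (by simp)
  have : Ico x 1 ∈ 𝓝[≥] x := Ico_mem_nhdsGE hx.2
  filter_upwards [this] with t ht
  have ht' : t ∈ Icc (0:ℝ) 1 := ⟨hx.1.trans ht.1, ht.2.le⟩
  simp only [projIcc_of_mem zero_le_one ht', h]

variable {E : Type} [NormedAddCommGroup E] [NormedSpace ℝ E]

set_option maxHeartbeats 1000000 in
lemma frob_norm [CompleteSpace E] (θ : E → E →L[ℝ] ℝ) (hθ : ContDiff ℝ ∞ θ) (p n : E)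
    (hn : ∀ᶠ u in 𝓝 p, θ u n = 1)
    (hint : ∀ᶠ u in 𝓝 p, ∀ a b, θ u a = 0 → θ u b = 0 → fderiv ℝ θ u a b = fderiv ℝ θ u b a) :
    ∃ x : E → ℝ, (∃ W : Set E, IsOpen W ∧ p ∈ W ∧ ContDiffOn ℝ ∞ x W) ∧ fderiv ℝ x p n = 1 ∧
      ∀ᶠ u in 𝓝 p, ∀ k, θ u k = 0 → fderiv ℝ x u k = 0 := by
  let l : E →L[ℝ] ℝ := θ p
  have hln : l n = 1 := hn.self_of_nhds
  let π : E →L[ℝ] E := ContinuousLinearMap.id ℝ E - l.smulRight n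
  have hπ : ∀ v, π v = v - l v • n := fun v => rfl
  let F : ℝ × E × ℝ → ℝ := fun q =>
    θ (p + (1 - q.1) • π (q.2.1 - p) + q.2.2 • n) (π (q.2.1 - p))
  have hF : ContDiff ℝ ∞ F := by
    refine ContDiff.clm_apply (hθ.comp ?_) ?_ <;> fun_prop
  have hFd : ∀ s u z k e, fderiv ℝ F (s, u, z) (0, k, e) =
      fderiv ℝ θ (p + (1 - s) • π (u - p) + z • n) ((1 - s) • π k + e • n) (π (u - p))
        + θ (p + (1 - s) • π (u - p) + z • n) (π k) := by
    intro s u z k e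
    have h1 := (hF.differentiable (by simp) (s, u, z)).hasFDerivAt
    have hline : HasDerivAt (fun t : ℝ => ((s, u + t • k, z + t • e) : ℝ × E × ℝ)) (0, k, e) 0 := by
      refine (hasDerivAt_const _ _).prodMk (HasDerivAt.prodMk ?_ ?_)
      · simpa using ((hasDerivAt_id (0:ℝ)).smul_const k).const_add u
      · simpa using ((hasDerivAt_id (0:ℝ)).smul_const e).const_add z
    have h2 : HasDerivAt (fun t : ℝ => F (s, u + t • k, z + t • e))
        (fderiv ℝ F (s, u, z) (0, k, e)) 0 := by
      refine HasFDerivAt.comp_hasDerivAt_of_eq (0:ℝ) h1 hline ?_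
      simp
    have hy : HasDerivAt (fun t : ℝ => π (u + t • k - p)) (π k) 0 := by
      have : HasDerivAt (fun t : ℝ => u + t • k - p) k 0 := by
        simpa using (((hasDerivAt_id (0:ℝ)).smul_const k).const_add u).sub_const p
      exact π.hasFDerivAt.comp_hasDerivAt (0:ℝ) this
    have hg : HasDerivAt (fun t : ℝ => p + (1 - s) • π (u + t • k - p) + (z + t • e) • n)
        ((1 - s) • π k + e • n) 0 := by
      have hz : HasDerivAt (fun t : ℝ => z + t • e) e 0 := by
        simpa using ((hasDerivAt_id (0:ℝ)).smul_const e).const_add z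
      exact ((hy.const_smul (1 - s)).const_add p).add (hz.smul_const n)
    have h3 : HasDerivAt (fun t : ℝ => F (s, u + t • k, z + t • e)) _ 0 :=
      HasDerivAt.clm_apply ((hθ.differentiable (by simp) _).hasFDerivAt.comp_hasDerivAt (0:ℝ) hg) hy
    rw [h2.unique h3]
    simp
  obtain ⟨ζ, W, hWo, hpW, hζW, hζ0, hevW⟩ := ode_param F hF (fun u => l (u - p))
    (by fun_prop) p (by intro s z; simp [F])
  have hζ := hζW.contDiffAt (hWo.mem_nhds hpW)
  have hev := Filter.eventually_of_mem (hWo.mem_nhds hpW) hevW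
  let ev : C(I, ℝ) →L[ℝ] ℝ := ContinuousMap.evalCLM ℝ (1 : I)
  have hxd : ∀ u, HasFDerivAt ζ (fderiv ℝ ζ u) u → ∀ k, fderiv ℝ (fun u => ζ u 1) u k =
      (fderiv ℝ ζ u k) 1 := by
    intro u hu k
    have : HasFDerivAt (fun u => ev (ζ u)) (ev ∘L (fderiv ℝ ζ u)) u :=
      (ev.hasFDerivAt (x := ζ u)).comp u hu
    have h2 : (fun u => ζ u 1) = fun u => ev (ζ u) := rfl
    rw [h2, this.fderiv]; rfl
  have hcd : ∀ u k, fderiv ℝ (fun u => l (u - p)) u k = l k := by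
    intro u k
    have : HasFDerivAt (fun u => l (u - p)) l u :=
      l.hasFDerivAt.comp u ((hasFDerivAt_id u).sub_const p)
    rw [this.fderiv]
  refine ⟨fun u => ζ u 1, ?_, ?_, ?_⟩
  · exact ⟨W, hWo, hpW, ev.contDiff.comp_contDiffOn hζW⟩
  · obtain ⟨η, h1, h2, h3, h4⟩ := hev.self_of_nhds
    rw [hxd p h1, ← h2, h4 n 1, hcd]
    have : ∀ t : ℝ, fderiv ℝ F (projIcc 0 1 zero_le_one t, p, ζ p (projIcc 0 1 zero_le_one t))
            (0, n, η n (projIcc 0 1 zero_le_one t)) = 0 := by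
      intro t
      rw [hFd]
      have : π n = 0 := by rw [hπ, hln]; simp
      simp [this]
    simp only [this]
    simp [hln]
  · -- the curve stays in the good neighbourhood
    obtain ⟨r, hr, hball⟩ := Metric.eventually_nhds_iff_ball.1 (hn.eventually_nhds.and hint)
    have hsmall : ∀ᶠ u in 𝓝 p, ‖π (u - p)‖ + ‖ζ u‖ * ‖n‖ < r := by
      have hcont : ContinuousAt (fun u => ‖π (u - p)‖ + ‖ζ u‖ * ‖n‖) p := by
        have := hζ.continuousAt
        refine ContinuousAt.add (by fun_prop) (ContinuousAt.mul this.norm continuousAt_const)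
      have h0 : ‖π (p - p)‖ + ‖ζ p‖ * ‖n‖ < r := by
        rw [hζ0]; simp [hr]
      exact hcont.eventually (gt_mem_nhds h0)
    filter_upwards [hev, hsmall] with u hu hsm k hk
    obtain ⟨η, h1, h2, h3, h4⟩ := hu
    rw [hxd u h1, ← h2]
    set Z : ℝ → ℝ := fun t => ζ u (projIcc 0 1 zero_le_one t) with hZ
    set H : ℝ → ℝ := fun t => η k (projIcc 0 1 zero_le_one t) with hH
    have hproj : Continuous (fun t : ℝ => projIcc (0:ℝ) 1 zero_le_one t) := continuous_projIcc
    have hZc : Continuous Z := (ζ u).continuous.comp hproj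
    have hHc : Continuous H := (η k).continuous.comp hproj
    set y := π (u - p) with hy
    set κ := π k with hκ
    set γ : ℝ → E := fun t => p + (1 - t) • y + Z t • n with hγ
    set δ : ℝ → E := fun t => (1 - t) • κ + H t • n with hδ
    have hγc : Continuous γ := by fun_prop
    have hDθ : Continuous (fderiv ℝ θ) := hθ.continuous_fderiv (by simp)
    have hγW : ∀ t ∈ Icc (0:ℝ) 1, γ t ∈ Metric.ball p r := by
      intro t ht
      rw [mem_ball_iff_norm]
      have : γ t - p = (1 - t) • y + Z t • n := by simp [hγ]; abel
      rw [this]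
      refine lt_of_le_of_lt (norm_add_le _ _) (lt_of_le_of_lt (add_le_add ?_ ?_) hsm)
      · rw [norm_smul, Real.norm_eq_abs, abs_of_nonneg (by linarith [ht.2])]
        exact mul_le_of_le_one_left (norm_nonneg _) (by linarith [ht.1])
      · rw [norm_smul]
        exact mul_le_mul_of_nonneg_right ((ζ u).norm_coe_le_norm _) (norm_nonneg _)
    have hpj : ∀ x ∈ Icc (0:ℝ) 1, ((projIcc (0:ℝ) 1 zero_le_one x : I) : ℝ) = x := by
      intro x hx; rw [projIcc_of_mem zero_le_one hx]
    have hZ' : ∀ x ∈ Ico (0:ℝ) 1, HasDerivWithinAt Z (θ (γ x) y) (Ici x) x := by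
      intro x hx
      have := hasDeriv_of_integral (ζ u) (fun t => F (projIcc 0 1 zero_le_one t, u,
            ζ u (projIcc 0 1 zero_le_one t))) (by
          refine hF.continuous.comp ?_
          fun_prop) _ h3 x hx
      simp only [F, hpj x (Ico_subset_Icc_self hx)] at this
      exact this
    have hH' : ∀ x ∈ Ico (0:ℝ) 1, HasDerivWithinAt H
        (fderiv ℝ θ (γ x) (δ x) y + θ (γ x) κ) (Ici x) x := by
      intro x hx
      have := hasDeriv_of_integral (η k) (fun t => fderiv ℝ F (projIcc 0 1 zero_le_one t, u,
            ζ u (projIcc 0 1 zero_le_one t)) (0, k, η k (projIcc 0 1 zero_le_one t))) (by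
          refine Continuous.clm_apply ((hF.continuous_fderiv (by simp)).comp ?_) ?_ <;> fun_prop)
          _ (h4 k) x hx
      simp only [hFd, hpj x (Ico_subset_Icc_self hx)] at this
      exact this
    have hγ' : ∀ x ∈ Ico (0:ℝ) 1, HasDerivWithinAt γ (-y + θ (γ x) y • n) (Ici x) x := by
      intro x hx
      have h5 : HasDerivWithinAt (fun t : ℝ => (1 - t) • y) (-y) (Ici x) x := by
        simpa using (((hasDerivAt_id x).const_sub 1).smul_const y).hasDerivWithinAt
      exact (h5.const_add p).add ((hZ' x hx).smul_const n)
    have hδ' : ∀ x ∈ Ico (0:ℝ) 1, HasDerivWithinAt δ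
        (-κ + (fderiv ℝ θ (γ x) (δ x) y + θ (γ x) κ) • n) (Ici x) x := by
      intro x hx
      have h5 : HasDerivWithinAt (fun t : ℝ => (1 - t) • κ) (-κ) (Ici x) x := by
        simpa using (((hasDerivAt_id x).const_sub 1).smul_const κ).hasDerivWithinAt
      exact h5.add ((hH' x hx).smul_const n)
    set w : ℝ → ℝ := fun t => θ (γ t) (δ t) with hw
    let q : ℝ → ℝ := fun t => fderiv ℝ θ (γ t) n (-y + θ (γ t) y • n)
    have hqc : Continuous q := by
      have h5 : Continuous fun t => fderiv ℝ θ (γ t) := hDθ.comp hγc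
      have h6 : Continuous fun t => θ (γ t) := hθ.continuous.comp hγc
      fun_prop
    have hw' : ∀ x ∈ Ico (0:ℝ) 1, HasDerivWithinAt w (- (w x * q x)) (Ici x) x := by
      intro x hx
      have h5 : HasDerivWithinAt (fun t => θ (γ t)) (fderiv ℝ θ (γ x) (-y + θ (γ x) y • n))
          (Ici x) x :=
        (hθ.differentiable (by simp) (γ x)).hasFDerivAt.comp_hasDerivWithinAt x (hγ' x hx)
      have h6 := h5.clm_apply (hδ' x hx)
      obtain ⟨hn1, hi1⟩ := hball (γ x) (hγW x (Ico_subset_Icc_self hx))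
      have hnx : θ (γ x) n = 1 := hn1.self_of_nhds
      have hDn : ∀ v, fderiv ℝ θ (γ x) v n = 0 := by
        intro v
        have h7 : HasFDerivAt (fun z => θ z n)
            ((fderiv ℝ θ (γ x)).flip n) (γ x) := by
          have := (hθ.differentiable (by simp) (γ x)).hasFDerivAt.clm_apply
            (hasFDerivAt_const n (γ x))
          simpa using this
        have h8 : HasFDerivAt (fun z => θ z n) (0 : E →L[ℝ] ℝ) (γ x) :=
          (hasFDerivAt_const (1:ℝ) (γ x)).congr_of_eventuallyEq hn1
        have h9 := congrArg (fun A : E →L[ℝ] ℝ => A v) (h7.unique h8)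
        simpa using h9
      have hi2 := hi1 (-y + θ (γ x) y • n) (δ x - w x • n) (by simp [hnx])
        (by simp [hnx, hw])
      refine h6.congr_deriv ?_
      simp only [map_sub, map_add, map_neg, map_smul, smul_eq_mul, _root_.sub_apply, _root_.add_apply, _root_.neg_apply,
        _root_.smul_apply, hDn, hnx, q] at hi2 ⊢
      linear_combination hi2
    obtain ⟨K, hK⟩ := isCompact_Icc.exists_bound_of_continuousOn
      (f := q) (s := Icc (0:ℝ) 1) hqc.continuousOn
    have hwc : Continuous w := (hθ.continuous.comp hγc).clm_apply (by fun_prop)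
    have hγ0 : γ 0 = u := by
      have hz0 : Z 0 = l (u - p) := by
        have := h3 0
        simp only [hZ]
        rw [projIcc_left]
        simpa using this
      simp only [hγ, hz0, hy, hπ]
      simp only [sub_zero, one_smul]
      abel
    have hδ0 : δ 0 = k := by
      have hz0 : H 0 = l k := by
        have := h4 k 0
        simp only [hH]
        rw [projIcc_left, ← hcd u k]
        simpa using this
      simp only [hδ, hz0, hκ, hπ]
      simp
    have hw0 := eq_zero_of_abs_deriv_le_mul_abs_self_of_eq_zero_right (K := K) hwc.continuousOn
      hw' (by simp only [hw, hγ0, hδ0, hk])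
      (by
        intro x hx
        rw [norm_neg, norm_mul, mul_comm]
        exact mul_le_mul_of_nonneg_right (hK x (Ico_subset_Icc_self hx)) (norm_nonneg _))
      1 (by simp)
    obtain ⟨hn1, -⟩ := hball (γ 1) (hγW 1 (by simp))
    have hn1 := hn1.self_of_nhds
    simp only [hw, hδ] at hw0
    simp [hn1] at hw0
    simp only [hH] at hw0
    rw [projIcc_right] at hw0
    exact hw0


theorem frobenius [FiniteDimensional ℝ E] (θ : E → E →L[ℝ] ℝ) (U : Set E) (hU : IsOpen U)
    (hθ : ContDiffOn ℝ ∞ θ U) (p : E) (hp : p ∈ U) (h0 : θ p ≠ 0)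
    (hint : ∀ u ∈ U, ∀ a b, θ u a = 0 → θ u b = 0 → fderiv ℝ θ u a b = fderiv ℝ θ u b a) :
    ∃ x : E → ℝ, ∃ W : Set E, IsOpen W ∧ p ∈ W ∧ W ⊆ U ∧ ContDiffOn ℝ ∞ x W ∧
      ∀ u ∈ W, ∃ h : ℝ, h ≠ 0 ∧ fderiv ℝ x u = h • θ u := by
  haveI : CompleteSpace E := FiniteDimensional.complete ℝ E
  obtain ⟨n, hn⟩ : ∃ n, θ p n ≠ 0 := by
    by_contra! hcon
    exact h0 (ContinuousLinearMap.ext hcon)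
  have hcont : ContinuousOn (fun u => θ u n) U := hθ.continuousOn.clm_apply continuousOn_const
  set U1 := U ∩ (fun u => θ u n) ⁻¹' {0}ᶜ with hU1
  have hU1o : IsOpen U1 := hcont.isOpen_inter_preimage hU isOpen_compl_singleton
  have hp1 : p ∈ U1 := ⟨hp, hn⟩
  obtain ⟨r, hr, hrU⟩ := Metric.isOpen_iff.1 hU1o p hp1
  let b : ContDiffBump p := ⟨r / 3, r / 2, by positivity, by linarith⟩
  have hθU1 : ContDiffOn ℝ ∞ (fun u => (θ u n)⁻¹ • θ u) U1 := by
    have h1 : ContDiffOn ℝ ∞ θ U1 := hθ.mono inter_subset_left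
    exact ((h1.clm_apply contDiffOn_const).inv (fun u hu => hu.2)).smul h1
  let θ' : E → E →L[ℝ] ℝ := fun u => b u • ((θ u n)⁻¹ • θ u)
  have hθ' : ContDiff ℝ ∞ θ' := by
    rw [contDiff_iff_contDiffAt]
    intro u
    by_cases hu : u ∈ tsupport b
    · have : u ∈ U1 := by
        rw [b.tsupport_eq] at hu
        refine hrU (Metric.closedBall_subset_ball ?_ hu)
        change r / 2 < r
        linarith
      exact b.contDiff.contDiffAt.smul (hθU1.contDiffAt (hU1o.mem_nhds this))
    · have : θ' =ᶠ[𝓝 u] fun _ => 0 := by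
        filter_upwards [(isClosed_tsupport b).isOpen_compl.mem_nhds hu] with v hv
        have : b v = 0 := image_eq_zero_of_notMem_tsupport hv
        simp [θ', this]
      exact contDiffAt_const.congr_of_eventuallyEq this
  have heq : ∀ u ∈ Metric.ball p (r / 3), θ' u = (θ u n)⁻¹ • θ u := by
    intro u hu
    have : b u = 1 := b.one_of_mem_closedBall (Metric.ball_subset_closedBall hu)
    simp [θ', this]
  have hbU : Metric.ball p (r / 3) ⊆ U1 := (Metric.ball_subset_ball (by linarith)).trans hrU
  have hmem : Metric.ball p (r / 3) ∈ 𝓝 p := Metric.ball_mem_nhds p (by positivity)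
  obtain ⟨x, ⟨W, hWo, hpW, hxW⟩, hx1, hx2⟩ := frob_norm θ' hθ' p n
    (by
      filter_upwards [hmem] with u hu
      rw [heq u hu]
      have : θ u n ≠ 0 := (hbU hu).2
      simp [this])
    (by
      filter_upwards [hmem] with u hu a c ha hc
      have hne : θ u n ≠ 0 := (hbU hu).2
      rw [heq u hu] at ha hc
      have ha' : θ u a = 0 := by simpa [hne] using ha
      have hc' : θ u c = 0 := by simpa [hne] using hc
      have hd : HasFDerivAt θ (fderiv ℝ θ u) u :=
        ((hθ.contDiffAt (hU.mem_nhds (hbU hu).1)).differentiableAt (by simp)).hasFDerivAt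
      have hi : DifferentiableAt ℝ (fun u => (θ u n)⁻¹) u :=
        (hd.differentiableAt.clm_apply (differentiableAt_const n)).inv hne
      have hfe : fderiv ℝ θ' u = fderiv ℝ (fun u => (θ u n)⁻¹ • θ u) u := by
        apply Filter.EventuallyEq.fderiv_eq
        filter_upwards [Metric.isOpen_ball.mem_nhds hu] with v hv using heq v hv
      have hs : HasFDerivAt (fun u => (θ u n)⁻¹ • θ u) _ u := hi.hasFDerivAt.smul hd
      rw [hfe, hs.fderiv]
      simp [ha', hc', hint u (hbU hu).1 a c ha' hc'])
  have hxc : ContinuousOn (fun u => fderiv ℝ x u n) W :=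
    (hxW.continuousOn_fderiv_of_isOpen hWo (by simp)).clm_apply continuousOn_const
  have hxne : ∀ᶠ u in 𝓝 p, fderiv ℝ x u n ≠ 0 := by
    have := (hxc.continuousAt (hWo.mem_nhds hpW))
    exact this.eventually_ne (by rw [hx1]; simp)
  obtain ⟨W2, hW2, hW2o, hpW2⟩ := eventually_nhds_iff.1 (hx2.and (hxne.and
    ((hWo.eventually_mem hpW).and hmem)))
  refine ⟨x, W2, hW2o, hpW2, fun u hu => (hbU (hW2 u hu).2.2.2).1,
    hxW.mono (fun u hu => (hW2 u hu).2.2.1), ?_⟩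
  intro u hu
  obtain ⟨h1, h2, h3, h4⟩ := hW2 u hu
  have hne : θ u n ≠ 0 := (hbU h4).2
  refine ⟨fderiv ℝ x u n / θ u n, div_ne_zero h2 hne, ?_⟩
  ext k
  have := h1 (k - (θ u k / θ u n) • n) (by rw [heq u h4]; simp [hne])
  simp only [map_sub, map_smul, smul_eq_mul] at this
  simp only [_root_.smul_apply, smul_eq_mul]
  field_simp
  field_simp at this
  linarith

end RI
end

section
open scoped ContDiff Topology
open Matrix
namespace RI
variable {N : ℕ}

/-- smooth matrix field -/
def SM (M : MetF N) (S : Set (Fin N → ℝ)) : Prop := ∀ i j, ContDiffOn ℝ ∞ (fun u => M u i j) S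

lemma SM.mono {M : MetF N} {S T : Set (Fin N → ℝ)} (h : SM M S) (hT : T ⊆ S) : SM M T :=
  fun i j => (h i j).mono hT

lemma SM.mul {A B : MetF N} {S : Set (Fin N → ℝ)} (hA : SM A S) (hB : SM B S) :
    SM (fun u => A u * B u) S := by
  intro i j
  simp only [Matrix.mul_apply]
  exact ContDiffOn.sum fun k _ => (hA i k).mul (hB k j)

lemma SM.add {A B : MetF N} {S : Set (Fin N → ℝ)} (hA : SM A S) (hB : SM B S) :
    SM (fun u => A u + B u) S := fun i j => (hA i j).add (hB i j)

lemma SM.sub {A B : MetF N} {S : Set (Fin N → ℝ)} (hA : SM A S) (hB : SM B S) :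
    SM (fun u => A u - B u) S := fun i j => (hA i j).sub (hB i j)

lemma SM.transpose {A : MetF N} {S : Set (Fin N → ℝ)} (hA : SM A S) :
    SM (fun u => (A u)ᵀ) S := fun i j => hA j i

lemma SM.const (A : Matrix (Fin N) (Fin N) ℝ) (S : Set (Fin N → ℝ)) :
    SM (fun _ => A) S := fun _ _ => contDiffOn_const

lemma SM.smul {A : MetF N} {f : (Fin N → ℝ) → ℝ} {S : Set (Fin N → ℝ)} (hf : ContDiffOn ℝ ∞ f S)
    (hA : SM A S) : SM (fun u => f u • A u) S := fun i j => hf.mul (hA i j)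

lemma det_smooth {E : Type*} [NormedAddCommGroup E] [NormedSpace ℝ E]
    {A : E → Matrix (Fin N) (Fin N) ℝ} {S : Set E}
    (hA : ∀ i j, ContDiffOn ℝ ∞ (fun u => A u i j) S) : ContDiffOn ℝ ∞ (fun u => (A u).det) S := by
  simp only [Matrix.det_apply]
  refine ContDiffOn.sum fun σ _ => ?_
  have : ContDiffOn ℝ ∞ (fun u => ∏ i, A u (σ i) i) S := contDiffOn_prod fun i _ => hA _ _
  rcases Int.units_eq_one_or (Equiv.Perm.sign σ) with h | h
  · simpa [h] using this
  · simpa [h] using this.neg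

lemma SM.inv {A : MetF N} {S : Set (Fin N → ℝ)} (hA : SM A S) (hu : ∀ u ∈ S, IsUnit (A u).det) :
    SM (fun u => (A u)⁻¹) S := by
  intro i j
  simp only [Matrix.inv_def, Ring.inverse_eq_inv', Matrix.smul_apply, Matrix.adjugate_apply,
    smul_eq_mul]
  refine ((det_smooth hA).inv fun u h => (hu u h).ne_zero).mul (det_smooth ?_)
  intro k l
  by_cases h : k = j
  · subst h; simp [contDiffOn_const]
  · simp [Matrix.updateRow_ne h]; exact hA k l

lemma SM.aevalProd {v : MetF N} {f : Fin N → (Fin N → ℝ) → ℝ} {S : Set (Fin N → ℝ)}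
    (hv : SM v S) (hf : ∀ i, ContDiffOn ℝ ∞ (f i) S) (s : Finset (Fin N)) :
    SM (fun u => Polynomial.aeval (v u) (∏ j ∈ s, (Polynomial.X - Polynomial.C (f j u)))) S := by
  induction s using Finset.induction_on with
  | empty => simpa using SM.const 1 S
  | insert a s ha ih =>
    simp only [Finset.prod_insert ha, map_mul]
    refine SM.mul ?_ ih
    simp only [map_sub, Polynomial.aeval_X, Polynomial.aeval_C]
    refine hv.sub ?_
    simp only [Algebra.algebraMap_eq_smul_one]
    exact SM.smul (hf a) (SM.const 1 S)

lemma eigenvalue_local (U : Set (Fin N → ℝ)) (hU : IsOpen U) (v : MetF N) (hv : SM v U)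
    (p : Fin N → ℝ) (hp : p ∈ U) (a : Fin N → ℝ) (ha : Function.Injective a)
    (hc : (v p).charpoly = ∏ i, (Polynomial.X - Polynomial.C (a i))) (i : Fin N) :
    ∃ f : (Fin N → ℝ) → ℝ, ∃ W, IsOpen W ∧ p ∈ W ∧ W ⊆ U ∧ ContDiffOn ℝ ∞ f W ∧ f p = a i ∧
      ∀ u ∈ W, (v u).charpoly.eval (f u) = 0 := by
  set c : ℝ := ∏ j ∈ Finset.univ.erase i, (a i - a j) with hcdef
  have hc0 : c ≠ 0 := Finset.prod_ne_zero_iff.2 fun j hj => sub_ne_zero.2 fun h =>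
    (Finset.ne_of_mem_erase hj) (ha h).symm
  have key : ∀ x, (v p).charpoly.eval x = (x - a i) * ∏ j ∈ Finset.univ.erase i, (x - a j) := by
    intro x
    rw [hc, Polynomial.eval_prod, Finset.mul_prod_erase _ (fun j => x - a j) (Finset.mem_univ i)]
    simp
  obtain ⟨ζ, W, hW, hpW, hζ, hζp, hh⟩ := implicit_local
    (fun z : (Fin N → ℝ) × ℝ => (z.2 • (1 : Matrix (Fin N) (Fin N) ℝ) - v z.1).det * c⁻¹)
    (U ×ˢ Set.univ) (hU.prod isOpen_univ)
    (by
      refine ContDiffOn.mul (det_smooth fun k l => ?_) contDiffOn_const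
      simp only [Matrix.sub_apply, Matrix.smul_apply, smul_eq_mul]
      exact (contDiffOn_snd.mul contDiffOn_const).sub
        ((hv k l).comp contDiffOn_fst fun z hz => hz.1))
    p (a i) ⟨hp, trivial⟩
    (by
      have h1 : ∀ z : ℝ, (z • (1 : Matrix (Fin N) (Fin N) ℝ) - v p).det * c⁻¹ =
          ((z - a i) * ∏ j ∈ Finset.univ.erase i, (z - a j)) * c⁻¹ := by
        intro z
        rw [← key, Matrix.eval_charpoly, Matrix.scalar_apply, Matrix.smul_one_eq_diagonal]
      simp only [h1]
      have hQ : DifferentiableAt ℝ (fun z : ℝ => ∏ j ∈ Finset.univ.erase i, (z - a j)) (a i) := by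
        fun_prop
      have h2 := (((hasDerivAt_id (a i)).sub_const (a i)).mul hQ.hasDerivAt).mul_const c⁻¹
      have h3 : HasDerivAt (fun z : ℝ => ((z - a i) * ∏ j ∈ Finset.univ.erase i, (z - a j)) * c⁻¹)
          1 (a i) := by
        refine HasDerivAt.congr_deriv h2 ?_
        simp only [← hcdef, id, sub_self, zero_mul, add_zero, one_mul]
        exact mul_inv_cancel₀ hc0
      have h4 := h3.hasFDerivAt
      have e : ContinuousLinearMap.id ℝ ℝ = ContinuousLinearMap.toSpanSingleton ℝ (1 : ℝ) := by
        ext; simp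
      rw [e]
      exact h4)
  refine ⟨ζ, W ∩ U, hW.inter hU, ⟨hpW, hp⟩, Set.inter_subset_right, hζ.mono Set.inter_subset_left,
    hζp, fun u hu => ?_⟩
  have := (hh u hu.1).2
  simp only [] at this
  rw [Matrix.smul_one_eq_diagonal, Matrix.smul_one_eq_diagonal, ← Matrix.scalar_apply,
    ← Matrix.scalar_apply, ← Matrix.eval_charpoly, ← Matrix.eval_charpoly, key (a i)] at this
  simpa [hc0] using this
end RI
end

section
open scoped ContDiff Topology
open Matrix
namespace RI
variable {N : ℕ}

lemma vecMul_aevalProd (A : Matrix (Fin N) (Fin N) ℝ) (x : Fin N → ℝ) (a : ℝ)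
    (h : x ᵥ* A = a • x) (f : Fin N → ℝ) (s : Finset (Fin N)) :
    x ᵥ* Polynomial.aeval A (∏ j ∈ s, (Polynomial.X - Polynomial.C (f j))) =
      (∏ j ∈ s, (a - f j)) • x := by
  induction s using Finset.induction_on with
  | empty => simp
  | insert b s hb ih =>
    simp only [Finset.prod_insert hb, map_mul, map_sub, Polynomial.aeval_X, Polynomial.aeval_C,
      Algebra.algebraMap_eq_smul_one]
    rw [← Matrix.vecMul_vecMul, Matrix.vecMul_sub, h, Matrix.vecMul_smul, Matrix.vecMul_one,
      ← sub_smul, Matrix.smul_vecMul, ih, smul_smul]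

lemma eigenframe (U : Set (Fin N → ℝ)) (hU : IsOpen U)
    (g1 g2 : MetF N) (hg1 : IsMetricOn g1 U) (hg2 : IsMetricOn g2 U)
    (hns : NonSingularPairOn g1 g2 U) (p : Fin N → ℝ) (hp : p ∈ U) :
    ∃ W, IsOpen W ∧ p ∈ W ∧ W ⊆ U ∧ ∃ f : Fin N → (Fin N → ℝ) → ℝ, ∃ Θ : MetF N,
      (∀ i, ContDiffOn ℝ ∞ (f i) W) ∧ SM Θ W ∧ (∀ u ∈ W, Function.Injective fun i => f i u) ∧
      (∀ u ∈ W, IsUnit (Θ u).det) ∧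
      ∀ u ∈ W, Θ u * g1 u = Matrix.diagonal (fun i => f i u) * Θ u * g2 u := by
  set v : MetF N := fun u => g1 u * (g2 u)⁻¹ with hvdef
  have hv : SM v U := SM.mul hg1.1 (SM.inv hg2.1 hg2.2.2)
  obtain ⟨a, ha, hc⟩ := hns p hp
  choose f W hWo hpW hWU hf hfp hroot using eigenvalue_local U hU v hv p hp a ha hc
  have hx : ∀ i, ∃ ξ : Fin N → ℝ, ξ ≠ 0 ∧ ξ ᵥ* v p = a i • ξ := by
    intro i
    have h1 : (Matrix.scalar (Fin N) (a i) - v p).det = 0 := by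
      rw [← Matrix.eval_charpoly, hvdef]
      simp only
      rw [hc, Polynomial.eval_prod]
      exact Finset.prod_eq_zero (Finset.mem_univ i) (by simp)
    obtain ⟨ξ, h0, h2⟩ := Matrix.exists_vecMul_eq_zero_iff.2 h1
    refine ⟨ξ, h0, ?_⟩
    rw [Matrix.vecMul_sub, sub_eq_zero, Matrix.scalar_apply, ← Matrix.smul_one_eq_diagonal,
      Matrix.vecMul_smul, Matrix.vecMul_one] at h2
    exact h2.symm
  choose ξ hξ0 hξ using hx
  set Q : Fin N → MetF N := fun i u => Polynomial.aeval (v u)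
    (∏ j ∈ Finset.univ.erase i, (Polynomial.X - Polynomial.C (f j u))) with hQ
  set Θ : MetF N := fun u => Matrix.of fun i => ξ i ᵥ* Q i u with hΘ
  set W0 : Set (Fin N → ℝ) := U ∩ ⋂ i, W i with hW0
  have hW0o : IsOpen W0 := hU.inter (isOpen_iInter_of_finite hWo)
  have hpW0 : p ∈ W0 := ⟨hp, Set.mem_iInter.2 hpW⟩
  have hfW : ∀ i, ContDiffOn ℝ ∞ (f i) W0 := fun i => (hf i).mono fun u hu =>
    Set.mem_iInter.1 hu.2 i
  have hΘs : SM Θ W0 := by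
    intro i j
    have h1 : SM (Q i) W0 := SM.aevalProd (hv.mono Set.inter_subset_left) hfW _
    simp only [hΘ, Matrix.of_apply, Matrix.vecMul, dotProduct]
    exact ContDiffOn.sum fun k _ => contDiffOn_const.mul (h1 k j)
  have hinj : ∀ᶠ u in 𝓝 p, Function.Injective fun i => f i u := by
    have : ∀ i j, ∀ᶠ u in 𝓝 p, f i u = f j u → i = j := by
      intro i j
      by_cases hij : i = j
      · exact Filter.Eventually.of_forall fun _ _ => hij
      · have h1 := ((hfW i).sub (hfW j)).continuousOn.continuousAt (hW0o.mem_nhds hpW0)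
        have h2 : f i p - f j p ≠ 0 := by
          rw [hfp, hfp]; exact sub_ne_zero.2 fun h => hij (ha h)
        filter_upwards [h1.eventually_ne h2] with u hu he
        exact absurd (sub_eq_zero.2 he) hu
    have h2 : ∀ᶠ u in 𝓝 p, ∀ i j, f i u = f j u → i = j :=
      Filter.eventually_all.2 fun i => Filter.eventually_all.2 fun j => this i j
    filter_upwards [h2] with u hu i j h using hu i j h
  have hdetp : (Θ p).det ≠ 0 := by
    have hrow : ∀ i, Θ p i = (∏ j ∈ Finset.univ.erase i, (a i - a j)) • ξ i := by
      intro i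
      have := vecMul_aevalProd (v p) (ξ i) (a i) (hξ i) (fun j => f j p) (Finset.univ.erase i)
      simp only [hfp] at this
      rw [← this]
      simp only [hΘ, hQ, hfp]
      rfl
    have hli : LinearIndependent ℝ (Θ p).row := by
      refine Module.End.eigenvectors_linearIndependent' (Matrix.vecMulLinear (v p)) a ha _ ?_
      intro i
      have hr : (Θ p).row i = Θ p i := rfl
      rw [hr, hrow]
      refine ⟨?_, ?_⟩
      · rw [Module.End.mem_eigenspace_iff]
        simp only [map_smul, Matrix.vecMulLinear_apply, hξ]
        rw [smul_comm]
      · refine smul_ne_zero (Finset.prod_ne_zero_iff.2 fun j hj => sub_ne_zero.2 fun h =>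
          (Finset.ne_of_mem_erase hj) (ha h).symm) (hξ0 i)
    rw [Matrix.linearIndependent_rows_iff_isUnit, Matrix.isUnit_iff_isUnit_det] at hli
    exact hli.ne_zero
  have hdet : ∀ᶠ u in 𝓝 p, (Θ u).det ≠ 0 :=
    ((det_smooth hΘs).continuousOn.continuousAt (hW0o.mem_nhds hpW0)).eventually_ne hdetp
  obtain ⟨W1, hW1, hW1o, hpW1⟩ := eventually_nhds_iff.1
    (hinj.and (hdet.and (hW0o.eventually_mem hpW0)))
  have hsub : W1 ⊆ W0 := fun u hu => (hW1 u hu).2.2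
  refine ⟨W1, hW1o, hpW1, fun u hu => (hsub hu).1, f, Θ, fun i => (hfW i).mono hsub,
    hΘs.mono hsub, fun u hu => (hW1 u hu).1, fun u hu => (hW1 u hu).2.1.isUnit, ?_⟩
  intro u hu
  obtain ⟨b, hb, hcb⟩ := hns u (hsub hu).1
  have hcf : (v u).charpoly = ∏ i, (Polynomial.X - Polynomial.C (f i u)) := by
    have h1 : ∀ i, ∃ k, f i u = b k := by
      intro i
      have h2 := hroot i u (Set.mem_iInter.1 (hsub hu).2 i)
      simp only [hvdef] at h2
      rw [hcb, Polynomial.eval_prod, Finset.prod_eq_zero_iff] at h2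
      obtain ⟨k, _, hk⟩ := h2
      exact ⟨k, by simpa [sub_eq_zero] using hk⟩
    choose σ hσ using h1
    have hσi : Function.Injective σ := fun i j h => (hW1 u hu).1 (by simp only [hσ, h])
    have hσb := Finite.injective_iff_bijective.1 hσi
    simp only [hσ]
    rw [Function.Bijective.prod_comp hσb (fun k => Polynomial.X - Polynomial.C (b k))]
    exact hcb
  have hvΘ : Θ u * v u = Matrix.diagonal (fun i => f i u) * Θ u := by
    ext i j
    have h1 : Q i u * (v u - f i u • 1) = 0 := by
      have h2 : Polynomial.aeval (v u) (v u).charpoly = 0 := Matrix.aeval_self_charpoly _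
      rw [hcf, ← Finset.prod_erase_mul _ _ (Finset.mem_univ i), map_mul] at h2
      simpa [hQ, Algebra.algebraMap_eq_smul_one] using h2
    have h3 : ξ i ᵥ* Q i u ᵥ* v u = f i u • (ξ i ᵥ* Q i u) := by
      rw [mul_sub, sub_eq_zero] at h1
      rw [Matrix.vecMul_vecMul, h1, Matrix.mul_smul, mul_one, Matrix.vecMul_smul]
    have h4 := congrFun h3 j
    rw [Matrix.diagonal_mul]
    simpa [Matrix.mul_apply, Matrix.vecMul, dotProduct, hΘ] using h4
  have h5 : v u * g2 u = g1 u := by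
    simp only [hvdef]
    rw [Matrix.mul_assoc, Matrix.nonsing_inv_mul _ (hg2.2.2 u (hsub hu).1), mul_one]
  rw [← hvΘ, Matrix.mul_assoc, h5]
end RI
end

section
open scoped ContDiff Topology
open Matrix
namespace RI
variable {N : ℕ}

/-- entrywise partial derivative -/
noncomputable def dm (M : MetF N) (c : Fin N) (u : Fin N → ℝ) : Matrix (Fin N) (Fin N) ℝ :=
  Matrix.of fun i j => pd (fun w => M w i j) c u

/-- entrywise differentiability -/
def DM (M : MetF N) (u : Fin N → ℝ) : Prop := ∀ i j, DifferentiableAt ℝ (fun w => M w i j) u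

lemma SM.dM {M : MetF N} {S : Set (Fin N → ℝ)} (h : SM M S) (hS : IsOpen S) {u : Fin N → ℝ}
    (hu : u ∈ S) : DM M u := fun i j =>
  ((h i j).contDiffAt (hS.mem_nhds hu)).differentiableAt (by simp)

lemma pd_congr {f g : (Fin N → ℝ) → ℝ} {u : Fin N → ℝ} (h : f =ᶠ[𝓝 u] g) (c : Fin N) :
    pd f c u = pd g c u := by unfold pd; rw [h.fderiv_eq]

lemma pd_add {f g : (Fin N → ℝ) → ℝ} {u : Fin N → ℝ} (hf : DifferentiableAt ℝ f u)
    (hg : DifferentiableAt ℝ g u) (c : Fin N) :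
    pd (fun w => f w + g w) c u = pd f c u + pd g c u := by
  unfold pd; rw [fderiv_fun_add hf hg]; rfl

lemma pd_sub {f g : (Fin N → ℝ) → ℝ} {u : Fin N → ℝ} (hf : DifferentiableAt ℝ f u)
    (hg : DifferentiableAt ℝ g u) (c : Fin N) :
    pd (fun w => f w - g w) c u = pd f c u - pd g c u := by
  unfold pd; rw [fderiv_fun_sub hf hg]; rfl

lemma pd_mul {f g : (Fin N → ℝ) → ℝ} {u : Fin N → ℝ} (hf : DifferentiableAt ℝ f u)
    (hg : DifferentiableAt ℝ g u) (c : Fin N) :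
    pd (fun w => f w * g w) c u = pd f c u * g u + f u * pd g c u := by
  unfold pd; rw [fderiv_fun_mul hf hg]; simp; ring

lemma pd_const (a : ℝ) (c : Fin N) (u : Fin N → ℝ) : pd (fun _ => a) c u = 0 := by
  unfold pd; simp

lemma pd_sum {ι : Type*} (s : Finset ι) {f : ι → (Fin N → ℝ) → ℝ} {u : Fin N → ℝ}
    (hf : ∀ i ∈ s, DifferentiableAt ℝ (f i) u) (c : Fin N) :
    pd (fun w => ∑ i ∈ s, f i w) c u = ∑ i ∈ s, pd (f i) c u := by
  unfold pd; rw [fderiv_fun_sum hf]; simp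

lemma pd_smooth {f : (Fin N → ℝ) → ℝ} {S : Set (Fin N → ℝ)} (hS : IsOpen S)
    (hf : ContDiffOn ℝ ∞ f S) (c : Fin N) : ContDiffOn ℝ ∞ (pd f c) S := by
  unfold pd
  exact (hf.fderiv_of_isOpen hS (by simp)).clm_apply contDiffOn_const

lemma DM.transpose {A : MetF N} {u : Fin N → ℝ} (hA : DM A u) : DM (fun w => (A w)ᵀ) u :=
  fun i j => hA j i

lemma DM.mul {A B : MetF N} {u : Fin N → ℝ} (hA : DM A u) (hB : DM B u) :
    DM (fun w => A w * B w) u := by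
  intro i j
  simp only [Matrix.mul_apply]
  exact DifferentiableAt.fun_sum fun k _ => (hA i k).mul (hB k j)

lemma dm_congr {A B : MetF N} {u : Fin N → ℝ} (h : A =ᶠ[𝓝 u] B) (c : Fin N) :
    dm A c u = dm B c u := by
  ext i j
  exact pd_congr (h.mono fun w hw => by simp only [hw]) c

lemma dm_transpose (A : MetF N) (c : Fin N) (u : Fin N → ℝ) :
    dm (fun w => (A w)ᵀ) c u = (dm A c u)ᵀ := rfl

lemma dm_const (A : Matrix (Fin N) (Fin N) ℝ) (c : Fin N) (u : Fin N → ℝ) :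
    dm (fun _ => A) c u = 0 := by
  ext i j; exact pd_const _ c u

lemma dm_add {A B : MetF N} {u : Fin N → ℝ} (hA : DM A u) (hB : DM B u) (c : Fin N) :
    dm (fun w => A w + B w) c u = dm A c u + dm B c u := by
  ext i j; exact pd_add (hA i j) (hB i j) c

lemma dm_smul {A : MetF N} {u : Fin N → ℝ} (l : ℝ) (hA : DM A u) (c : Fin N) :
    dm (fun w => l • A w) c u = l • dm A c u := by
  ext i j
  have := pd_mul (differentiableAt_const (c := l)) (hA i j) c
  rw [pd_const] at this
  simpa [dm] using this

lemma dm_mul {A B : MetF N} {u : Fin N → ℝ} (hA : DM A u) (hB : DM B u) (c : Fin N) :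
    dm (fun w => A w * B w) c u = dm A c u * B u + A u * dm B c u := by
  ext i j
  simp only [dm, Matrix.of_apply, Matrix.mul_apply, Matrix.add_apply]
  rw [pd_sum _ (fun k _ => (hA i k).fun_mul (hB k j)), ← Finset.sum_add_distrib]
  exact Finset.sum_congr rfl fun k _ => pd_mul (hA i k) (hB k j) c

lemma dm_inv {A : MetF N} {S : Set (Fin N → ℝ)} (hS : IsOpen S) (hA : SM A S)
    (hu : ∀ u ∈ S, IsUnit (A u).det) {u : Fin N → ℝ} (huS : u ∈ S) (c : Fin N) :
    dm (fun w => (A w)⁻¹) c u = -((A u)⁻¹ * dm A c u * (A u)⁻¹) := by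
  have h1 : dm (fun w => A w * (A w)⁻¹) c u = 0 := by
    rw [dm_congr (B := fun _ => 1), dm_const]
    filter_upwards [hS.mem_nhds huS] with w hw using Matrix.mul_nonsing_inv _ (hu w hw)
  rw [dm_mul (hA.dM hS huS) ((hA.inv hu).dM hS huS)] at h1
  have h2 : (A u)⁻¹ * (A u) = 1 := Matrix.nonsing_inv_mul _ (hu u huS)
  have h3 : (A u)⁻¹ * (A u * dm (fun w => (A w)⁻¹) c u) = (A u)⁻¹ * -(dm A c u * (A u)⁻¹) := by
    rw [eq_neg_of_add_eq_zero_right h1]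
  rw [← Matrix.mul_assoc, h2, one_mul] at h3
  rw [h3, mul_neg, Matrix.mul_assoc]

/-- Christoffel matrices -/
noncomputable def Gam (g : MetF N) (c : Fin N) (u : Fin N → ℝ) : Matrix (Fin N) (Fin N) ℝ :=
  Matrix.of fun i j => christoffel g i j c u

/-- Christoffel symbols of the first kind -/
noncomputable def Kk (g : MetF N) (c : Fin N) (u : Fin N → ℝ) : Matrix (Fin N) (Fin N) ℝ :=
  Matrix.of fun s j => (1 / 2) * (dm (fun w => (g w)⁻¹) j u s c + dm (fun w => (g w)⁻¹) c u j s
    - dm (fun w => (g w)⁻¹) s u j c)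

lemma Gam_eq (g : MetF N) (c : Fin N) (u : Fin N → ℝ) : Gam g c u = g u * Kk g c u := by
  ext i j
  simp only [Gam, Kk, christoffel, Matrix.mul_apply, Matrix.of_apply, dm, Finset.mul_sum]
  exact Finset.sum_congr rfl fun s _ => by ring

section
variable {g : MetF N} {S : Set (Fin N → ℝ)} (hS : IsOpen S) (hg : IsMetricOn g S)
  {u : Fin N → ℝ} (hu : u ∈ S)
include hg

lemma inv_symm (hu : u ∈ S) : ((g u)⁻¹)ᵀ = (g u)⁻¹ := by
  rw [Matrix.transpose_nonsing_inv, hg.2.1 u hu]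

lemma SMinv : SM (fun w => (g w)⁻¹) S := SM.inv hg.1 hg.2.2

include hS

lemma dG_symm (hu : u ∈ S) (c i j : Fin N) :
    dm (fun w => (g w)⁻¹) c u i j = dm (fun w => (g w)⁻¹) c u j i := by
  have h : dm (fun w => (g w)⁻¹) c u = dm (fun w => ((g w)⁻¹)ᵀ) c u :=
    dm_congr (by filter_upwards [hS.mem_nhds hu] with w hw using (inv_symm hg hw).symm) c
  rw [dm_transpose] at h
  exact congrFun (congrFun h i) j

lemma Gam_symm (hu : u ∈ S) (c i j : Fin N) : Gam g c u i j = Gam g j u i c := by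
  rw [Gam_eq, Gam_eq]
  simp only [Matrix.mul_apply, Kk, Matrix.of_apply]
  refine Finset.sum_congr rfl fun s _ => ?_
  rw [dG_symm hS hg hu j s c, dG_symm hS hg hu c j s, dG_symm hS hg hu s j c]; ring

lemma SM_Gam (c : Fin N) : SM (Gam g c) S := by
  have : (Gam g c) = fun u => g u * Kk g c u := by ext1 u; exact Gam_eq g c u
  rw [this]
  refine SM.mul hg.1 ?_
  intro s j
  simp only [Kk, Matrix.of_apply, dm]
  have h := SMinv hg
  exact contDiffOn_const.mul (((pd_smooth hS (h _ _) _).add (pd_smooth hS (h _ _) _)).sub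
    (pd_smooth hS (h _ _) _))

lemma dm_metric (hu : u ∈ S) (c : Fin N) :
    dm g c u = -(g u * (Gam g c u)ᵀ + Gam g c u * g u) := by
  have h1 := dm_inv hS hg.1 hg.2.2 hu c
  have h2 : Kk g c u + (Kk g c u)ᵀ = dm (fun w => (g w)⁻¹) c u := by
    ext s j
    simp only [Matrix.add_apply, Matrix.transpose_apply, Kk, Matrix.of_apply]
    rw [dG_symm hS hg hu j s c, dG_symm hS hg hu c j s, dG_symm hS hg hu s j c]; ring
  have hgs : (g u)ᵀ = g u := hg.2.1 u hu
  rw [Gam_eq, Matrix.transpose_mul, hgs]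
  have h3 : g u * dm (fun w => (g w)⁻¹) c u * g u = - dm g c u := by
    rw [h1]
    simp only [mul_neg, neg_mul, neg_inj]
    rw [Matrix.mul_assoc, Matrix.mul_assoc, Matrix.nonsing_inv_mul _ (hg.2.2 u hu), mul_one,
      ← Matrix.mul_assoc, Matrix.mul_nonsing_inv _ (hg.2.2 u hu), one_mul]
  rw [← h2, mul_add, add_mul] at h3
  rw [← neg_eq_iff_eq_neg.2 h3.symm.symm]
  rw [add_comm]; simp only [Matrix.mul_assoc]

lemma Gam_unique (hu : u ∈ S) (Γ : Fin N → Matrix (Fin N) (Fin N) ℝ)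
    (hs : ∀ c i j, Γ c i j = Γ j i c)
    (hd : ∀ c, dm g c u = -(g u * (Γ c)ᵀ + Γ c * g u)) (c : Fin N) : Gam g c u = Γ c := by
  have hgi : g u * (g u)⁻¹ = 1 := Matrix.mul_nonsing_inv _ (hg.2.2 u hu)
  have hig : (g u)⁻¹ * g u = 1 := Matrix.nonsing_inv_mul _ (hg.2.2 u hu)
  set K : Fin N → Matrix (Fin N) (Fin N) ℝ := fun c => (g u)⁻¹ * Γ c with hK
  have hKs : ∀ c i j, K c i j = K j i c := by
    intro c i j
    simp only [hK, Matrix.mul_apply]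
    exact Finset.sum_congr rfl fun s _ => by rw [hs c s j]
  have hKd : ∀ c, dm (fun w => (g w)⁻¹) c u = K c + (K c)ᵀ := by
    intro c
    rw [dm_inv hS hg.1 hg.2.2 hu c, hd]
    simp only [mul_neg, neg_mul, neg_neg, mul_add, add_mul, hK, Matrix.transpose_mul,
      inv_symm hg hu]
    rw [← Matrix.mul_assoc, hig, one_mul, add_comm]
    congr 1
    rw [Matrix.mul_assoc, Matrix.mul_assoc, hgi, mul_one]
  have h4 : Kk g c u = K c := by
    ext s j
    simp only [Kk, Matrix.of_apply, hKd, Matrix.add_apply, Matrix.transpose_apply]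
    rw [hKs j s c, hKs j c s, hKs c j s]; ring
  rw [Gam_eq, h4, hK]
  simp only
  rw [← Matrix.mul_assoc, hgi, one_mul]

omit hS hg in
lemma christoffelR_eq (g : MetF N) (i j k : Fin N) (u : Fin N → ℝ) :
    christoffelR g i j k u = (g u * (Gam g k u)ᵀ) i j := by
  simp [christoffelR, Matrix.mul_apply, Gam]

lemma curvatureR_eq (hu : u ∈ S) (i j c d : Fin N) :
    curvatureR g i j c d u = (dm (fun w => g w * (Gam g d w)ᵀ) c u
      - dm (fun w => g w * (Gam g c w)ᵀ) d u + Gam g c u * g u * (Gam g d u)ᵀ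
      - Gam g d u * g u * (Gam g c u)ᵀ) i j := by
  have hR : curvatureR g i j c d u = (g u * (dm (Gam g d) c u - dm (Gam g c) d u +
      Gam g c u * Gam g d u - Gam g d u * Gam g c u)ᵀ) i j := by
    simp only [curvatureR, curvature, Matrix.mul_apply, Matrix.transpose_apply, Matrix.sub_apply,
      Matrix.add_apply, Finset.sum_sub_distrib]
    refine Finset.sum_congr rfl fun s _ => ?_
    simp only [Gam, dm, Matrix.of_apply]
    congr 1
    rw [add_sub_assoc]
  have hb : ∀ c d, dm (fun w => g w * (Gam g d w)ᵀ) c u =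
      dm g c u * (Gam g d u)ᵀ + g u * (dm (Gam g d) c u)ᵀ := by
    intro c d
    rw [dm_mul (SM.dM hg.1 hS hu) (((SM_Gam hS hg d).dM hS hu).transpose), dm_transpose]
  rw [hR, hb, hb, dm_metric hS hg hu, dm_metric hS hg hu]
  refine congrFun (congrFun ?_ i) j
  simp only [Matrix.transpose_sub, Matrix.transpose_add, Matrix.transpose_mul, mul_add, mul_sub,
    neg_mul, add_mul, neg_add, Matrix.mul_assoc]
  abel
end
end RI
end

section
open scoped ContDiff Topology
open Matrix
namespace RI
variable {N : ℕ}

lemma commute_diag {f : Fin N → ℝ} (hf : Function.Injective f) {M : Matrix (Fin N) (Fin N) ℝ}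
    (h : Matrix.diagonal f * M = M * Matrix.diagonal f) {i j : Fin N} (hij : i ≠ j) : M i j = 0 := by
  have h1 := congrFun (congrFun h i) j
  rw [Matrix.diagonal_mul, Matrix.mul_diagonal] at h1
  have h2 : (f i - f j) * M i j = 0 := by linarith
  rcases mul_eq_zero.1 h2 with h3 | h3
  · exact absurd (hf (sub_eq_zero.1 h3)) hij
  · exact h3

/-- lower-index matrix of the `k`-th Christoffel symbol -/
noncomputable def Cm (g : MetF N) (k : Fin N) (u : Fin N → ℝ) : Matrix (Fin N) (Fin N) ℝ :=
  Matrix.of fun r s => Gam g s u k r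

lemma frame_deriv {g Θ : MetF N} {S : Set (Fin N → ℝ)} (hS : IsOpen S) (hg : IsMetricOn g S)
    (hΘ : SM Θ S) (hΘu : ∀ u ∈ S, IsUnit (Θ u).det) {u : Fin N → ℝ} (hu : u ∈ S) (c : Fin N) :
    dm (fun w => Θ w * g w * (Θ w)ᵀ) c u =
      (dm Θ c u - Θ u * Gam g c u) * (Θ u)⁻¹ * (Θ u * g u * (Θ u)ᵀ) +
      (Θ u * g u * (Θ u)ᵀ) * ((dm Θ c u - Θ u * Gam g c u) * (Θ u)⁻¹)ᵀ := by
  have h1 : (Θ u)⁻¹ * Θ u = 1 := Matrix.nonsing_inv_mul _ (hΘu u hu)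
  have h2 : ∀ X, X * (Θ u)⁻¹ * (Θ u * g u * (Θ u)ᵀ) = X * g u * (Θ u)ᵀ := by
    intro X
    rw [Matrix.mul_assoc X, ← Matrix.mul_assoc (Θ u)⁻¹, ← Matrix.mul_assoc (Θ u)⁻¹, h1, one_mul,
      Matrix.mul_assoc X]
  have h3 : ∀ X, (Θ u * g u * (Θ u)ᵀ) * (X * (Θ u)⁻¹)ᵀ = Θ u * g u * Xᵀ := by
    intro X
    rw [Matrix.mul_assoc, ← Matrix.transpose_mul, Matrix.mul_assoc X, h1, mul_one]
  rw [h2, h3]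
  have hd := hΘ.dM hS hu
  rw [dm_mul (hd.mul (SM.dM hg.1 hS hu)) hd.transpose, dm_mul hd (SM.dM hg.1 hS hu), dm_transpose,
    dm_metric hS hg hu c, Matrix.transpose_sub, Matrix.transpose_mul]
  simp only [mul_add, mul_sub, neg_mul, mul_neg, add_mul, sub_mul, neg_add, Matrix.mul_assoc]
  abel

lemma almost_delta {g1 g2 : MetF N} {S : Set (Fin N → ℝ)} (hS : IsOpen S) (hg1 : IsMetricOn g1 S)
    (hg2 : IsMetricOn g2 S) (hc : AlmostCompatibleOn g1 g2 S) {u : Fin N → ℝ} (hu : u ∈ S)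
    (k : Fin N) :
    g1 u * (Cm g2 k u - Cm g1 k u) * g2 u = g2 u * (Cm g2 k u - Cm g1 k u) * g1 u := by
  -- choose t
  obtain ⟨t, ht0, ht⟩ : ∃ t : ℝ, t ≠ 0 ∧ IsUnit ((1 : ℝ) • g1 u + t • g2 u).det := by
    have hcont : Continuous fun t : ℝ => ((1 : ℝ) • g1 u + t • g2 u).det := by
      apply Continuous.matrix_det
      fun_prop
    have h0 : ((1 : ℝ) • g1 u + (0 : ℝ) • g2 u).det ≠ 0 := by
      simpa using (hg1.2.2 u hu).ne_zero
    have h1 : ∀ᶠ t in 𝓝 (0 : ℝ), ((1 : ℝ) • g1 u + t • g2 u).det ≠ 0 :=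
      hcont.continuousAt.eventually_ne h0
    have h2 : ∀ᶠ t in 𝓝[≠] (0 : ℝ), ((1 : ℝ) • g1 u + t • g2 u).det ≠ 0 ∧ t ≠ 0 :=
      (h1.filter_mono nhdsWithin_le_nhds).and self_mem_nhdsWithin
    obtain ⟨t, h3, h4⟩ := h2.exists
    exact ⟨t, h4, h3.isUnit⟩
  set h : MetF N := fun v => (1 : ℝ) • g1 v + t • g2 v with hh
  have hSM : SM h S := (SM.smul contDiffOn_const hg1.1).add (SM.smul contDiffOn_const hg2.1)
  set S' : Set (Fin N → ℝ) := S ∩ (fun v => (h v).det) ⁻¹' {0}ᶜ with hS'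
  have hS'o : IsOpen S' := (det_smooth hSM).continuousOn.isOpen_inter_preimage hS
    isOpen_compl_singleton
  have huS' : u ∈ S' := ⟨hu, ht.ne_zero⟩
  have hhm : IsMetricOn h S' := by
    refine ⟨hSM.mono Set.inter_subset_left, fun v hv => ?_, fun v hv => ?_⟩
    · exact ((hg1.2.1 v hv.1).smul _).add ((hg2.2.1 v hv.1).smul _)
    · exact (show (h v).det ≠ 0 from hv.2).isUnit
  have hsym : ∀ {g : MetF N} {T : Set (Fin N → ℝ)}, IsOpen T → IsMetricOn g T → u ∈ T →
      (Cm g k u)ᵀ = Cm g k u := by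
    intro g T hT hg huT
    ext r s
    exact Gam_symm hT hg huT r k s
  have hlin : h u * Cm h k u = g1 u * Cm g1 k u + t • (g2 u * Cm g2 k u) := by
    ext j s
    have := hc 1 t u hu ht j k s
    rw [christoffelR_eq, christoffelR_eq, christoffelR_eq] at this
    simp only [Matrix.mul_apply, Matrix.transpose_apply, Matrix.add_apply, Matrix.smul_apply,
      Cm, Matrix.of_apply, smul_eq_mul, one_mul] at this ⊢
    rw [← this]
    simp [hh]
  have hs1 : (g1 u)ᵀ = g1 u := hg1.2.1 u hu
  have hs2 : (g2 u)ᵀ = g2 u := hg2.2.1 u hu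
  have hsh : (h u)ᵀ = h u := hhm.2.1 u huS'
  have c1 := hsym hS hg1 hu
  have c2 := hsym hS hg2 hu
  have ch := hsym hS'o hhm huS'
  have e1 : h u * Cm h k u * h u = (h u * Cm h k u * h u)ᵀ := by
    rw [Matrix.transpose_mul, Matrix.transpose_mul, hsh, ch, Matrix.mul_assoc]
  rw [hlin] at e1
  simp only [hh, one_smul, Matrix.transpose_mul, Matrix.transpose_add, Matrix.transpose_smul,
    hs1, hs2, c1, c2, add_mul, mul_add, Matrix.mul_smul, Matrix.smul_mul, smul_add] at e1
  have e2 : t • (g1 u * Cm g1 k u * g2 u + g2 u * Cm g2 k u * g1 u) =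
      t • (g2 u * Cm g1 k u * g1 u + g1 u * Cm g2 k u * g2 u) := by
    simp only [smul_add]
    simp only [Matrix.mul_assoc] at e1 ⊢
    rw [← sub_eq_zero] at e1 ⊢
    rw [← e1]; abel
  have e3 := smul_right_injective _ ht0 e2
  simp only [mul_sub, sub_mul]
  rw [← sub_eq_zero] at e3 ⊢
  rw [← neg_eq_zero, ← e3]; abel
end RI
end

section
open scoped ContDiff Topology
open Matrix
namespace RI
variable {N : ℕ}

section
variable {g1 g2 : MetF N} {S : Set (Fin N → ℝ)} (hS : IsOpen S) (hg1 : IsMetricOn g1 S)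
    (hg2 : IsMetricOn g2 S) {f : Fin N → (Fin N → ℝ) → ℝ} {Θ : MetF N}
    (hf : ∀ i, ContDiffOn ℝ ∞ (f i) S) (hΘ : SM Θ S)
    (hfi : ∀ u ∈ S, Function.Injective fun i => f i u)
    (hΘu : ∀ u ∈ S, IsUnit (Θ u).det)
    (hfr : ∀ u ∈ S, Θ u * g1 u = Matrix.diagonal (fun i => f i u) * Θ u * g2 u)

include hg1 hg2 hfi hΘu hfr

lemma frame_diag {u : Fin N → ℝ} (hu : u ∈ S) :
    (∀ i j, i ≠ j → (Θ u * g2 u * (Θ u)ᵀ) i j = 0) ∧ (∀ i, (Θ u * g2 u * (Θ u)ᵀ) i i ≠ 0) ∧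
    Θ u * g1 u * (Θ u)ᵀ = Matrix.diagonal (fun i => f i u) * (Θ u * g2 u * (Θ u)ᵀ) := by
  have hs1 : (g1 u)ᵀ = g1 u := hg1.2.1 u hu
  have hs2 : (g2 u)ᵀ = g2 u := hg2.2.1 u hu
  have h3 : Θ u * g1 u * (Θ u)ᵀ = Matrix.diagonal (fun i => f i u) * (Θ u * g2 u * (Θ u)ᵀ) := by
    rw [hfr u hu]; simp only [Matrix.mul_assoc]
  have hD : (Θ u * g2 u * (Θ u)ᵀ)ᵀ = Θ u * g2 u * (Θ u)ᵀ := by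
    simp [Matrix.transpose_mul, hs2, Matrix.mul_assoc]
  have hD1 : (Θ u * g1 u * (Θ u)ᵀ)ᵀ = Θ u * g1 u * (Θ u)ᵀ := by
    simp [Matrix.transpose_mul, hs1, Matrix.mul_assoc]
  have h1 : ∀ i j, i ≠ j → (Θ u * g2 u * (Θ u)ᵀ) i j = 0 := by
    intro i j hij
    refine commute_diag (hfi u hu) ?_ hij
    rw [← h3, ← hD1, h3, Matrix.transpose_mul, hD, Matrix.diagonal_transpose]
  refine ⟨h1, fun i hi => ?_, h3⟩
  have h4 : IsUnit (Θ u * g2 u * (Θ u)ᵀ).det := by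
    rw [Matrix.det_mul, Matrix.det_mul, Matrix.det_transpose]
    exact ((hΘu u hu).mul (hg2.2.2 u hu)).mul (hΘu u hu)
  refine h4.ne_zero (Matrix.det_eq_zero_of_row_eq_zero i fun j => ?_)
  by_cases hij : i = j
  · rw [← hij]; exact hi
  · exact h1 i j hij

include hS hf hΘ

lemma frame_consequences (hc : AlmostCompatibleOn g1 g2 S) {u : Fin N → ℝ} (hu : u ∈ S)
    (i : Fin N) :
    (∀ a b : Fin N → ℝ, (Θ u *ᵥ a) i = 0 → (Θ u *ᵥ b) i = 0 →
      ∑ c, a c * (dm Θ c u *ᵥ b) i = ∑ c, b c * (dm Θ c u *ᵥ a) i) ∧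
    (∀ a : Fin N → ℝ, (Θ u *ᵥ a) i = 0 → ∑ c, a c * pd (f i) c u = 0) := by
  set E := (Θ u)⁻¹ with hE
  have hEΘ : E * Θ u = 1 := Matrix.nonsing_inv_mul _ (hΘu u hu)
  have hΘE : Θ u * E = 1 := Matrix.mul_nonsing_inv _ (hΘu u hu)
  obtain ⟨hd0, hdn, hd1⟩ := frame_diag hg1 hg2 hfi hΘu hfr hu
  set D := Θ u * g2 u * (Θ u)ᵀ with hD
  set d : Fin N → ℝ := fun i => D i i with hdd
  have hDd : D = Matrix.diagonal d := by
    ext i j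
    by_cases hij : i = j
    · subst hij; simp [hdd]
    · rw [Matrix.diagonal_apply_ne _ hij]; exact hd0 i j hij
  -- frame components of the difference tensor
  have hdelta : ∀ k m n, m ≠ n → (Eᵀ * (Cm g2 k u - Cm g1 k u) * E) m n = 0 := by
    intro k m n hmn
    set Δ := Cm g2 k u - Cm g1 k u with hΔ
    have h1 := almost_delta hS hg1 hg2 hc hu k
    rw [← hΔ] at h1
    have hs1 : (g1 u)ᵀ = g1 u := hg1.2.1 u hu
    have hs2 : (g2 u)ᵀ = g2 u := hg2.2.1 u hu
    have hfrT : g1 u * (Θ u)ᵀ = g2 u * (Θ u)ᵀ * Matrix.diagonal (fun i => f i u) := by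
      have := congrArg Matrix.transpose (hfr u hu)
      simpa [Matrix.transpose_mul, hs1, hs2, Matrix.mul_assoc] using this
    have h2 : (Θ u * g2 u * Δ * (g2 u * (Θ u)ᵀ)) m n = 0 := by
      refine commute_diag (hfi u hu) ?_ hmn
      calc Matrix.diagonal (fun i => f i u) * (Θ u * g2 u * Δ * (g2 u * (Θ u)ᵀ))
          = Matrix.diagonal (fun i => f i u) * Θ u * g2 u * Δ * (g2 u * (Θ u)ᵀ) := by
            simp only [Matrix.mul_assoc]
        _ = Θ u * (g1 u * Δ * g2 u) * (Θ u)ᵀ := by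
            rw [← hfr u hu]; simp only [Matrix.mul_assoc]
        _ = Θ u * g2 u * Δ * (g1 u * (Θ u)ᵀ) := by
            rw [h1]; simp only [Matrix.mul_assoc]
        _ = _ := by rw [hfrT]; simp only [Matrix.mul_assoc]
    have h3 : Θ u * g2 u = D * Eᵀ := by
      rw [hD, Matrix.mul_assoc _ (Θ u)ᵀ, ← Matrix.transpose_mul, hEΘ, Matrix.transpose_one, mul_one]
    have hDT : Dᵀ = D := by rw [hDd, Matrix.diagonal_transpose]
    have h4 : g2 u * (Θ u)ᵀ = E * D := by
      have := congrArg Matrix.transpose h3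
      rwa [Matrix.transpose_mul, Matrix.transpose_mul, hDT, hs2, Matrix.transpose_transpose] at this
    rw [h3, h4] at h2
    have h5 : D * Eᵀ * Δ * (E * D) = D * (Eᵀ * Δ * E) * D := by simp only [Matrix.mul_assoc]
    rw [h5, hDd, Matrix.mul_diagonal, Matrix.diagonal_mul] at h2
    have := hdn m; have := hdn n
    simpa [hdd, hdn m, hdn n] using h2
  set Om1 : Fin N → Matrix (Fin N) (Fin N) ℝ := fun c => (dm Θ c u - Θ u * Gam g1 c u) * E
  set Om2 : Fin N → Matrix (Fin N) (Fin N) ℝ := fun c => (dm Θ c u - Θ u * Gam g2 c u) * E with hOm2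
  set O1 : Fin N → Fin N → Fin N → ℝ := fun i j k => ∑ c, E c k * Om1 c i j with hO1
  set O2 : Fin N → Fin N → Fin N → ℝ := fun i j k => ∑ c, E c k * Om2 c i j with hO2
  have hO12 : ∀ i j k, j ≠ k → O1 i j k = O2 i j k := by
    intro i j k hjk
    rw [← sub_eq_zero]
    have h1 : ∀ c, Om1 c i j - Om2 c i j = ∑ p, Θ u i p * ∑ r, E r j *
        (Cm g2 p u - Cm g1 p u) r c := by
      intro c
      have : Om1 c - Om2 c = Θ u * ((Gam g2 c u - Gam g1 c u) * E) := by
        simp only [Om1, Om2, ← sub_mul, ← Matrix.mul_assoc]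
        congr 1
        rw [mul_sub]; abel
      have h2 := congrFun (congrFun this i) j
      rw [Matrix.sub_apply] at h2
      rw [h2, Matrix.mul_apply]
      refine Finset.sum_congr rfl fun p _ => ?_
      rw [Matrix.mul_apply]
      congr 1
      refine Finset.sum_congr rfl fun r _ => ?_
      simp only [Cm, Matrix.sub_apply, Matrix.of_apply]; ring
    have h2 : O1 i j k - O2 i j k = ∑ p, Θ u i p * (Eᵀ * (Cm g2 p u - Cm g1 p u) * E) j k := by
      simp only [hO1, hO2, ← Finset.sum_sub_distrib, ← mul_sub, h1]
      simp only [Finset.mul_sum, Matrix.mul_apply, Matrix.transpose_apply, Finset.sum_mul]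
      rw [Finset.sum_comm]
      refine Finset.sum_congr rfl fun p _ => Finset.sum_congr rfl fun c _ =>
        Finset.sum_congr rfl fun r _ => by ring
    rw [h2]
    exact Finset.sum_eq_zero fun p _ => by rw [hdelta p j k hjk, mul_zero]
  have hder1 : ∀ c, dm (fun w => Θ w * g1 w * (Θ w)ᵀ) c u =
      Om1 c * Matrix.diagonal (fun i => f i u * d i) +
      Matrix.diagonal (fun i => f i u * d i) * (Om1 c)ᵀ := by
    intro c
    have h1 := frame_deriv hS hg1 hΘ hΘu hu c
    rw [hd1, hDd, Matrix.diagonal_mul_diagonal] at h1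
    exact h1
  have hder2 : ∀ c, dm (fun w => Θ w * g2 w * (Θ w)ᵀ) c u =
      Om2 c * Matrix.diagonal d + Matrix.diagonal d * (Om2 c)ᵀ := by
    intro c
    have h1 := frame_deriv hS hg2 hΘ hΘu hu c
    rw [← hD, hDd] at h1
    exact h1
  have hoff2 : ∀ c i j, i ≠ j → dm (fun w => Θ w * g2 w * (Θ w)ᵀ) c u i j = 0 := by
    intro c i j hij
    rw [← pd_const 0 c u]
    refine pd_congr ?_ c
    filter_upwards [hS.mem_nhds hu] with w hw
    exact (frame_diag hg1 hg2 hfi hΘu hfr hw).1 i j hij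
  have hoff1 : ∀ c i j, i ≠ j → dm (fun w => Θ w * g1 w * (Θ w)ᵀ) c u i j = 0 := by
    intro c i j hij
    rw [← pd_const 0 c u]
    refine pd_congr ?_ c
    filter_upwards [hS.mem_nhds hu] with w hw
    have := (frame_diag hg1 hg2 hfi hΘu hfr hw)
    rw [this.2.2, Matrix.diagonal_mul, this.1 i j hij, mul_zero]
  have hr2 : ∀ i j k, i ≠ j → O2 i j k * d j + d i * O2 j i k = 0 := by
    intro i j k hij
    simp only [hO2, Finset.sum_mul, Finset.mul_sum, ← Finset.sum_add_distrib]
    refine Finset.sum_eq_zero fun c _ => ?_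
    have h1 := hoff2 c i j hij
    rw [hder2, Matrix.add_apply, Matrix.mul_diagonal, Matrix.diagonal_mul,
      Matrix.transpose_apply] at h1
    linear_combination E c k * h1
  have hr1 : ∀ i j k, i ≠ j → O1 i j k * (f j u * d j) + (f i u * d i) * O1 j i k = 0 := by
    intro i j k hij
    simp only [hO1, Finset.sum_mul, Finset.mul_sum, ← Finset.sum_add_distrib]
    refine Finset.sum_eq_zero fun c _ => ?_
    have h1 := hoff1 c i j hij
    rw [hder1, Matrix.add_apply, Matrix.mul_diagonal, Matrix.diagonal_mul,
      Matrix.transpose_apply] at h1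
    linear_combination E c k * h1
  have hO0 : ∀ i j k, i ≠ j → j ≠ k → i ≠ k → O2 i j k = 0 := by
    intro i j k hij hjk hik
    have h1 := hr1 i j k hij
    have h2 := hr2 i j k hij
    rw [hO12 i j k hjk, hO12 j i k hik] at h1
    have h3 : (f j u - f i u) * d j * O2 i j k = 0 := by linear_combination h1 - f i u * h2
    have h4 : f j u - f i u ≠ 0 := sub_ne_zero.2 fun h => hij (hfi u hu h).symm
    have h5 : d j ≠ 0 := hdn j
    simpa [h4, h5] using h3
  have hexp : ∀ a : Fin N → ℝ, ∀ c, a c = ∑ k, E c k * (Θ u *ᵥ a) k := by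
    intro a c
    have h1 : E *ᵥ (Θ u *ᵥ a) = a := by rw [Matrix.mulVec_mulVec, hEΘ, Matrix.one_mulVec]
    exact (congrFun h1 c).symm
  have hdf : ∀ k, k ≠ i → ∑ c, E c k * pd (f i) c u = 0 := by
    intro k hki
    have hsmD : SM (fun w => Θ w * g2 w * (Θ w)ᵀ) S := (hΘ.mul hg2.1).mul hΘ.transpose
    have h1 : ∀ c, dm (fun w => Θ w * g1 w * (Θ w)ᵀ) c u i i =
        pd (f i) c u * d i + f i u * dm (fun w => Θ w * g2 w * (Θ w)ᵀ) c u i i := by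
      intro c
      have h2 : dm (fun w => Θ w * g1 w * (Θ w)ᵀ) c u i i =
          pd (fun w => f i w * (Θ w * g2 w * (Θ w)ᵀ) i i) c u := by
        refine pd_congr ?_ c
        filter_upwards [hS.mem_nhds hu] with w hw
        rw [(frame_diag hg1 hg2 hfi hΘu hfr hw).2.2, Matrix.diagonal_mul]
      rw [h2, pd_mul (((hf i).contDiffAt (hS.mem_nhds hu)).differentiableAt (by simp))
        (hsmD.dM hS hu i i)]
      rfl
    have h3 : ∀ c, 2 * Om1 c i i * (f i u * d i) =
        pd (f i) c u * d i + f i u * (2 * Om2 c i i * d i) := by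
      intro c
      have := h1 c
      rw [hder1, hder2] at this
      simp only [Matrix.add_apply, Matrix.mul_diagonal, Matrix.diagonal_mul,
        Matrix.transpose_apply] at this
      linear_combination this
    have h4 : (∑ c, E c k * pd (f i) c u) * d i = 2 * (f i u * d i) * (O1 i i k - O2 i i k) := by
      simp only [hO1, hO2, ← Finset.sum_sub_distrib, Finset.sum_mul, Finset.mul_sum]
      refine Finset.sum_congr rfl fun c _ => ?_
      linear_combination (- E c k) * h3 c
    rw [hO12 i i k hki.symm, sub_self, mul_zero] at h4
    exact (mul_eq_zero.1 h4).resolve_right (hdn i)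
  constructor
  · intro a b ha hb
    have hQ : ∀ a b : Fin N → ℝ, ∑ c, a c * (dm Θ c u *ᵥ b) i =
        (∑ k, ∑ j, (Θ u *ᵥ a) k * (Θ u *ᵥ b) j * O2 i j k) +
        ∑ c, a c * ((Θ u * Gam g2 c u) *ᵥ b) i := by
      intro a b
      have h1 : ∀ c, (dm Θ c u *ᵥ b) i = (Om2 c *ᵥ (Θ u *ᵥ b)) i +
          ((Θ u * Gam g2 c u) *ᵥ b) i := by
        intro c
        rw [Matrix.mulVec_mulVec, ← Pi.add_apply, ← Matrix.add_mulVec]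
        simp only [hOm2, Matrix.mul_assoc _ E, hEΘ, mul_one, sub_add_cancel]
      simp only [h1, mul_add, Finset.sum_add_distrib]
      congr 1
      have h2 : ∀ c, a c * (Om2 c *ᵥ (Θ u *ᵥ b)) i = ∑ k, ∑ j, E c k * (Θ u *ᵥ a) k *
          (Om2 c i j * (Θ u *ᵥ b) j) := by
        intro c
        conv_lhs => rw [hexp a c]
        rw [Matrix.mulVec, dotProduct, Finset.sum_mul_sum]
      simp only [h2]
      rw [Finset.sum_comm]
      refine Finset.sum_congr rfl fun k _ => ?_
      rw [Finset.sum_comm]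
      refine Finset.sum_congr rfl fun j _ => ?_
      simp only [hO2, Finset.mul_sum]
      exact Finset.sum_congr rfl fun c _ => by ring
    rw [hQ a b, hQ b a]
    congr 1
    · have hz : ∀ a b : Fin N → ℝ, (Θ u *ᵥ a) i = 0 → (Θ u *ᵥ b) i = 0 →
          (∑ k, ∑ j, (Θ u *ᵥ a) k * (Θ u *ᵥ b) j * O2 i j k) =
          ∑ k, (Θ u *ᵥ a) k * (Θ u *ᵥ b) k * O2 i k k := by
        intro a b ha hb
        refine Finset.sum_congr rfl fun k _ => ?_
        refine Finset.sum_eq_single_of_mem k (Finset.mem_univ _) fun j _ hjk => ?_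
        by_cases hij : i = j
        · rw [← hij, hb]; ring
        by_cases hik : i = k
        · rw [← hik, ha]; ring
        rw [hO0 i j k hij hjk hik, mul_zero]
      rw [hz a b ha hb, hz b a hb ha]
      exact Finset.sum_congr rfl fun k _ => by ring
    · have hG : ∀ a b : Fin N → ℝ, ∑ c, a c * ((Θ u * Gam g2 c u) *ᵥ b) i =
          ∑ c, ∑ j, ∑ p, Θ u i p * Gam g2 c u p j * (a c * b j) := by
        intro a b
        refine Finset.sum_congr rfl fun c _ => ?_
        simp only [Matrix.mulVec, dotProduct, Matrix.mul_apply, Finset.mul_sum, Finset.sum_mul]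
        exact Finset.sum_congr rfl fun j _ => Finset.sum_congr rfl fun p _ => by ring
      rw [hG, hG, Finset.sum_comm]
      refine Finset.sum_congr rfl fun c _ => Finset.sum_congr rfl fun j _ =>
        Finset.sum_congr rfl fun p _ => ?_
      rw [Gam_symm hS hg2 hu j p c]; ring
  · intro a ha
    have h1 : ∑ c, a c * pd (f i) c u = ∑ k, (Θ u *ᵥ a) k * ∑ c, E c k * pd (f i) c u := by
      have h2 : ∀ c, a c * pd (f i) c u = ∑ k, E c k * (Θ u *ᵥ a) k * pd (f i) c u := by
        intro c
        conv_lhs => rw [hexp a c, Finset.sum_mul]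
      simp only [h2, Finset.mul_sum]
      rw [Finset.sum_comm]
      exact Finset.sum_congr rfl fun k _ => Finset.sum_congr rfl fun c _ => by ring
    rw [h1]
    refine Finset.sum_eq_zero fun k _ => ?_
    by_cases hki : k = i
    · rw [hki, ha, zero_mul]
    · rw [hdf k hki, mul_zero]
end
end RI
end

section
open scoped ContDiff Topology
open Matrix
namespace RI
variable {N : ℕ}

lemma fderiv_eq_pd (h : (Fin N → ℝ) → ℝ) (u a : Fin N → ℝ) :
    fderiv ℝ h u a = ∑ c, a c * pd h c u := by
  have h1 : a = ∑ c, a c • (Pi.single c 1 : Fin N → ℝ) := by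
    ext j; simp [Pi.single_apply]
  conv_lhs => rw [h1]
  simp [pd]

lemma IsMetricOn.mono' {g : MetF N} {S T : Set (Fin N → ℝ)} (h : IsMetricOn g S) (hT : T ⊆ S) :
    IsMetricOn g T :=
  ⟨fun i j => (h.1 i j).mono hT, fun u hu => h.2.1 u (hT hu), fun u hu => h.2.2 u (hT hu)⟩

/-- row of a matrix as a covector -/
noncomputable def rowc (M : Matrix (Fin N) (Fin N) ℝ) (i : Fin N) : (Fin N → ℝ) →L[ℝ] ℝ :=
  ∑ j, M i j • (ContinuousLinearMap.proj j : (Fin N → ℝ) →L[ℝ] ℝ)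

lemma rowc_apply (M : Matrix (Fin N) (Fin N) ℝ) (i : Fin N) (a : Fin N → ℝ) :
    rowc M i a = (M *ᵥ a) i := by
  simp [rowc, Matrix.mulVec, dotProduct]

lemma rowc_smooth {M : MetF N} {S : Set (Fin N → ℝ)} (hM : SM M S) (i : Fin N) :
    ContDiffOn ℝ ∞ (fun u => rowc (M u) i) S := by
  unfold rowc
  exact ContDiffOn.sum fun j _ => (hM i j).smul contDiffOn_const

lemma rowc_fderiv {M : MetF N} {u : Fin N → ℝ} (hM : DM M u) (i : Fin N) (a b : Fin N → ℝ) :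
    fderiv ℝ (fun u => rowc (M u) i) u a b = ∑ c, a c * (dm M c u *ᵥ b) i := by
  have h1 : HasFDerivAt (fun u => rowc (M u) i)
      (∑ j, (fderiv ℝ (fun w => M w i j) u).smulRight
        (ContinuousLinearMap.proj j : (Fin N → ℝ) →L[ℝ] ℝ)) u := by
    unfold rowc
    exact HasFDerivAt.fun_sum fun j _ => (hM i j).hasFDerivAt.smul_const
      (ContinuousLinearMap.proj j : (Fin N → ℝ) →L[ℝ] ℝ)
  rw [h1.fderiv]
  simp only [_root_.sum_apply, ContinuousLinearMap.smulRight_apply,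
    _root_.smul_apply, ContinuousLinearMap.proj_apply, smul_eq_mul, fderiv_eq_pd]
  simp only [Matrix.mulVec, dotProduct, dm, Matrix.of_apply, Finset.sum_mul, Finset.mul_sum]
  rw [Finset.sum_comm]
  exact Finset.sum_congr rfl fun c _ => Finset.sum_congr rfl fun j _ => by ring

lemma coords {g1 g2 : MetF N} {S : Set (Fin N → ℝ)} (hS : IsOpen S) (hg1 : IsMetricOn g1 S)
    (hg2 : IsMetricOn g2 S) {f : Fin N → (Fin N → ℝ) → ℝ} {Θ : MetF N}
    (hf : ∀ i, ContDiffOn ℝ ∞ (f i) S) (hΘ : SM Θ S)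
    (hfi : ∀ u ∈ S, Function.Injective fun i => f i u)
    (hΘu : ∀ u ∈ S, IsUnit (Θ u).det)
    (hfr : ∀ u ∈ S, Θ u * g1 u = Matrix.diagonal (fun i => f i u) * Θ u * g2 u)
    (hc : AlmostCompatibleOn g1 g2 S) (p : Fin N → ℝ) (hp : p ∈ S) :
    ∃ T : OpenPartialHomeomorph (Fin N → ℝ) (Fin N → ℝ), p ∈ T.source ∧ T.source ⊆ S ∧
      ContDiffOn ℝ ∞ T T.source ∧ ContDiffOn ℝ ∞ T.symm T.target ∧
      ∀ u ∈ T.source, ∀ i, ∃ h : ℝ, h ≠ 0 ∧ ∀ k, pd (fun w => T w i) k u = h * Θ u i k := by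
  have hfrob : ∀ i, ∃ x : (Fin N → ℝ) → ℝ, ∃ W, IsOpen W ∧ p ∈ W ∧ W ⊆ S ∧ ContDiffOn ℝ ∞ x W ∧
      ∀ u ∈ W, ∃ h : ℝ, h ≠ 0 ∧ fderiv ℝ x u = h • rowc (Θ u) i := by
    intro i
    refine frobenius (fun u => rowc (Θ u) i) S hS (rowc_smooth hΘ i) p hp ?_ ?_
    · intro h0
      refine (hΘu p hp).ne_zero (Matrix.det_eq_zero_of_row_eq_zero i fun j => ?_)
      have := congrArg (fun L : (Fin N → ℝ) →L[ℝ] ℝ => L (Pi.single j 1)) h0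
      simpa [rowc_apply] using this
    · intro u hu a b ha hb
      rw [rowc_fderiv (hΘ.dM hS hu), rowc_fderiv (hΘ.dM hS hu)]
      rw [rowc_apply] at ha hb
      exact (frame_consequences hS hg1 hg2 hf hΘ hfi hΘu hfr hc hu i).1 a b ha hb
  choose x W hWo hpW hWS hx hxd using hfrob
  set φ : (Fin N → ℝ) → (Fin N → ℝ) := fun u i => x i u with hφ
  set O := S ∩ ⋂ i, W i with hO
  have hOo : IsOpen O := hS.inter (isOpen_iInter_of_finite hWo)
  have hpO : p ∈ O := ⟨hp, Set.mem_iInter.2 hpW⟩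
  have hOW : ∀ i, O ⊆ W i := fun i u hu => Set.mem_iInter.1 hu.2 i
  have hφs : ContDiffOn ℝ ∞ φ O := contDiffOn_pi.2 fun i => (hx i).mono (hOW i)
  have hφd : HasFDerivAt φ (ContinuousLinearMap.pi fun i => fderiv ℝ (x i) p) p :=
    hasFDerivAt_pi.2 fun i =>
      (((hx i).contDiffAt ((hWo i).mem_nhds (hpW i))).differentiableAt (by simp)).hasFDerivAt
  have hinj : Function.Injective
      (ContinuousLinearMap.pi fun i => fderiv ℝ (x i) p : (Fin N → ℝ) →L[ℝ] (Fin N → ℝ)) := by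
    rw [injective_iff_map_eq_zero]
    intro a ha
    have h1 : Θ p *ᵥ a = 0 := by
      ext i
      have h2 := congrFun ha i
      obtain ⟨h, h0, hh⟩ := hxd i p (hpW i)
      simp only [ContinuousLinearMap.coe_pi', hh] at h2
      simpa [h0, rowc_apply] using h2
    exact Matrix.eq_zero_of_mulVec_eq_zero (hΘu p hp).ne_zero h1
  let e : (Fin N → ℝ) ≃L[ℝ] (Fin N → ℝ) := (LinearEquiv.ofInjectiveEndo
    (ContinuousLinearMap.pi fun i => fderiv ℝ (x i) p : (Fin N → ℝ) →L[ℝ] (Fin N → ℝ)).toLinearMap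
    hinj).toContinuousLinearEquiv
  have he : (e : (Fin N → ℝ) →L[ℝ] (Fin N → ℝ)) =
      ContinuousLinearMap.pi fun i => fderiv ℝ (x i) p := by
    ext a i; rfl
  obtain ⟨T, hT, hpT, hTO, hTs⟩ := inv_local φ O hOo hφs p hpO e (by rw [he]; exact hφd)
  refine ⟨T, hpT, fun u hu => (hTO hu).1, by rw [hT]; exact hφs.mono hTO,
    fun y hy => (hTs y hy).contDiffWithinAt, fun u hu i => ?_⟩
  obtain ⟨h, h0, hh⟩ := hxd i u (hOW i (hTO hu))
  refine ⟨h, h0, fun k => ?_⟩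
  rw [hT]
  have : pd (fun w => φ w i) k u = fderiv ℝ (x i) u (Pi.single k 1) := rfl
  rw [this, hh]
  simp [rowc_apply]
end RI
end

section
open scoped ContDiff Topology
open Matrix
namespace RI
variable {N : ℕ}

lemma const_along {F : (Fin N → ℝ) → ℝ} {q : Fin N → ℝ} {ε : ℝ} {i : Fin N}
    (hF : ContDiffOn ℝ ∞ F (Metric.ball q ε))
    (hd : ∀ x ∈ Metric.ball q ε, ∀ y : Fin N → ℝ, y i = 0 → fderiv ℝ F x y = 0)
    {x y : Fin N → ℝ} (hx : x ∈ Metric.ball q ε) (hy : y ∈ Metric.ball q ε) (h : x i = y i) :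
    F x = F y := by
  have hm : ∀ t ∈ Set.Icc (0 : ℝ) 1, x + t • (y - x) ∈ Metric.ball q ε := fun t ht =>
    (convex_ball q ε).add_smul_sub_mem hx hy ht
  have hda : ∀ t ∈ Set.Icc (0 : ℝ) 1, HasDerivAt (fun t : ℝ => F (x + t • (y - x))) 0 t := by
    intro t ht
    have h1 : HasFDerivAt F (fderiv ℝ F (x + t • (y - x))) (x + t • (y - x)) :=
      ((hF.contDiffAt (Metric.isOpen_ball.mem_nhds (hm t ht))).differentiableAt
        (by simp)).hasFDerivAt
    have h2 : HasDerivAt (fun t : ℝ => x + t • (y - x)) (y - x) t := by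
      simpa using ((hasDerivAt_id t).smul_const (y - x)).const_add x
    have h3 := h1.comp_hasDerivAt t h2
    rw [hd _ (hm t ht) (y - x) (by simp [h])] at h3
    exact h3
  have := constant_of_has_deriv_right_zero (f := fun t : ℝ => F (x + t • (y - x))) (a := 0) (b := 1)
    (fun t ht => (hda t ht).continuousAt.continuousWithinAt)
    (fun t ht => (hda t ⟨ht.1, ht.2.le⟩).hasDerivWithinAt) 1 ⟨zero_le_one, le_rfl⟩
  simpa using this.symm

lemma cutoff (c ε : ℝ) (hε : 0 < ε) : ∃ χ : ℝ → ℝ, ContDiff ℝ ∞ χ ∧ (∀ t, |χ t - c| < ε) ∧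
    ∀ t, |t - c| < ε / 3 → χ t = t := by
  let b : ContDiffBump c := ⟨ε / 3, ε / 2, by positivity, by linarith⟩
  refine ⟨fun t => c + b t * (t - c), ?_, ?_, ?_⟩
  · exact contDiff_const.add (b.contDiff.mul (contDiff_id.sub contDiff_const))
  · intro t
    simp only [add_sub_cancel_left, abs_mul, abs_of_nonneg b.nonneg]
    by_cases h : |t - c| < ε / 2
    · calc b t * |t - c| ≤ 1 * |t - c| := by gcongr; exact b.le_one
        _ < ε := by linarith
    · rw [b.zero_of_le_dist (by rw [Real.dist_eq]; exact not_lt.1 h), zero_mul]; exact hε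
  · intro t ht
    change c + b t * (t - c) = t
    rw [b.one_of_mem_closedBall (by rw [Metric.mem_closedBall, Real.dist_eq]; exact ht.le)]
    ring

lemma sum_eq_frame (M A : Matrix (Fin N) (Fin N) ℝ) (i j : Fin N) (P Q : Fin N → ℝ) (h h' : ℝ)
    (hP : ∀ k, P k = h * M i k) (hQ : ∀ k, Q k = h' * M j k) :
    ∑ k, ∑ l, P k * Q l * A k l = h * h' * (M * A * Mᵀ) i j := by
  simp only [Matrix.mul_apply, Matrix.transpose_apply, Finset.sum_mul, Finset.mul_sum, hP, hQ]
  rw [Finset.sum_comm]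
  exact Finset.sum_congr rfl fun k _ => Finset.sum_congr rfl fun l _ => by ring

theorem forward (U : Set (Fin N → ℝ)) (hU : IsOpen U)
    (g1 g2 : MetF N) (hg1 : IsMetricOn g1 U) (hg2 : IsMetricOn g2 U)
    (hns : NonSingularPairOn g1 g2 U) (hc : AlmostCompatibleOn g1 g2 U)
    (p : Fin N → ℝ) (hp : p ∈ U) :
    ∃ U0 Vs : Set (Fin N → ℝ), ∃ φ ψ : (Fin N → ℝ) → (Fin N → ℝ),
        ∃ gh : Fin N → (Fin N → ℝ) → ℝ, ∃ f : Fin N → ℝ → ℝ,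
        IsOpen U0 ∧ p ∈ U0 ∧ U0 ⊆ U ∧ IsOpen Vs ∧ φ '' U0 = Vs ∧
        ContDiffOn ℝ (⊤ : ℕ∞) φ U0 ∧ ContDiffOn ℝ (⊤ : ℕ∞) ψ Vs ∧
        (∀ u ∈ U0, ψ (φ u) = u) ∧ (∀ x ∈ Vs, φ (ψ x) = x) ∧
        (∀ i, ContDiffOn ℝ (⊤ : ℕ∞) (gh i) Vs) ∧ (∀ i, ∀ x ∈ Vs, gh i x ≠ 0) ∧
        (∀ i, ContDiff ℝ (⊤ : ℕ∞) (f i)) ∧ (∀ i, ∀ t : ℝ, f i t ≠ 0) ∧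
        (∀ u ∈ U0, ∀ i j : Fin N,
          (∑ k, ∑ l, pd (fun w => φ w i) k u * pd (fun w => φ w j) l u * g2 u k l) =
            if i = j then gh i (φ u) else 0) ∧
        (∀ u ∈ U0, ∀ i j : Fin N,
          (∑ k, ∑ l, pd (fun w => φ w i) k u * pd (fun w => φ w j) l u * g1 u k l) =
            if i = j then f i (φ u i) * gh i (φ u) else 0) := by
  obtain ⟨S, hS, hpS, hSU, f, Θ, hf, hΘ, hfi, hΘu, hfr⟩ := eigenframe U hU g1 g2 hg1 hg2 hns p hp
  have hg1' := IsMetricOn.mono' hg1 hSU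
  have hg2' := IsMetricOn.mono' hg2 hSU
  have hc' : AlmostCompatibleOn g1 g2 S := fun l1 l2 u hu => hc l1 l2 u (hSU hu)
  obtain ⟨T, hpT, hTS, hTs, hTi, hTd⟩ := coords hS hg1' hg2' hf hΘ hfi hΘu hfr hc' p hpS
  have hfne : ∀ u ∈ S, ∀ i, f i u ≠ 0 := by
    intro u hu i h0
    have h1 : IsUnit (Θ u * g1 u).det := by
      rw [Matrix.det_mul]; exact (hΘu u hu).mul (hg1'.2.2 u hu)
    rw [hfr u hu, Matrix.mul_assoc, Matrix.det_mul, Matrix.det_diagonal] at h1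
    exact (isUnit_of_mul_isUnit_left h1).ne_zero (Finset.prod_eq_zero (Finset.mem_univ i) h0)
  set q := T p with hq
  obtain ⟨ε, hε, hball⟩ := Metric.isOpen_iff.1 T.open_target q (T.map_source hpT)
  set F : Fin N → (Fin N → ℝ) → ℝ := fun i x => f i (T.symm x) with hF
  have hFs : ∀ i, ContDiffOn ℝ ∞ (F i) (Metric.ball q ε) := fun i =>
    (hf i).comp (hTi.mono hball) fun x hx => hTS (T.map_target (hball hx))
  have hFd : ∀ i, ∀ x ∈ Metric.ball q ε, ∀ y : Fin N → ℝ, y i = 0 → fderiv ℝ (F i) x y = 0 := by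
    intro i x hx y hy
    set u := T.symm x with hu
    have huT : u ∈ T.source := T.map_target (hball hx)
    have d1 : HasFDerivAt T.symm (fderiv ℝ T.symm x) x :=
      ((hTi.contDiffAt (T.open_target.mem_nhds (hball hx))).differentiableAt (by simp)).hasFDerivAt
    have d2 : DifferentiableAt ℝ (f i) u :=
      ((hf i).contDiffAt (hS.mem_nhds (hTS huT))).differentiableAt (by simp)
    have d3 : DifferentiableAt ℝ T u :=
      (hTs.contDiffAt (T.open_source.mem_nhds huT)).differentiableAt (by simp)
    have d4 : HasFDerivAt (fun w => T w i) (fderiv ℝ (fun w => T w i) u) u :=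
      ((differentiableAt_pi.1 d3) i).hasFDerivAt
    have e1 : fderiv ℝ (F i) x = (fderiv ℝ (f i) u).comp (fderiv ℝ T.symm x) :=
      (d2.hasFDerivAt.comp x d1).fderiv
    have e2 : fderiv ℝ (fun w => T w i) u (fderiv ℝ T.symm x y) = y i := by
      have h1 : HasFDerivAt (fun z => T (T.symm z) i)
          ((fderiv ℝ (fun w => T w i) u).comp (fderiv ℝ T.symm x)) x := d4.comp x d1
      have h2 : HasFDerivAt (fun z : Fin N → ℝ => z i)
          (ContinuousLinearMap.proj i : (Fin N → ℝ) →L[ℝ] ℝ) x :=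
        (ContinuousLinearMap.proj i : (Fin N → ℝ) →L[ℝ] ℝ).hasFDerivAt
      have h3 : (fun z => T (T.symm z) i) =ᶠ[𝓝 x] fun z => z i := by
        filter_upwards [T.open_target.mem_nhds (hball hx)] with z hz
        rw [T.right_inv hz]
      have h4 := (h2.congr_of_eventuallyEq h3).unique h1
      have := congrArg (fun L : (Fin N → ℝ) →L[ℝ] ℝ => L y) h4
      simpa using this.symm
    rw [e1, ContinuousLinearMap.comp_apply]
    set a := fderiv ℝ T.symm x y with ha
    obtain ⟨h, h0, hh⟩ := hTd u huT i
    rw [fderiv_eq_pd, hy] at e2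
    have e3 : (Θ u *ᵥ a) i = 0 := by
      have : h * (Θ u *ᵥ a) i = 0 := by
        rw [← e2, Matrix.mulVec, dotProduct, Finset.mul_sum]
        exact Finset.sum_congr rfl fun c _ => by rw [hh]; ring
      exact (mul_eq_zero.1 this).resolve_left h0
    rw [fderiv_eq_pd]
    exact (frame_consequences hS hg1' hg2' hf hΘ hfi hΘu hfr hc' (hTS huT) i).2 a e3
  choose χ hχs hχb hχe using fun i => cutoff (q i) ε hε
  have hup : ∀ i t, |t - q i| < ε → Function.update q i t ∈ Metric.ball q ε := by
    intro i t ht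
    rw [Metric.mem_ball, dist_pi_lt_iff hε]
    intro j
    by_cases hj : j = i
    · subst hj; simpa [Real.dist_eq] using ht
    · simpa [hj] using hε
  have hVsub : Metric.ball q (ε / 3) ⊆ Metric.ball q ε := Metric.ball_subset_ball (by linarith)
  have hVT : Metric.ball q (ε / 3) ⊆ T.target := hVsub.trans hball
  have hfh : ∀ x ∈ Metric.ball q (ε / 3), ∀ i,
      F i (Function.update q i (χ i (x i))) = f i (T.symm x) := by
    intro x hx i
    have h1 : |x i - q i| < ε / 3 := by
      rw [← Real.dist_eq]; exact (dist_le_pi_dist x q i).trans_lt hx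
    refine const_along (hFs i) (hFd i) (hup i _ (hχb i _)) (hVsub hx) ?_
    rw [hχe i _ h1]; simp
  have hsT : SM (fun u => Matrix.of fun i k => pd (fun w => T w i) k u) T.source := by
    intro i k
    exact pd_smooth T.open_source ((contDiffOn_pi.1 hTs) i) k
  refine ⟨T.source ∩ T ⁻¹' Metric.ball q (ε / 3), Metric.ball q (ε / 3), T, T.symm,
    fun i x => ∑ k, ∑ l, pd (fun w => T w i) k (T.symm x) * pd (fun w => T w i) l (T.symm x) *
      g2 (T.symm x) k l, fun i t => F i (Function.update q i (χ i t)),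
    T.isOpen_inter_preimage Metric.isOpen_ball, ⟨hpT, Metric.mem_ball_self (by positivity)⟩,
    fun u hu => hSU (hTS hu.1), Metric.isOpen_ball, ?_, hTs.mono Set.inter_subset_left,
    hTi.mono hVT, fun u hu => T.left_inv hu.1, fun x hx => T.right_inv (hVT hx), ?_, ?_, ?_, ?_,
    ?_, ?_⟩
  · apply Set.Subset.antisymm
    · rintro _ ⟨u, hu, rfl⟩; exact hu.2
    · intro x hx
      exact ⟨T.symm x, ⟨T.map_target (hVT hx), by rw [Set.mem_preimage, T.right_inv (hVT hx)]; exact hx⟩,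
        T.right_inv (hVT hx)⟩
  · intro i
    have hmap : Set.MapsTo T.symm (Metric.ball q (ε / 3)) T.source := fun x hx =>
      T.map_target (hVT hx)
    refine ContDiffOn.sum fun k _ => ContDiffOn.sum fun l _ => ?_
    exact (((hsT i k).comp (hTi.mono hVT) hmap).mul ((hsT i l).comp (hTi.mono hVT) hmap)).mul
      ((hg2.1 k l).comp (hTi.mono hVT) fun x hx => hSU (hTS (hmap hx)))
  · intro i x hx
    have hxs := T.map_target (hVT hx)
    obtain ⟨h, h0, hh⟩ := hTd _ hxs i
    simp only []
    rw [sum_eq_frame (Θ (T.symm x)) (g2 (T.symm x)) i i _ _ h h hh hh]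
    exact mul_ne_zero (mul_ne_zero h0 h0)
      ((frame_diag hg1' hg2' hfi hΘu hfr (hTS hxs)).2.1 i)
  · intro i
    rw [← contDiffOn_univ]
    refine (hFs i).comp (t := Metric.ball q ε) ?_ fun t _ => hup i _ (hχb i t)
    rw [contDiffOn_univ]
    exact (contDiff_update ∞ q i).comp (hχs i)
  · intro i t
    exact hfne _ (hTS (T.map_target (hball (hup i _ (hχb i t))))) i
  · intro u hu i j
    simp only [T.left_inv hu.1]
    obtain ⟨h, h0, hh⟩ := hTd u hu.1 i
    obtain ⟨h', h0', hh'⟩ := hTd u hu.1 j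
    by_cases hij : i = j
    · subst hij; rw [if_pos rfl]
    · rw [if_neg hij, sum_eq_frame (Θ u) (g2 u) i j _ _ h h' hh hh',
        (frame_diag hg1' hg2' hfi hΘu hfr (hTS hu.1)).1 i j hij, mul_zero]
  · intro u hu i j
    have e1 := hfh (T u) hu.2 i
    simp only [T.left_inv hu.1] at e1 ⊢
    rw [e1]
    obtain ⟨h, h0, hh⟩ := hTd u hu.1 i
    obtain ⟨h', h0', hh'⟩ := hTd u hu.1 j
    have hfd := frame_diag hg1' hg2' hfi hΘu hfr (hTS hu.1)
    rw [sum_eq_frame (Θ u) (g1 u) i j _ _ h h' hh hh', hfd.2.2, Matrix.diagonal_mul]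
    by_cases hij : i = j
    · subst hij; rw [if_pos rfl, sum_eq_frame (Θ u) (g2 u) i i _ _ h h hh hh]
      have hk : h' * (Θ u * g2 u * (Θ u)ᵀ) i i = h * (Θ u * g2 u * (Θ u)ᵀ) i i := by
        rw [Matrix.mul_apply]
        simp only [Matrix.transpose_apply, Finset.mul_sum]
        refine Finset.sum_congr rfl fun k _ => ?_
        linear_combination (Θ u * g2 u) i k * ((hh k) - (hh' k))
      linear_combination h * f i u * hk
    · rw [if_neg hij, hfd.1 i j hij]; ring
end RI
end

section
open scoped ContDiff Topology
open Matrix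
namespace RI
variable {N : ℕ}

/-- raised Christoffel symbols of a diagonal metric -/
noncomputable def bh (e : Fin N → ℝ) (De l : Fin N → Fin N → ℝ) (k : Fin N) :
    Matrix (Fin N) (Fin N) ℝ :=
  Matrix.of fun s i => (if s = i then -(1 / 2) * De s k else 0) + (if i = k then e s * l i s else 0)
    - (if s = k then e i * l s i else 0)

/-- Christoffel symbols of a diagonal metric -/
noncomputable def Gh (e : Fin N → ℝ) (De l : Fin N → Fin N → ℝ) (k : Fin N) :
    Matrix (Fin N) (Fin N) ℝ :=
  Matrix.of fun i s => bh e De l k s i / e s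

lemma Gh_symm {e : Fin N → ℝ} {De l : Fin N → Fin N → ℝ} (he : ∀ i, e i ≠ 0)
    (hH : ∀ i k, i ≠ k → De i k = -2 * e i * l i k) (i s k : Fin N) :
    Gh e De l k i s = Gh e De l s i k := by
  by_cases hsk : s = k
  · rw [hsk]
  have h1 := he s
  have h2 := he k
  have h3 := hH s k hsk
  have h4 := hH k s (Ne.symm hsk)
  simp only [Gh, bh, Matrix.of_apply, if_neg hsk, if_neg (Ne.symm hsk), h3, h4]
  by_cases hsi : s = i
  · subst hsi
    simp only [if_true, if_neg hsk, if_neg (Ne.symm hsk)]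
    field_simp
    ring
  · by_cases hki : k = i
    · subst hki
      simp only [if_true, if_neg hsk, if_neg (Ne.symm hsk)]
      field_simp
      ring
    · simp only [if_neg hsi, if_neg hki, if_neg (Ne.symm hsi), if_neg (Ne.symm hki)]
      simp

lemma Gh_diag {e : Fin N → ℝ} {De l : Fin N → Fin N → ℝ} (he : ∀ i, e i ≠ 0) (k : Fin N) :
    Gh e De l k * Matrix.diagonal e = (bh e De l k)ᵀ := by
  ext i s
  rw [Matrix.mul_diagonal, Matrix.transpose_apply]
  simp only [Gh, Matrix.of_apply]
  rw [div_mul_cancel₀ _ (he s)]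

lemma bh_symm (e : Fin N → ℝ) (De l : Fin N → Fin N → ℝ) (k : Fin N) :
    bh e De l k + (bh e De l k)ᵀ = -Matrix.diagonal (fun i => De i k) := by
  ext s i
  simp only [bh, Matrix.add_apply, Matrix.transpose_apply, Matrix.of_apply, Matrix.neg_apply,
    Matrix.diagonal_apply]
  by_cases h : s = i
  · subst h; simp; ring
  · simp [h, Ne.symm h]

lemma bh_mul {e : Fin N → ℝ} {De l : Fin N → Fin N → ℝ} (he : ∀ i, e i ≠ 0)
    (hH : ∀ i k, i ≠ k → De i k = -2 * e i * l i k) {k m : Fin N} (hkm : k ≠ m) (i j : Fin N) :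
    (Gh e De l k * bh e De l m) i j = ∑ s, if s = k
      then bh e De l k s i * ((if s = j then l s m else 0) + if j = m then l j s else 0)
      else ((if s = i then l s k else 0) + if i = k then l i s else 0) * bh e De l m s j := by
  have hb : ∀ s k i, s ≠ k → bh e De l k s i =
      e s * ((if s = i then l s k else 0) + if i = k then l i s else 0) := by
    intro s k i hsk
    simp only [bh, Matrix.of_apply, if_neg hsk, hH s k hsk]
    split_ifs <;> ring
  rw [Matrix.mul_apply]
  refine Finset.sum_congr rfl fun s _ => ?_
  have h1 := he s
  by_cases hs : s = k
  · rw [if_pos hs]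
    simp only [Gh, Matrix.of_apply]
    rw [hb s m j (by rw [hs]; exact hkm)]
    field_simp
  · rw [if_neg hs]
    simp only [Gh, Matrix.of_apply]
    rw [hb s k i hs]
    field_simp

lemma bh_lin (e1 e2 : Fin N → ℝ) (De1 De2 l : Fin N → Fin N → ℝ) (a b : ℝ) (k : Fin N) :
    bh (fun i => a * e1 i + b * e2 i) (fun i k => a * De1 i k + b * De2 i k) l k =
      a • bh e1 De1 l k + b • bh e2 De2 l k := by
  ext s i
  simp only [bh, Matrix.of_apply, Matrix.add_apply, Matrix.smul_apply, smul_eq_mul]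
  split_ifs <;> ring

lemma quad_lin {e1 e2 : Fin N → ℝ} {De1 De2 l : Fin N → Fin N → ℝ} {a b : ℝ}
    (he1 : ∀ i, e1 i ≠ 0) (he2 : ∀ i, e2 i ≠ 0) (he : ∀ i, a * e1 i + b * e2 i ≠ 0)
    (hH1 : ∀ i k, i ≠ k → De1 i k = -2 * e1 i * l i k)
    (hH2 : ∀ i k, i ≠ k → De2 i k = -2 * e2 i * l i k) {k m : Fin N} (hkm : k ≠ m) :
    Gh (fun i => a * e1 i + b * e2 i) (fun i k => a * De1 i k + b * De2 i k) l k *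
      bh (fun i => a * e1 i + b * e2 i) (fun i k => a * De1 i k + b * De2 i k) l m =
    a • (Gh e1 De1 l k * bh e1 De1 l m) + b • (Gh e2 De2 l k * bh e2 De2 l m) := by
  ext i j
  rw [Matrix.add_apply, Matrix.smul_apply, Matrix.smul_apply, bh_mul he1 hH1 hkm,
    bh_mul he2 hH2 hkm, bh_mul he (fun i k hik => by
      simp only [hH1 i k hik, hH2 i k hik]; ring) hkm, bh_lin, bh_lin, smul_eq_mul, smul_eq_mul,
    Finset.mul_sum, Finset.mul_sum, ← Finset.sum_add_distrib]
  refine Finset.sum_congr rfl fun s _ => ?_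
  simp only [Matrix.add_apply, Matrix.smul_apply, smul_eq_mul]
  by_cases hs : s = k
  · simp only [if_pos hs]; ring
  · simp only [if_neg hs]; ring

lemma cancel_frame {J X Y : Matrix (Fin N) (Fin N) ℝ} (hJ : IsUnit J.det)
    (h : J * X * Jᵀ = J * Y * Jᵀ) : X = Y := by
  have h1 : J⁻¹ * J = 1 := Matrix.nonsing_inv_mul _ hJ
  have h2 : Jᵀ * (J⁻¹)ᵀ = 1 := by rw [← Matrix.transpose_mul, h1, Matrix.transpose_one]
  have h3 : ∀ Z, J⁻¹ * (J * Z * Jᵀ) * (J⁻¹)ᵀ = Z := by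
    intro Z
    rw [Matrix.mul_assoc, Matrix.mul_assoc _ Jᵀ, h2, mul_one, ← Matrix.mul_assoc, h1, one_mul]
  rw [← h3 X, h, h3 Y]

lemma gam_formula {g J : MetF N} {S : Set (Fin N → ℝ)} (hS : IsOpen S) (hg : IsMetricOn g S)
    {e : Fin N → (Fin N → ℝ) → ℝ} (hJ : SM J S)
    (hJu : ∀ u ∈ S, IsUnit (J u).det)
    (hJs : ∀ u ∈ S, ∀ c j b, dm J c u j b = dm J b u j c)
    (hD : ∀ w ∈ S, J w * g w * (J w)ᵀ = Matrix.diagonal (fun i => e i w))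
    {u : Fin N → ℝ} (hu : u ∈ S) (he : ∀ i, e i u ≠ 0) (De l : Fin N → Fin N → ℝ)
    (hDe : ∀ i k, De i k = ∑ c, (J u)⁻¹ c k * pd (e i) c u)
    (hH : ∀ i k, i ≠ k → De i k = -2 * e i u * l i k) (c : Fin N) :
    Gam g c u = (J u)⁻¹ * (∑ k, J u k c • Gh (fun i => e i u) De l k) * J u
      + (J u)⁻¹ * dm J c u := by
  have hEJ : (J u)⁻¹ * J u = 1 := Matrix.nonsing_inv_mul _ (hJu u hu)
  have hJE : J u * (J u)⁻¹ = 1 := Matrix.mul_nonsing_inv _ (hJu u hu)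
  set E := (J u)⁻¹ with hE
  set e0 : Fin N → ℝ := fun i => e i u with he0
  set A : Fin N → Matrix (Fin N) (Fin N) ℝ := fun c => ∑ k, J u k c • Gh e0 De l k with hA
  refine Gam_unique hS hg hu (fun c => E * A c * J u + E * dm J c u) ?_ ?_ c
  · intro c i j
    simp only [Matrix.add_apply]
    congr 1
    · rw [Matrix.mul_assoc, Matrix.mul_assoc, Matrix.mul_apply, Matrix.mul_apply]
      refine Finset.sum_congr rfl fun p _ => ?_
      congr 1
      simp only [hA, Matrix.mul_apply, Matrix.sum_apply, Matrix.smul_apply, smul_eq_mul,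
        Finset.sum_mul]
      rw [Finset.sum_comm]
      refine Finset.sum_congr rfl fun s _ => Finset.sum_congr rfl fun k _ => ?_
      rw [Gh_symm he hH p k s]; ring
    · rw [Matrix.mul_apply, Matrix.mul_apply]
      exact Finset.sum_congr rfl fun p _ => by rw [hJs u hu c p j]
  · intro c
    have hgs : (g u)ᵀ = g u := hg.2.1 u hu
    have hJd := hJ.dM hS hu
    have hgd : DM g u := SM.dM hg.1 hS hu
    have h1 : dm (fun w => J w * g w * (J w)ᵀ) c u = Matrix.diagonal (fun i => pd (e i) c u) := by
      rw [dm_congr (B := fun w => Matrix.diagonal (fun i => e i w))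
        (by filter_upwards [hS.mem_nhds hu] with w hw using hD w hw)]
      ext i j
      by_cases hij : i = j
      · subst hij; simp [dm]
      · simp [dm, hij, pd_const]
    rw [dm_mul (hJd.mul hgd) hJd.transpose, dm_mul hJd hgd, dm_transpose] at h1
    have h2 : Matrix.diagonal (fun i => pd (e i) c u) =
        -(A c * Matrix.diagonal e0 + Matrix.diagonal e0 * (A c)ᵀ) := by
      have h3 : A c * Matrix.diagonal e0 = ∑ k, J u k c • (bh e0 De l k)ᵀ := by
        have he' : ∀ i, e0 i ≠ 0 := he
        simp only [hA, Finset.sum_mul, Matrix.smul_mul, Gh_diag he']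
      have h4 : Matrix.diagonal e0 * (A c)ᵀ = ∑ k, J u k c • (bh e0 De l k) := by
        have := congrArg Matrix.transpose h3
        rw [Matrix.transpose_mul, Matrix.diagonal_transpose] at this
        rw [this]
        simp [Matrix.transpose_sum]
      rw [h3, h4, ← Finset.sum_add_distrib]
      simp only [← smul_add]
      have h5 : ∀ k, (bh e0 De l k)ᵀ + bh e0 De l k = -Matrix.diagonal (fun i => De i k) := by
        intro k; rw [add_comm, bh_symm]
      simp only [h5, smul_neg, Finset.sum_neg_distrib, neg_neg]
      ext i j
      rw [Matrix.sum_apply]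
      by_cases hij : i = j
      · subst hij
        simp only [Matrix.smul_apply, Matrix.diagonal_apply_eq, smul_eq_mul, hDe, Finset.mul_sum]
        rw [Finset.sum_comm]
        have h6 : ∀ c', ∑ k, J u k c * (E c' k * pd (e i) c' u) =
            (1 : Matrix (Fin N) (Fin N) ℝ) c' c * pd (e i) c' u := by
          intro c'
          rw [← hEJ, Matrix.mul_apply, Finset.sum_mul]
          exact Finset.sum_congr rfl fun k _ => by ring
        simp [h6, Matrix.one_apply]
      · simp [hij]
    apply cancel_frame (hJu u hu)
    have hJΓ : J u * (E * A c * J u + E * dm J c u) = A c * J u + dm J c u := by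
      rw [mul_add, ← Matrix.mul_assoc, ← Matrix.mul_assoc, ← Matrix.mul_assoc, hJE, one_mul,
        one_mul]
    have h7 : J u * ((E * A c * J u + E * dm J c u) * g u) * (J u)ᵀ =
        A c * Matrix.diagonal e0 + dm J c u * g u * (J u)ᵀ := by
      rw [← Matrix.mul_assoc, hJΓ, he0, ← hD u hu]
      simp only [add_mul, Matrix.mul_assoc]
    have h8 : J u * (g u * (E * A c * J u + E * dm J c u)ᵀ) * (J u)ᵀ =
        Matrix.diagonal e0 * (A c)ᵀ + J u * g u * (dm J c u)ᵀ := by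
      have := congrArg Matrix.transpose h7
      simpa only [Matrix.transpose_mul, Matrix.transpose_add, Matrix.transpose_transpose, hgs,
        Matrix.diagonal_transpose, Matrix.mul_assoc] using this
    rw [mul_neg, neg_mul, mul_add, add_mul, h7, h8]
    rw [h2] at h1
    have h9 : J u * dm g c u * (J u)ᵀ = -(A c * Matrix.diagonal e0 + Matrix.diagonal e0 * (A c)ᵀ)
        - dm J c u * g u * (J u)ᵀ - J u * g u * (dm J c u)ᵀ := by
      rw [← h1, add_mul]; abel
    rw [h9]; abel
end RI
end

section
open scoped ContDiff Topology
open Matrix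
namespace RI
variable {N : ℕ}

lemma absB {J E g D A a K Γ : Matrix (Fin N) (Fin N) ℝ} (hEJ : E * J = 1)
    (hD : J * g * Jᵀ = D) (hgs : gᵀ = g) (hDs : Dᵀ = D) (hA : A * D = aᵀ)
    (hΓ : Γ = E * A * J + E * K) : g * Γᵀ = E * a * Eᵀ + g * Kᵀ * Eᵀ := by
  have h1 : g * Jᵀ = E * D := by
    rw [← hD, ← Matrix.mul_assoc, ← Matrix.mul_assoc, hEJ, one_mul]
  have h2 : D * Aᵀ = a := by
    have := congrArg Matrix.transpose hA
    rwa [Matrix.transpose_mul, hDs, Matrix.transpose_transpose] at this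
  rw [hΓ, Matrix.transpose_add, Matrix.transpose_mul, Matrix.transpose_mul, Matrix.transpose_mul,
    mul_add, ← Matrix.mul_assoc g, h1, ← h2]
  simp only [Matrix.mul_assoc]

lemma absQ {J E g D A a K Γ A' a' K' Γ' : Matrix (Fin N) (Fin N) ℝ} (hEJ : E * J = 1)
    (hJE : J * E = 1)
    (hD : J * g * Jᵀ = D) (hgs : gᵀ = g) (hDs : Dᵀ = D) (hA : A * D = aᵀ) (hA' : A' * D = a'ᵀ)
    (hΓ : Γ = E * A * J + E * K) (hΓ' : Γ' = E * A' * J + E * K') :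
    Γ * g * Γ'ᵀ = E * (A * a') * Eᵀ + (E * aᵀ * Eᵀ * K'ᵀ * Eᵀ + E * K * E * a' * Eᵀ
      + E * K * g * K'ᵀ * Eᵀ) := by
  have h1 : J * g = D * Eᵀ := by
    rw [← hD, Matrix.mul_assoc _ Jᵀ, ← Matrix.transpose_mul, hEJ, Matrix.transpose_one, mul_one]
  rw [Matrix.mul_assoc, absB hEJ hD hgs hDs hA' hΓ', hΓ]
  have h2 : E * A * J * (E * a' * Eᵀ) = E * (A * a') * Eᵀ := by
    calc E * A * J * (E * a' * Eᵀ) = E * A * (J * E) * a' * Eᵀ := by simp only [Matrix.mul_assoc]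
      _ = _ := by rw [hJE, mul_one]; simp only [Matrix.mul_assoc]
  have h3 : E * A * J * (g * K'ᵀ * Eᵀ) = E * aᵀ * Eᵀ * K'ᵀ * Eᵀ := by
    calc E * A * J * (g * K'ᵀ * Eᵀ) = E * A * (J * g) * K'ᵀ * Eᵀ := by simp only [Matrix.mul_assoc]
      _ = _ := by rw [h1, ← hA]; simp only [Matrix.mul_assoc]
  rw [add_mul, mul_add, mul_add, h2, h3]
  simp only [Matrix.mul_assoc]
  abel

lemma A_diag {e : Fin N → ℝ} {De l : Fin N → Fin N → ℝ} (he : ∀ i, e i ≠ 0)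
    (x : Fin N → ℝ) :
    (∑ k, x k • Gh e De l k) * Matrix.diagonal e = (∑ k, x k • bh e De l k)ᵀ := by
  simp only [Finset.sum_mul, Matrix.smul_mul, Gh_diag he, Matrix.transpose_sum,
    Matrix.transpose_smul]

lemma A_quad (e : Fin N → ℝ) (De l : Fin N → Fin N → ℝ) (x y : Fin N → ℝ) :
    (∑ k, x k • Gh e De l k) * (∑ k, y k • bh e De l k) -
      (∑ k, y k • Gh e De l k) * (∑ k, x k • bh e De l k) =
    ∑ k, ∑ m, (x k * y m - y k * x m) • (Gh e De l k * bh e De l m) := by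
  simp only [Finset.sum_mul_sum, ← Finset.sum_sub_distrib, Matrix.smul_mul, Matrix.mul_smul,
    smul_smul, ← sub_smul]
  refine Finset.sum_congr rfl fun k _ => Finset.sum_congr rfl fun m _ => ?_
  congr 1; ring

lemma lin_abs {J E g1 g2 : Matrix (Fin N) (Fin N) ℝ} {K Γ1 Γ2 Γ : Fin N → Matrix (Fin N) (Fin N) ℝ}
    {e1 e2 : Fin N → ℝ} {De1 De2 l : Fin N → Fin N → ℝ} {a b : ℝ}
    (hEJ : E * J = 1) (hJE : J * E = 1)
    (hs1 : g1ᵀ = g1) (hs2 : g2ᵀ = g2)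
    (hD1 : J * g1 * Jᵀ = Matrix.diagonal e1) (hD2 : J * g2 * Jᵀ = Matrix.diagonal e2)
    (he1 : ∀ i, e1 i ≠ 0) (he2 : ∀ i, e2 i ≠ 0) (he : ∀ i, a * e1 i + b * e2 i ≠ 0)
    (hH1 : ∀ i k, i ≠ k → De1 i k = -2 * e1 i * l i k)
    (hH2 : ∀ i k, i ≠ k → De2 i k = -2 * e2 i * l i k)
    (hΓ1 : ∀ c, Γ1 c = E * (∑ k, J k c • Gh e1 De1 l k) * J + E * K c)
    (hΓ2 : ∀ c, Γ2 c = E * (∑ k, J k c • Gh e2 De2 l k) * J + E * K c)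
    (hΓ : ∀ c, Γ c = E * (∑ k, J k c • Gh (fun i => a * e1 i + b * e2 i)
      (fun i k => a * De1 i k + b * De2 i k) l k) * J + E * K c) :
    (∀ c, (a • g1 + b • g2) * (Γ c)ᵀ = a • (g1 * (Γ1 c)ᵀ) + b • (g2 * (Γ2 c)ᵀ)) ∧
    (∀ c d, Γ c * (a • g1 + b • g2) * (Γ d)ᵀ - Γ d * (a • g1 + b • g2) * (Γ c)ᵀ =
      a • (Γ1 c * g1 * (Γ1 d)ᵀ - Γ1 d * g1 * (Γ1 c)ᵀ) +
      b • (Γ2 c * g2 * (Γ2 d)ᵀ - Γ2 d * g2 * (Γ2 c)ᵀ)) := by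
  have hsh : (a • g1 + b • g2)ᵀ = a • g1 + b • g2 := by simp [hs1, hs2]
  have hDh : J * (a • g1 + b • g2) * Jᵀ = Matrix.diagonal (fun i => a * e1 i + b * e2 i) := by
    rw [mul_add, add_mul, Matrix.mul_smul, Matrix.mul_smul, Matrix.smul_mul, Matrix.smul_mul, hD1,
      hD2]
    ext i j
    by_cases hij : i = j
    · subst hij; simp
    · simp [hij]
  set e : Fin N → ℝ := fun i => a * e1 i + b * e2 i with hedef
  set De : Fin N → Fin N → ℝ := fun i k => a * De1 i k + b * De2 i k with hDedef
  have hlin : ∀ x : Fin N → ℝ, ∑ k, x k • bh e De l k = a • (∑ k, x k • bh e1 De1 l k) +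
      b • (∑ k, x k • bh e2 De2 l k) := by
    intro x
    simp only [hedef, hDedef, bh_lin, Finset.smul_sum, ← Finset.sum_add_distrib]
    refine Finset.sum_congr rfl fun k _ => ?_
    module
  constructor
  · intro c
    rw [absB hEJ hDh hsh (Matrix.diagonal_transpose _) (A_diag he _) (hΓ c),
      absB hEJ hD1 hs1 (Matrix.diagonal_transpose _) (A_diag he1 _) (hΓ1 c),
      absB hEJ hD2 hs2 (Matrix.diagonal_transpose _) (A_diag he2 _) (hΓ2 c), hlin]
    simp only [mul_add, add_mul, Matrix.mul_smul, Matrix.smul_mul, smul_add]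
    abel
  · intro c d
    have hq := A_quad e De l (fun k => J k c) (fun k => J k d)
    have hq1 := A_quad e1 De1 l (fun k => J k c) (fun k => J k d)
    have hq2 := A_quad e2 De2 l (fun k => J k c) (fun k => J k d)
    have hqq : (∑ k, ∑ m, (J k c * J m d - J k d * J m c) • (Gh e De l k * bh e De l m)) =
        a • (∑ k, ∑ m, (J k c * J m d - J k d * J m c) • (Gh e1 De1 l k * bh e1 De1 l m)) +
        b • (∑ k, ∑ m, (J k c * J m d - J k d * J m c) • (Gh e2 De2 l k * bh e2 De2 l m)) := by
      simp only [Finset.smul_sum, ← Finset.sum_add_distrib]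
      refine Finset.sum_congr rfl fun k _ => Finset.sum_congr rfl fun m _ => ?_
      by_cases hkm : k = m
      · subst hkm
        have : J k c * J k d - J k d * J k c = 0 := by ring
        simp [this]
      · rw [quad_lin he1 he2 he hH1 hH2 hkm]
        module
    have Q := fun c d => absQ hEJ hJE hDh hsh (Matrix.diagonal_transpose _)
      (A_diag he fun k => J k c) (A_diag he fun k => J k d) (hΓ c) (hΓ d)
    have Q1 := fun c d => absQ hEJ hJE hD1 hs1 (Matrix.diagonal_transpose _)
      (A_diag he1 fun k => J k c) (A_diag he1 fun k => J k d) (hΓ1 c) (hΓ1 d)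
    have Q2 := fun c d => absQ hEJ hJE hD2 hs2 (Matrix.diagonal_transpose _)
      (A_diag he2 fun k => J k c) (A_diag he2 fun k => J k d) (hΓ2 c) (hΓ2 d)
    have hsplit : ∀ X Y Z W : Matrix (Fin N) (Fin N) ℝ, (E * X * Eᵀ + Z) - (E * Y * Eᵀ + W) =
        E * (X - Y) * Eᵀ + (Z - W) := by
      intro X Y Z W
      rw [mul_sub, sub_mul]; abel
    rw [Q c d, Q d c, Q1 c d, Q1 d c, Q2 c d, Q2 d c, hsplit, hsplit, hsplit, hq, hq1, hq2, hqq,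
      hlin, hlin]
    simp only [mul_add, add_mul, Matrix.mul_smul, Matrix.smul_mul, smul_add, smul_sub,
      Matrix.transpose_add, Matrix.transpose_smul]
    abel
end RI
end

section
open scoped ContDiff Topology
open Matrix
namespace RI
variable {N : ℕ}

lemma pd_comm {f : (Fin N → ℝ) → ℝ} {S : Set (Fin N → ℝ)} (hS : IsOpen S)
    (hf : ContDiffOn ℝ ∞ f S) {u : Fin N → ℝ} (hu : u ∈ S) (b c : Fin N) :
    pd (fun w => pd f b w) c u = pd (fun w => pd f c w) b u := by
  have hfa : ContDiffAt ℝ ∞ f u := hf.contDiffAt (hS.mem_nhds hu)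
  have hsym : IsSymmSndFDerivAt ℝ f u := hfa.isSymmSndFDerivAt (by
    rw [minSmoothness_of_isRCLikeNormedField]
    exact WithTop.coe_le_coe.2 (le_top : (2 : ℕ∞) ≤ ⊤))
  have hd : DifferentiableAt ℝ (fderiv ℝ f) u :=
    (hfa.fderiv_right (m := ∞) (by simp)).differentiableAt
      (by simp)
  have key : ∀ b c : Fin N, pd (fun w => pd f b w) c u =
      fderiv ℝ (fderiv ℝ f) u (Pi.single c 1) (Pi.single b 1) := by
    intro b c
    unfold pd
    rw [fderiv_clm_apply hd (differentiableAt_const _)]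
    simp
  rw [key, key]
  exact hsym.eq _ _

lemma backward_aux {g1 g2 J : MetF N} {S : Set (Fin N → ℝ)} (hS : IsOpen S)
    (hg1 : IsMetricOn g1 S) (hg2 : IsMetricOn g2 S) (l1 l2 : ℝ)
    (hh : IsMetricOn (fun v => l1 • g1 v + l2 • g2 v) S)
    (hJ : SM J S) (hJs : ∀ u ∈ S, ∀ c j b, dm J c u j b = dm J b u j c)
    {γ F : Fin N → (Fin N → ℝ) → ℝ}
    (hγ : ∀ i, ContDiffOn ℝ ∞ (γ i) S) (hF : ∀ i, ContDiffOn ℝ ∞ (F i) S)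
    (hγ0 : ∀ i, ∀ w ∈ S, γ i w ≠ 0) (hF0 : ∀ i, ∀ w ∈ S, F i w ≠ 0)
    (hFd : ∀ i, ∀ w ∈ S, ∃ t : ℝ, ∀ c, pd (F i) c w = t * J w i c)
    (hD2 : ∀ w ∈ S, J w * g2 w * (J w)ᵀ = Matrix.diagonal (fun i => γ i w))
    (hD1 : ∀ w ∈ S, J w * g1 w * (J w)ᵀ = Matrix.diagonal (fun i => F i w * γ i w))
    {u : Fin N → ℝ} (hu : u ∈ S) :
    (∀ i j k, christoffelR (fun v => l1 • g1 v + l2 • g2 v) i j k u =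
      l1 * christoffelR g1 i j k u + l2 * christoffelR g2 i j k u) ∧
    (∀ i j k l, curvatureR (fun v => l1 • g1 v + l2 • g2 v) i j k l u =
      l1 * curvatureR g1 i j k l u + l2 * curvatureR g2 i j k l u) := by
  set h : MetF N := fun v => l1 • g1 v + l2 • g2 v with hhdef
  have hJu : ∀ w ∈ S, IsUnit (J w).det := by
    intro w hw
    have := congrArg Matrix.det (hD2 w hw)
    rw [Matrix.det_mul, Matrix.det_mul, Matrix.det_diagonal] at this
    have hp : (∏ i, γ i w) ≠ 0 := Finset.prod_ne_zero_iff.2 fun i _ => hγ0 i w hw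
    refine isUnit_iff_ne_zero.2 fun h0 => hp ?_
    rw [← this, h0]; simp
  have hDh : ∀ w ∈ S, J w * h w * (J w)ᵀ =
      Matrix.diagonal (fun i => l1 * (F i w * γ i w) + l2 * γ i w) := by
    intro w hw
    simp only [hhdef]
    rw [mul_add, add_mul, Matrix.mul_smul, Matrix.mul_smul, Matrix.smul_mul, Matrix.smul_mul,
      hD1 w hw, hD2 w hw]
    ext i j
    by_cases hij : i = j
    · subst hij; simp
    · simp [hij]
  have he : ∀ w ∈ S, ∀ i, l1 * (F i w * γ i w) + l2 * γ i w ≠ 0 := by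
    intro w hw
    have := congrArg Matrix.det (hDh w hw)
    rw [Matrix.det_mul, Matrix.det_mul, Matrix.det_diagonal, Matrix.det_transpose] at this
    have hp : (J w).det * (h w).det * (J w).det ≠ 0 :=
      mul_ne_zero (mul_ne_zero (hJu w hw).ne_zero (hh.2.2 w hw).ne_zero) (hJu w hw).ne_zero
    rw [this] at hp
    exact fun i => Finset.prod_ne_zero_iff.1 hp i (Finset.mem_univ i)
  have main : ∀ w ∈ S,
      (∀ c, h w * (Gam h c w)ᵀ = l1 • (g1 w * (Gam g1 c w)ᵀ) + l2 • (g2 w * (Gam g2 c w)ᵀ)) ∧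
      (∀ c d, Gam h c w * h w * (Gam h d w)ᵀ - Gam h d w * h w * (Gam h c w)ᵀ =
      l1 • (Gam g1 c w * g1 w * (Gam g1 d w)ᵀ - Gam g1 d w * g1 w * (Gam g1 c w)ᵀ) +
      l2 • (Gam g2 c w * g2 w * (Gam g2 d w)ᵀ - Gam g2 d w * g2 w * (Gam g2 c w)ᵀ)) := by
    intro w hw
    have hEJ : (J w)⁻¹ * J w = 1 := Matrix.nonsing_inv_mul _ (hJu w hw)
    have hJE : J w * (J w)⁻¹ = 1 := Matrix.mul_nonsing_inv _ (hJu w hw)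
    have dγ : ∀ i, DifferentiableAt ℝ (γ i) w := fun i =>
      ((hγ i).contDiffAt (hS.mem_nhds hw)).differentiableAt (by simp)
    have dF : ∀ i, DifferentiableAt ℝ (F i) w := fun i =>
      ((hF i).contDiffAt (hS.mem_nhds hw)).differentiableAt (by simp)
    let De1 : Fin N → Fin N → ℝ := fun i k =>
      ∑ c, (J w)⁻¹ c k * pd (fun v => F i v * γ i v) c w
    let De2 : Fin N → Fin N → ℝ := fun i k => ∑ c, (J w)⁻¹ c k * pd (γ i) c w
    let l : Fin N → Fin N → ℝ := fun i k => -De2 i k / (2 * γ i w)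
    have hH2 : ∀ i k, i ≠ k → De2 i k = -2 * γ i w * l i k := by
      intro i k _
      have := hγ0 i w hw
      simp only [l]; field_simp
    have hDe1 : ∀ i k, i ≠ k → De1 i k = F i w * De2 i k := by
      intro i k hik
      obtain ⟨t, ht⟩ := hFd i w hw
      have h0 : ∑ c, J w i c * (J w)⁻¹ c k = 0 := by
        have := congrFun (congrFun hJE i) k
        rw [Matrix.mul_apply, Matrix.one_apply_ne hik] at this
        exact this
      simp only [De1, De2, Finset.mul_sum]
      have : ∀ c, (J w)⁻¹ c k * pd (fun v => F i v * γ i v) c w =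
          (t * γ i w) * (J w i c * (J w)⁻¹ c k) + F i w * ((J w)⁻¹ c k * pd (γ i) c w) := by
        intro c
        rw [pd_mul (dF i) (dγ i), ht c]; ring
      rw [Finset.sum_congr rfl fun c _ => this c, Finset.sum_add_distrib, ← Finset.mul_sum, h0]
      simp
    have hH1 : ∀ i k, i ≠ k → De1 i k = -2 * (F i w * γ i w) * l i k := by
      intro i k hik
      rw [hDe1 i k hik, hH2 i k hik]; ring
    have hDeh : ∀ i k, l1 * De1 i k + l2 * De2 i k =
        ∑ c, (J w)⁻¹ c k * pd (fun v => l1 * (F i v * γ i v) + l2 * γ i v) c w := by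
      intro i k
      simp only [De1, De2, Finset.mul_sum, ← Finset.sum_add_distrib]
      refine Finset.sum_congr rfl fun c _ => ?_
      rw [pd_add (((dF i).fun_mul (dγ i)).const_mul l1) ((dγ i).const_mul l2),
        pd_mul (differentiableAt_const l1) ((dF i).fun_mul (dγ i)),
        pd_mul (differentiableAt_const l2) (dγ i), pd_const, pd_const]
      ring
    have G1 := gam_formula hS hg1 (e := fun i v => F i v * γ i v) hJ hJu hJs hD1 hw
      (fun i => mul_ne_zero (hF0 i w hw) (hγ0 i w hw)) De1 l (fun _ _ => rfl) hH1
    have G2 := gam_formula hS hg2 (e := γ) hJ hJu hJs hD2 hw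
      (fun i => hγ0 i w hw) De2 l (fun _ _ => rfl) hH2
    have G := gam_formula hS hh (e := fun i v => l1 * (F i v * γ i v) + l2 * γ i v) hJ hJu hJs hDh
      hw (fun i => he w hw i) (fun i k => l1 * De1 i k + l2 * De2 i k) l hDeh
      (fun i k hik => by
        rw [hH1 i k hik, hH2 i k hik]; ring)
    exact lin_abs hEJ hJE (hg1.2.1 w hw) (hg2.2.1 w hw) (hD1 w hw) (hD2 w hw)
      (fun i => mul_ne_zero (hF0 i w hw) (hγ0 i w hw)) (fun i => hγ0 i w hw) (he w hw)
      hH1 hH2 G1 G2 G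
  constructor
  · intro i j k
    rw [christoffelR_eq, christoffelR_eq, christoffelR_eq, (main u hu).1 k]
    simp
  · intro i j c d
    have dmh : ∀ c d, dm (fun w => h w * (Gam h d w)ᵀ) c u =
        l1 • dm (fun w => g1 w * (Gam g1 d w)ᵀ) c u +
        l2 • dm (fun w => g2 w * (Gam g2 d w)ᵀ) c u := by
      intro c d
      have s1 : DM (fun w => g1 w * (Gam g1 d w)ᵀ) u :=
        (SM.mul hg1.1 (SM_Gam hS hg1 d).transpose).dM hS hu
      have s2 : DM (fun w => g2 w * (Gam g2 d w)ᵀ) u :=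
        (SM.mul hg2.1 (SM_Gam hS hg2 d).transpose).dM hS hu
      rw [dm_congr (B := fun w => l1 • (g1 w * (Gam g1 d w)ᵀ) + l2 • (g2 w * (Gam g2 d w)ᵀ))
        (by filter_upwards [hS.mem_nhds hu] with w hw using (main w hw).1 d),
        dm_add (A := fun w => l1 • (g1 w * (Gam g1 d w)ᵀ)) (B := fun w => l2 • (g2 w * (Gam g2 d w)ᵀ))
          (fun i j => (s1 i j).const_mul l1) (fun i j => (s2 i j).const_mul l2),
        dm_smul l1 s1, dm_smul l2 s2]
    have hq := congrFun (congrFun ((main u hu).2 c d) i) j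
    rw [curvatureR_eq hS hh hu, curvatureR_eq hS hg1 hu, curvatureR_eq hS hg2 hu, dmh, dmh]
    simp only [Matrix.add_apply, Matrix.sub_apply, Matrix.smul_apply, smul_eq_mul] at hq ⊢
    linarith

theorem backward (U0 Vs : Set (Fin N → ℝ)) (φ : (Fin N → ℝ) → (Fin N → ℝ))
    (gh : Fin N → (Fin N → ℝ) → ℝ) (f : Fin N → ℝ → ℝ) (g1 g2 : MetF N)
    (hg1 : IsMetricOn g1 U0) (hg2 : IsMetricOn g2 U0)
    (hU0 : IsOpen U0) (him : φ '' U0 = Vs) (hφ : ContDiffOn ℝ ∞ φ U0)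
    (hgh : ∀ i, ContDiffOn ℝ ∞ (gh i) Vs) (hgh0 : ∀ i, ∀ x ∈ Vs, gh i x ≠ 0)
    (hf : ∀ i, ContDiff ℝ ∞ (f i)) (hf0 : ∀ i, ∀ t : ℝ, f i t ≠ 0)
    (h2 : ∀ u ∈ U0, ∀ i j : Fin N,
          (∑ k, ∑ l, pd (fun w => φ w i) k u * pd (fun w => φ w j) l u * g2 u k l) =
            if i = j then gh i (φ u) else 0)
    (h1 : ∀ u ∈ U0, ∀ i j : Fin N,
          (∑ k, ∑ l, pd (fun w => φ w i) k u * pd (fun w => φ w j) l u * g1 u k l) =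
            if i = j then f i (φ u i) * gh i (φ u) else 0)
    (l1 l2 : ℝ) {u : Fin N → ℝ} (hu : u ∈ U0) (hd : IsUnit (l1 • g1 u + l2 • g2 u).det) :
    (∀ i j k, christoffelR (fun v => l1 • g1 v + l2 • g2 v) i j k u =
      l1 * christoffelR g1 i j k u + l2 * christoffelR g2 i j k u) ∧
    (∀ i j k l, curvatureR (fun v => l1 • g1 v + l2 • g2 v) i j k l u =
      l1 * curvatureR g1 i j k l u + l2 * curvatureR g2 i j k l u) := by
  set h : MetF N := fun v => l1 • g1 v + l2 • g2 v with hhdef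
  have hSM : SM h U0 := (SM.smul contDiffOn_const hg1.1).add (SM.smul contDiffOn_const hg2.1)
  set S : Set (Fin N → ℝ) := U0 ∩ (fun v => (h v).det) ⁻¹' {0}ᶜ with hSdef
  have hS : IsOpen S := (det_smooth hSM).continuousOn.isOpen_inter_preimage hU0
    isOpen_compl_singleton
  have huS : u ∈ S := ⟨hu, hd.ne_zero⟩
  have hSU : S ⊆ U0 := Set.inter_subset_left
  have hhm : IsMetricOn h S := by
    refine ⟨hSM.mono hSU, fun v hv => ?_, fun v hv => ?_⟩
    · exact ((hg1.2.1 v hv.1).smul _).add ((hg2.2.1 v hv.1).smul _)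
    · exact (show (h v).det ≠ 0 from hv.2).isUnit
  have hφi : ∀ i, ContDiffOn ℝ ∞ (fun w => φ w i) S := fun i =>
    (contDiffOn_pi.1 hφ i).mono hSU
  have hmap : Set.MapsTo φ S Vs := fun w hw => him ▸ Set.mem_image_of_mem φ (hSU hw)
  let J : MetF N := fun w => Matrix.of fun i k => pd (fun v => φ v i) k w
  have hfr : ∀ (A : Matrix (Fin N) (Fin N) ℝ) (w : Fin N → ℝ) (d : Fin N → ℝ),
      (∀ i j, (∑ k, ∑ l, pd (fun w => φ w i) k w * pd (fun w => φ w j) l w * A k l) =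
        if i = j then d i else 0) → J w * A * (J w)ᵀ = Matrix.diagonal d := by
    intro A w d hA
    ext i j
    have := sum_eq_frame (J w) A i j (fun k => pd (fun w => φ w i) k w)
      (fun k => pd (fun w => φ w j) k w) 1 1 (fun k => by simp [J]) (fun k => by simp [J])
    rw [Matrix.diagonal_apply, ← hA i j, this]; simp
  refine backward_aux (J := J) (γ := fun i w => gh i (φ w)) (F := fun i w => f i (φ w i)) hS
    (RI.IsMetricOn.mono' hg1 hSU) (RI.IsMetricOn.mono' hg2 hSU) l1 l2 hhm
    (fun i k => pd_smooth hS (hφi i) k) ?_ (fun i => (hgh i).comp (hφ.mono hSU) hmap)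
    (fun i => (hf i).comp_contDiffOn (hφi i)) (fun i w hw => hgh0 i _ (hmap hw))
    (fun i w _ => hf0 i _) ?_ (fun w hw => hfr _ _ _ (h2 w (hSU hw)))
    (fun w hw => hfr _ _ _ (h1 w (hSU hw))) huS
  · intro w hw c j b
    exact pd_comm hS (hφi j) hw b c
  · intro i w hw
    refine ⟨deriv (f i) (φ w i), fun c => ?_⟩
    have hd1 : DifferentiableAt ℝ (fun v => φ v i) w :=
      ((hφi i).contDiffAt (hS.mem_nhds hw)).differentiableAt (by simp)
    have hd2 : HasDerivAt (f i) (deriv (f i) (φ w i)) (φ w i) :=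
      ((hf i).differentiable (by simp)).differentiableAt.hasDerivAt
    have := (hd2.comp_hasFDerivAt w hd1.hasFDerivAt).fderiv
    simp only [pd, J, Matrix.of_apply]
    rw [show (fun w => f i (φ w i)) = f i ∘ (fun v => φ v i) from rfl, this]
    simp
end RI
end

/-- **Theorem 3.** A non-singular pair of metrics is compatible iff around each point there are
local coordinates (Riemann invariants) in which both metrics are diagonal and of the special form
`ĝ2^{ij}(x) = ĝ^i(x) δ^{ij}`, `ĝ1^{ij}(x) = f^i(x^i) ĝ^i(x) δ^{ij}` with nowhere-vanishing `ĝ^i`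
and nowhere-vanishing functions `f^i` of one variable. -/
theorem nonsingular_compatible_iff_riemann_invariants {N : ℕ}
    (U : Set (Fin N → ℝ)) (hU : IsOpen U)
    (g1 g2 : MetF N) (hg1 : IsMetricOn g1 U) (hg2 : IsMetricOn g2 U)
    (hns : NonSingularPairOn g1 g2 U) :
    CompatibleOn g1 g2 U ↔
      ∀ p ∈ U, ∃ U0 Vs : Set (Fin N → ℝ), ∃ φ ψ : (Fin N → ℝ) → (Fin N → ℝ),
        ∃ gh : Fin N → (Fin N → ℝ) → ℝ, ∃ f : Fin N → ℝ → ℝ,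
        IsOpen U0 ∧ p ∈ U0 ∧ U0 ⊆ U ∧ IsOpen Vs ∧ φ '' U0 = Vs ∧
        ContDiffOn ℝ (⊤ : ℕ∞) φ U0 ∧ ContDiffOn ℝ (⊤ : ℕ∞) ψ Vs ∧
        (∀ u ∈ U0, ψ (φ u) = u) ∧ (∀ x ∈ Vs, φ (ψ x) = x) ∧
        (∀ i, ContDiffOn ℝ (⊤ : ℕ∞) (gh i) Vs) ∧ (∀ i, ∀ x ∈ Vs, gh i x ≠ 0) ∧
        (∀ i, ContDiff ℝ (⊤ : ℕ∞) (f i)) ∧ (∀ i, ∀ t : ℝ, f i t ≠ 0) ∧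
        (∀ u ∈ U0, ∀ i j : Fin N,
          (∑ k, ∑ l, pd (fun w => φ w i) k u * pd (fun w => φ w j) l u * g2 u k l) =
            if i = j then gh i (φ u) else 0) ∧
        (∀ u ∈ U0, ∀ i j : Fin N,
          (∑ k, ∑ l, pd (fun w => φ w i) k u * pd (fun w => φ w j) l u * g1 u k l) =
            if i = j then f i (φ u i) * gh i (φ u) else 0) := by
  constructor
  · intro hc p hp
    exact RI.forward U hU g1 g2 hg1 hg2 hns hc.1 p hp
  · intro H
    refine ⟨fun l1 l2 u hu hd => ?_, fun l1 l2 u hu hd => ?_⟩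
    · obtain ⟨U0, Vs, φ, ψ, gh, f, hU0, hp, hsub, -, him, hφ, -, -, -, hgh, hgh0, hf, hf0, h2, h1⟩ :=
        H u hu
      exact (RI.backward U0 Vs φ gh f g1 g2 (RI.IsMetricOn.mono' hg1 hsub)
        (RI.IsMetricOn.mono' hg2 hsub) hU0 him hφ hgh hgh0 hf hf0 h2 h1 l1 l2 hp hd).1
    · obtain ⟨U0, Vs, φ, ψ, gh, f, hU0, hp, hsub, -, him, hφ, -, -, -, hgh, hgh0, hf, hf0, h2, h1⟩ :=
        H u hu
      exact (RI.backward U0 Vs φ gh f g1 g2 (RI.IsMetricOn.mono' hg1 hsub)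
        (RI.IsMetricOn.mono' hg2 hsub) hU0 him hφ hgh hgh0 hf hf0 h2 h1 l1 l2 hp hd).2
end

section
/- Let g be a metric on an open set U ⊆ ℝ^N with Christoffel symbols Γ^i_{jk} and raised curvature tensor R^{ij}_{kl}, let L ≥ 1, let μ^{mn} (1 ≤ m, n ≤ L) be real constants with μ^{mn} = μ^{nm}, and let w_1, ..., w_L be smooth affinors on U satisfying: (i) Σ_s g^{is} (w_n)^j_s = Σ_s g^{js} (w_n)^i_s for all i, j, n; (ii) ∇_k (w_n)^i_j = ∇_j (w_n)^i_k for all i, j, k, n; (iii) the w_n pairwise commute, Σ_s (w_m)^i_s (w_n)^s_j = Σ_s (w_n)^i_s (w_m)^s_j; and (iv) the Gauss equation R^{ij}_{kl} = Σ_{m,n} μ^{mn} ( (w_m)^i_l (w_n)^j_k − (w_m)^j_l (w_n)^i_k ). Let h, f_1, ..., f_L : U → ℝ be smooth functions with Σ_j (w_n)^j_s ∂h/∂u^j = ∂f_n/∂u^s for all s and n. Define V^i_j(u) = Σ_s g^{is}(u) ( ∂²h/∂u^s∂u^j − Σ_p Γ^p_{sj}(u) ∂h/∂u^p ) + Σ_{m,n}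 μ^{mn} (w_m)^i_j(u) f_n(u). Then ∇_j V^i_k = ∇_k V^i_j on U for all i, j, k. -/
open Matrix

/-- Covariant derivative `∇_j V^i_k` of an affinor `V` with respect to the Levi-Civita connection
of the contravariant metric `g`. -/
noncomputable def covDeriv {N : ℕ} (g V : MetF N) (j i k : Fin N) (u : Fin N → ℝ) : ℝ :=
  pd (fun w => V w i k) j u +
    ∑ s, (christoffel g i j s u * V u s k - christoffel g s j k u * V u i s)

section Helpers

variable {N : ℕ} {U : Set (Fin N → ℝ)}

lemma sm_diff (hU : IsOpen U) {f : (Fin N → ℝ) → ℝ} (hf : ContDiffOn ℝ (⊤ : ℕ∞) f U)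
    {u : Fin N → ℝ} (hu : u ∈ U) : DifferentiableAt ℝ f u :=
  (hf.contDiffAt (hU.mem_nhds hu)).differentiableAt (by simp)

lemma sm_pd (hU : IsOpen U) {f : (Fin N → ℝ) → ℝ} (hf : ContDiffOn ℝ (⊤ : ℕ∞) f U)
    (j : Fin N) : ContDiffOn ℝ (⊤ : ℕ∞) (pd f j) U := by
  have h1 : ContDiffOn ℝ (⊤ : ℕ∞) (fderiv ℝ f) U :=
    hf.fderiv_of_isOpen hU (by simp)
  exact h1.clm_apply contDiffOn_const

lemma pd_congr (hU : IsOpen U) {f f' : (Fin N → ℝ) → ℝ} (hf : ∀ u ∈ U, f u = f' u)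
    {u : Fin N → ℝ} (hu : u ∈ U) (j : Fin N) : pd f j u = pd f' j u := by
  unfold pd
  have : f =ᶠ[nhds u] f' := Filter.eventuallyEq_of_mem (hU.mem_nhds hu) hf
  rw [this.fderiv_eq]

lemma pd_add {f f' : (Fin N → ℝ) → ℝ} {u : Fin N → ℝ} (hf : DifferentiableAt ℝ f u)
    (hf' : DifferentiableAt ℝ f' u) (j : Fin N) :
    pd (fun v => f v + f' v) j u = pd f j u + pd f' j u := by
  unfold pd; rw [fderiv_fun_add hf hf']; rfl

lemma pd_sub {f f' : (Fin N → ℝ) → ℝ} {u : Fin N → ℝ} (hf : DifferentiableAt ℝ f u)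
    (hf' : DifferentiableAt ℝ f' u) (j : Fin N) :
    pd (fun v => f v - f' v) j u = pd f j u - pd f' j u := by
  unfold pd; rw [fderiv_fun_sub hf hf']; rfl

lemma pd_mul {f f' : (Fin N → ℝ) → ℝ} {u : Fin N → ℝ} (hf : DifferentiableAt ℝ f u)
    (hf' : DifferentiableAt ℝ f' u) (j : Fin N) :
    pd (fun v => f v * f' v) j u = pd f j u * f' u + f u * pd f' j u := by
  unfold pd; rw [fderiv_fun_mul hf hf']
  simp; ring

lemma pd_const (c : ℝ) (j : Fin N) (u : Fin N → ℝ) : pd (fun _ => c) j u = 0 := by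
  unfold pd; simp

lemma pd_sum {ι : Type*} [Fintype ι] {f : ι → (Fin N → ℝ) → ℝ} {u : Fin N → ℝ}
    (hf : ∀ i, DifferentiableAt ℝ (f i) u) (j : Fin N) :
    pd (fun v => ∑ i, f i v) j u = ∑ i, pd (f i) j u := by
  unfold pd; rw [fderiv_fun_sum (fun i _ => hf i)]; simp

lemma pd_comm (hU : IsOpen U) {f : (Fin N → ℝ) → ℝ} (hf : ContDiffOn ℝ (⊤ : ℕ∞) f U)
    {u : Fin N → ℝ} (hu : u ∈ U) (i j : Fin N) : pd (pd f i) j u = pd (pd f j) i u := by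
  have h1 : ContDiffOn ℝ (⊤ : ℕ∞) (fderiv ℝ f) U :=
    hf.fderiv_of_isOpen hU (by simp)
  have h2 : DifferentiableAt ℝ (fderiv ℝ f) u :=
    (h1.contDiffAt (hU.mem_nhds hu)).differentiableAt (by simp)
  have key : ∀ a b : Fin N, pd (pd f a) b u =
      fderiv ℝ (fderiv ℝ f) u (Pi.single b 1) (Pi.single a 1) := by
    intro a b
    have : pd f a = fun v => fderiv ℝ f v (Pi.single a 1) := rfl
    rw [this]
    unfold pd
    rw [fderiv_clm_apply h2 (differentiableAt_const _)]
    simp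
  rw [key, key]
  have hs : IsSymmSndFDerivAt ℝ f u :=
    (hf.contDiffAt (hU.mem_nhds hu)).isSymmSndFDerivAt (by
      simp only [minSmoothness_of_isRCLikeNormedField]
      exact WithTop.coe_le_coe.2 le_top)
  exact hs _ _

lemma sm_det {A : (Fin N → ℝ) → Matrix (Fin N) (Fin N) ℝ}
    (hA : ∀ i j, ContDiffOn ℝ (⊤ : ℕ∞) (fun u => A u i j) U) :
    ContDiffOn ℝ (⊤ : ℕ∞) (fun u => (A u).det) U := by
  simp only [Matrix.det_apply']
  refine ContDiffOn.sum fun σ _ => ContDiffOn.mul contDiffOn_const ?_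
  exact contDiffOn_prod fun i _ => hA _ _

lemma sm_inv {g : MetF N} (hg : IsMetricOn g U) (i j : Fin N) :
    ContDiffOn ℝ (⊤ : ℕ∞) (fun u => (g u)⁻¹ i j) U := by
  obtain ⟨h1, -, h3⟩ := hg
  have : ∀ u, (g u)⁻¹ i j = (g u).det⁻¹ * ((g u).updateRow j (Pi.single i 1)).det := by
    intro u
    rw [Matrix.inv_def, Matrix.smul_apply, Matrix.adjugate_apply, Ring.inverse_eq_inv', smul_eq_mul]
  simp only [this]
  refine ContDiffOn.mul ((sm_det h1).inv fun u hu => (h3 u hu).ne_zero) (sm_det ?_)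
  intro a b
  by_cases hab : a = j
  · subst hab; simp only [Matrix.updateRow_self]; exact contDiffOn_const
  · simp only [Matrix.updateRow_ne hab]; exact h1 a b

lemma sm_chr (hU : IsOpen U) {g : MetF N} (hg : IsMetricOn g U) (i j k : Fin N) :
    ContDiffOn ℝ (⊤ : ℕ∞) (christoffel g i j k) U := by
  unfold christoffel
  refine contDiffOn_const.mul (ContDiffOn.sum fun s _ => (hg.1 i s).mul ?_)
  exact ((sm_pd hU (sm_inv hg _ _) _).add (sm_pd hU (sm_inv hg _ _) _)).sub
    (sm_pd hU (sm_inv hg _ _) _)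

lemma inv_symm {g : MetF N} (hg : IsMetricOn g U) {u : Fin N → ℝ} (hu : u ∈ U) (i j : Fin N) :
    (g u)⁻¹ i j = (g u)⁻¹ j i := by
  have : ((g u)⁻¹)ᵀ = (g u)⁻¹ := by rw [Matrix.transpose_nonsing_inv, (hg.2.1 u hu)]
  exact (congrFun (congrFun this i) j).symm

lemma chr_symm (hU : IsOpen U) {g : MetF N} (hg : IsMetricOn g U) {u : Fin N → ℝ} (hu : u ∈ U)
    (i j k : Fin N) : christoffel g i j k u = christoffel g i k j u := by
  unfold christoffel
  congr 1
  refine Finset.sum_congr rfl fun s _ => ?_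
  rw [pd_congr hU (fun v hv => inv_symm hg hv s k) hu j,
    pd_congr hU (fun v hv => inv_symm hg hv j s) hu k,
    pd_congr hU (fun v hv => inv_symm hg hv j k) hu s]
  ring

lemma pd_metric (hU : IsOpen U) {g : MetF N} (hg : IsMetricOn g U) {u : Fin N → ℝ} (hu : u ∈ U)
    (i s j : Fin N) : pd (fun v => g v i s) j u =
      - ∑ p, christoffel g i j p u * g u p s - ∑ p, g u i p * christoffel g s j p u := by
  have dg : ∀ a b, DifferentiableAt ℝ (fun v => g v a b) u := fun a b => sm_diff hU (hg.1 a b) hu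
  have dG : ∀ a b, DifferentiableAt ℝ (fun v => (g v)⁻¹ a b) u :=
    fun a b => sm_diff hU (sm_inv hg a b) hu
  have gs : ∀ a b, g u a b = g u b a := fun a b => (congrFun (congrFun (hg.2.1 u hu) a) b).symm
  -- derivative of g * g⁻¹ = 1
  have e1 : ∀ b, ∑ a, (pd (fun v => g v i a) j u * (g u)⁻¹ a b
      + g u i a * pd (fun v => (g v)⁻¹ a b) j u) = 0 := by
    intro b
    have h1 : pd (fun v => ∑ a, g v i a * (g v)⁻¹ a b) j u = 0 := by
      rw [← pd_const ((1 : Matrix (Fin N) (Fin N) ℝ) i b) j u]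
      refine pd_congr hU (fun v hv => ?_) hu j
      rw [← Matrix.mul_nonsing_inv (g v) (hg.2.2 v hv), Matrix.mul_apply]
    rw [pd_sum (fun a => (dg i a).fun_mul (dG a b))] at h1
    rw [← h1]
    exact Finset.sum_congr rfl fun a _ => (pd_mul (dg i a) (dG a b) j).symm
  have e2 : pd (fun v => g v i s) j u =
      - ∑ b, ∑ a, g u i a * pd (fun v => (g v)⁻¹ a b) j u * g u b s := by
    have h2 : ∑ b, (∑ a, (pd (fun v => g v i a) j u * (g u)⁻¹ a b
      + g u i a * pd (fun v => (g v)⁻¹ a b) j u)) * g u b s = 0 := by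
      simp only [e1, zero_mul, Finset.sum_const_zero]
    have h3 : ∑ b, (∑ a, pd (fun v => g v i a) j u * (g u)⁻¹ a b) * g u b s
        = pd (fun v => g v i s) j u := by
      have := Matrix.nonsing_inv_mul (g u) (hg.2.2 u hu)
      simp only [Finset.sum_mul, mul_assoc]
      rw [Finset.sum_comm]
      simp only [← Finset.mul_sum, ← Matrix.mul_apply, this, Matrix.one_apply]
      simp
    simp only [Finset.sum_add_distrib, add_mul] at h2
    rw [h3] at h2
    simp only [Finset.sum_mul] at h2
    linarith
  have e3 : ∀ p, christoffel g i j p u * g u p s = ∑ a, g u i a * (1/2 * (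
     pd (fun v => (g v)⁻¹ a p) j u + pd (fun v => (g v)⁻¹ j a) p u -
      pd (fun v => (g v)⁻¹ j p) a u)) * g u p s := by
    intro p
    unfold christoffel
    rw [Finset.mul_sum, Finset.sum_mul]
    exact Finset.sum_congr rfl fun a _ => by ring
  have e4 : ∀ p, g u i p * christoffel g s j p u = ∑ a, g u i p * (1/2 * (
     pd (fun v => (g v)⁻¹ p a) j u + pd (fun v => (g v)⁻¹ j a) p u -
      pd (fun v => (g v)⁻¹ j p) a u)) * g u a s := by
    intro p
    unfold christoffel
    rw [Finset.mul_sum, Finset.mul_sum]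
    refine Finset.sum_congr rfl fun a _ => ?_
    rw [pd_congr hU (fun v hv => inv_symm hg hv a p) hu j, gs s a]
    ring
  rw [e2, Finset.sum_congr rfl fun p _ => e3 p, Finset.sum_congr rfl fun p _ => e4 p]
  rw [Finset.sum_comm (f := fun p a => g u i p * (1/2 * (
     pd (fun v => (g v)⁻¹ p a) j u + pd (fun v => (g v)⁻¹ j a) p u -
      pd (fun v => (g v)⁻¹ j p) a u)) * g u a s)]
  rw [← Finset.sum_neg_distrib, ← Finset.sum_neg_distrib, ← Finset.sum_sub_distrib]
  refine Finset.sum_congr rfl fun b _ => ?_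
  rw [← Finset.sum_neg_distrib, ← Finset.sum_neg_distrib, ← Finset.sum_sub_distrib]
  exact Finset.sum_congr rfl fun a _ => by ring

/-- The Hessian of `h`. -/
noncomputable def hess (g : MetF N) (h : (Fin N → ℝ) → ℝ) (s k : Fin N) (u : Fin N → ℝ) : ℝ :=
  pd (pd h k) s u - ∑ p, christoffel g p s k u * pd h p u

lemma sm_hess (hU : IsOpen U) {g : MetF N} (hg : IsMetricOn g U) {h : (Fin N → ℝ) → ℝ}
    (hh : ContDiffOn ℝ (⊤ : ℕ∞) h U) (s k : Fin N) :
    ContDiffOn ℝ (⊤ : ℕ∞) (hess g h s k) U :=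
  (sm_pd hU (sm_pd hU hh _) _).sub
    (ContDiffOn.sum fun p _ => (sm_chr hU hg _ _ _).mul (sm_pd hU hh _))

lemma ricci (hU : IsOpen U) {g : MetF N} (hg : IsMetricOn g U) {h : (Fin N → ℝ) → ℝ}
    (hh : ContDiffOn ℝ (⊤ : ℕ∞) h U) {u : Fin N → ℝ} (hu : u ∈ U) (s j k : Fin N) :
    (pd (hess g h s k) j u - ∑ p, christoffel g p j s u * hess g h p k u) -
    (pd (hess g h s j) k u - ∑ p, christoffel g p k s u * hess g h p j u) =
      - ∑ p, curvature g p s j k u * pd h p u := by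
  have e1 : ∀ j k, pd (hess g h s k) j u = pd (pd (pd h k) s) j u -
      ∑ p, (pd (christoffel g p s k) j u * pd h p u + christoffel g p s k u * pd (pd h p) j u) := by
    intro j k
    have dp : ∀ p, DifferentiableAt ℝ (christoffel g p s k) u :=
      fun p => sm_diff hU (sm_chr hU hg _ _ _) hu
    have dh : ∀ p, DifferentiableAt ℝ (pd h p) u := fun p => sm_diff hU (sm_pd hU hh _) hu
    unfold hess
    rw [pd_sub (sm_diff hU (sm_pd hU (sm_pd hU hh _) _) hu)
      (DifferentiableAt.fun_sum fun p _ => (dp p).fun_mul (dh p)), pd_sum fun p => (dp p).fun_mul (dh p)]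
    congr 1
    exact Finset.sum_congr rfl fun p _ => pd_mul (dp p) (dh p) j
  have e2 : pd (pd (pd h k) s) j u = pd (pd (pd h j) s) k u := by
    rw [pd_comm hU (sm_pd hU hh k) hu s j, pd_congr hU (fun v hv => pd_comm hU hh hv k j) hu s,
      pd_comm hU (sm_pd hU hh j) hu k s]
  have e3 : ∀ j k, ∑ p, christoffel g p j s u * hess g h p k u =
      ∑ p, christoffel g p s j u * pd (pd h p) k u -
      ∑ q, (∑ p, christoffel g q p k u * christoffel g p s j u) * pd h q u := by
    intro j k
    unfold hess
    simp only [mul_sub, Finset.sum_sub_distrib, Finset.mul_sum, Finset.sum_mul]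
    congr 1
    · exact Finset.sum_congr rfl fun p _ => by
        rw [chr_symm hU hg hu p j s, pd_comm hU hh hu k p]
    · rw [Finset.sum_comm]
      exact Finset.sum_congr rfl fun p _ => Finset.sum_congr rfl fun q _ => by
        rw [chr_symm hU hg hu q j s]; ring
  rw [e1, e1, e3, e3, e2]
  unfold curvature
  simp only [add_mul, sub_mul, Finset.sum_add_distrib, Finset.sum_sub_distrib]
  ring

lemma sum_covA (hU : IsOpen U) {g : MetF N} (hg : IsMetricOn g U) {h : (Fin N → ℝ) → ℝ}
    (hh : ContDiffOn ℝ (⊤ : ℕ∞) h U) {u : Fin N → ℝ} (hu : u ∈ U) (i j k : Fin N) :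
    pd (fun v => ∑ s, g v i s * hess g h s k v) j u
      + ∑ s, christoffel g i j s u * ∑ p, g u s p * hess g h p k u
    = ∑ s, g u i s * (pd (hess g h s k) j u - ∑ p, christoffel g p j s u * hess g h p k u) := by
  have dg : ∀ s, DifferentiableAt ℝ (fun v => g v i s) u := fun s => sm_diff hU (hg.1 _ _) hu
  have dH : ∀ s, DifferentiableAt ℝ (hess g h s k) u :=
    fun s => sm_diff hU (sm_hess hU hg hh _ _) hu
  rw [pd_sum fun s => (dg s).fun_mul (dH s)]
  rw [Finset.sum_congr rfl fun s _ => pd_mul (dg s) (dH s) j]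
  simp only [pd_metric hU hg hu, sub_mul, neg_mul, add_mul, mul_sub, Finset.sum_add_distrib,
    Finset.sum_sub_distrib, Finset.sum_neg_distrib, Finset.sum_mul, Finset.mul_sum]
  rw [Finset.sum_comm (f := fun x y => christoffel g i j y u * g u y x * hess g h x k u),
    Finset.sum_comm (f := fun x y => g u i y * christoffel g x j y u * hess g h x k u)]
  simp only [mul_assoc]
  ring

end Helpers

/-- Under Ferapontov's conditions (i)–(iv) on `(g, w_n, μ^{mn})` and the relations
`Σ_j (w_n)^j_s ∂h/∂u^j = ∂f_n/∂u^s`, the non-locally Hamiltonian affinor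
`V^i_j = Σ_s g^{is}(∂²h/∂u^s∂u^j − Σ_p Γ^p_{sj} ∂h/∂u^p) + Σ_{m,n} μ^{mn} (w_m)^i_j f_n`
satisfies `∇_j V^i_k = ∇_k V^i_j`. -/
theorem nonlocally_hamiltonian_affinor_covariant_symmetric {N L : ℕ} (hL : 1 ≤ L)
    (U : Set (Fin N → ℝ)) (hU : IsOpen U)
    (g : MetF N) (hg : IsMetricOn g U)
    (μ : Fin L → Fin L → ℝ) (hμ : ∀ m n, μ m n = μ n m)
    (w : Fin L → MetF N)
    (hwsm : ∀ n i j, ContDiffOn ℝ (⊤ : ℕ∞) (fun u => w n u i j) U)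
    -- (i) symmetry of the affinors with respect to the metric
    (hwsymm : ∀ u ∈ U, ∀ (n : Fin L) (i j : Fin N),
      ∑ s, g u i s * w n u j s = ∑ s, g u j s * w n u i s)
    -- (ii) symmetry of the covariant derivatives
    (hwcov : ∀ u ∈ U, ∀ (n : Fin L) (i j k : Fin N),
      covDeriv g (w n) k i j u = covDeriv g (w n) j i k u)
    -- (iii) commutativity of the family of affinors
    (hwcomm : ∀ u ∈ U, ∀ (m n : Fin L) (i j : Fin N),
      ∑ s, w m u i s * w n u s j = ∑ s, w n u i s * w m u s j)
    -- (iv) the Gauss equation for the curvature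
    (hgauss : ∀ u ∈ U, ∀ i j k l : Fin N,
      curvatureR g i j k l u =
        ∑ m, ∑ n, μ m n * (w m u i l * w n u j k - w m u j l * w n u i k))
    (h : (Fin N → ℝ) → ℝ) (f : Fin L → (Fin N → ℝ) → ℝ)
    (hhsm : ContDiffOn ℝ (⊤ : ℕ∞) h U) (hfsm : ∀ n, ContDiffOn ℝ (⊤ : ℕ∞) (f n) U)
    (hstr : ∀ u ∈ U, ∀ (n : Fin L) (s : Fin N),
      ∑ j, w n u j s * pd h j u = pd (f n) s u)
    (V : MetF N)
    (hV : ∀ u ∈ U, ∀ i j : Fin N, V u i j =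
      (∑ s, g u i s * (pd (pd h j) s u - ∑ p, christoffel g p s j u * pd h p u)) +
        ∑ m, ∑ n, μ m n * w m u i j * f n u) :
    ∀ u ∈ U, ∀ i j k : Fin N, covDeriv g V j i k u = covDeriv g V k i j u := by
  intro u hu i j k
  have dw : ∀ m i k, DifferentiableAt ℝ (fun v => w m v i k) u :=
    fun m i k => sm_diff hU (hwsm m i k) hu
  have df : ∀ n, DifferentiableAt ℝ (f n) u := fun n => sm_diff hU (hfsm n) hu
  have dA : ∀ k, DifferentiableAt ℝ (fun v => ∑ s, g v i s * hess g h s k v) u := fun k =>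
    DifferentiableAt.fun_sum fun s _ =>
      (sm_diff hU (hg.1 _ _) hu).mul (sm_diff hU (sm_hess hU hg hhsm _ _) hu)
  have dT : ∀ m n k, DifferentiableAt ℝ (fun v => μ m n * w m v i k * f n v) u := fun m n k =>
    ((differentiableAt_const _).fun_mul (dw m i k)).mul (df n)
  have dS : ∀ m k, DifferentiableAt ℝ (fun v => ∑ n, μ m n * w m v i k * f n v) u := fun m k =>
    DifferentiableAt.fun_sum fun n _ => dT m n k
  -- split of the covariant derivative
  have split : ∀ j k, covDeriv g V j i k u =
      (∑ s, g u i s * (pd (hess g h s k) j u - ∑ p, christoffel g p j s u * hess g h p k u))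
      + (∑ m, ∑ n, μ m n * ((covDeriv g (w m) j i k u
          + ∑ s, christoffel g s j k u * w m u i s) * f n u + w m u i k * pd (f n) j u))
      - ∑ s, christoffel g s j k u * V u i s := by
    intro j k
    rw [← sum_covA hU hg hhsm hu i j k]
    have e1 : pd (fun v => V v i k) j u = pd (fun v => ∑ s, g v i s * hess g h s k v) j u
        + ∑ m, ∑ n, μ m n * (pd (fun v => w m v i k) j u * f n u + w m u i k * pd (f n) j u) := by
      rw [pd_congr hU (fun v hv => hV v hv i k) hu j]
      have := pd_add (dA k) (DifferentiableAt.fun_sum fun m (_ : m ∈ Finset.univ) => dS m k) j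
      refine this.trans ?_
      congr 1
      rw [pd_sum fun m => dS m k]
      refine Finset.sum_congr rfl fun m _ => ?_
      rw [pd_sum fun n => dT m n k]
      refine Finset.sum_congr rfl fun n _ => ?_
      rw [pd_mul ((differentiableAt_const _).fun_mul (dw m i k)) (df n),
        pd_mul (differentiableAt_const _) (dw m i k), pd_const]
      ring
    have e2 : ∑ s, christoffel g i j s u * V u s k =
        ∑ s, christoffel g i j s u * ∑ p, g u s p * hess g h p k u
        + ∑ m, ∑ n, μ m n * ((∑ s, christoffel g i j s u * w m u s k) * f n u) := by
      simp only [hV u hu, mul_add, Finset.sum_add_distrib]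
      congr 1
      simp only [Finset.mul_sum, Finset.sum_mul]
      rw [Finset.sum_comm]
      refine Finset.sum_congr rfl fun m _ => ?_
      rw [Finset.sum_comm]
      exact Finset.sum_congr rfl fun n _ => Finset.sum_congr rfl fun s _ => by ring
    have e3 : ∀ m, covDeriv g (w m) j i k u + ∑ s, christoffel g s j k u * w m u i s =
        pd (fun v => w m v i k) j u + ∑ s, christoffel g i j s u * w m u s k := by
      intro m
      unfold covDeriv
      rw [Finset.sum_sub_distrib]; ring
    simp only [e3]
    unfold covDeriv
    rw [Finset.sum_sub_distrib, e1, e2]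
    simp only [mul_add, add_mul, Finset.sum_add_distrib]
    ring
  have gaussC : ∑ s, g u i s * ∑ p, curvature g p s j k u * pd h p u =
      ∑ m, ∑ n, μ m n * (w m u i k * pd (f n) j u - w n u i j * pd (f m) k u) := by
    have h1 : ∑ s, g u i s * ∑ p, curvature g p s j k u * pd h p u =
        ∑ p, curvatureR g i p j k u * pd h p u := by
      unfold curvatureR
      simp only [Finset.mul_sum, Finset.sum_mul]
      rw [Finset.sum_comm]
      simp only [mul_assoc]
    rw [h1]
    simp only [hgauss u hu, ← hstr u hu, Finset.mul_sum, Finset.sum_mul, ← Finset.sum_sub_distrib]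
    rw [Finset.sum_comm]
    refine Finset.sum_congr rfl fun m _ => ?_
    rw [Finset.sum_comm]
    exact Finset.sum_congr rfl fun n _ => Finset.sum_congr rfl fun s _ => by ring
  have swap : ∑ m, ∑ n, μ m n * (w n u i j * pd (f m) k u) =
      ∑ m, ∑ n, μ m n * (w m u i j * pd (f n) k u) := by
    rw [Finset.sum_comm]
    exact Finset.sum_congr rfl fun m _ => Finset.sum_congr rfl fun n _ => by rw [hμ n m]
  have ric : (∑ s, g u i s * (pd (hess g h s k) j u - ∑ p, christoffel g p j s u * hess g h p k u))
      - (∑ s, g u i s * (pd (hess g h s j) k u - ∑ p, christoffel g p k s u * hess g h p j u))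
      = - ∑ s, g u i s * ∑ p, curvature g p s j k u * pd h p u := by
    rw [← Finset.sum_sub_distrib, ← Finset.sum_neg_distrib]
    refine Finset.sum_congr rfl fun s _ => ?_
    rw [← mul_sub, ricci hU hg hhsm hu s j k]
    ring
  rw [gaussC] at ric
  have cs : ∀ s, christoffel g s k j u = christoffel g s j k u :=
    fun s => chr_symm hU hg hu s k j
  rw [split j k, split k j]
  simp only [cs, hwcov u hu _ i k j]
  simp only [mul_add, mul_sub, Finset.sum_add_distrib, Finset.sum_sub_distrib] at ric swap ⊢
  linarith
end
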